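/- Let f be a dominant pseudo polynomial of degree θ > 3, set ρ = 1/(8θ² + 12θ + 10), and let 0 < ρ̃ < ρ/3. Then for every ε > 0 there is a constant C > 0 such that for all sufficiently large X and every integer m with 2 ≤ m ≤ X^{ρ̃}, there exists a prime p ≤ C·X^{1/3+ε} such that m divides ⌊f(p)⌋. -/

import Mathlib

open Finset Filter

noncomputable section

/-- `f` is a dominant pseudo polynomial of degree `Θ`: it has the form
`f x = ∑ j, α j * x ^ θ j` with positive coefficients, strictly increasing exponents
`1 ≤ θ 0 < θ 1 < ⋯`, and the largest exponent equals `Θ` and is not an integer. -/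
def IsDominantPseudoPoly (f : ℝ → ℝ) (Θ : ℝ) : Prop :=
  ∃ (d : ℕ) (α θ : Fin (d + 1) → ℝ),
    (∀ j, 0 < α j) ∧ StrictMono θ ∧ 1 ≤ θ 0 ∧
    θ (Fin.last d) = Θ ∧ (∀ z : ℤ, (z : ℝ) ≠ Θ) ∧
    ∀ x : ℝ, f x = ∑ j, α j * x ^ θ j

section PrimeModulus

variable {p : ℕ} [Fact p.Prime]

theorem sum_rpow_sum_le {ι X : Type*} (I : Finset ι) (Y : Finset X) (g : ι → X → ℝ)
    (hg : ∀ i x, 0 ≤ g i x) {s : ℝ} (hs : 1 ≤ s) :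
    ∑ x ∈ Y, (∑ i ∈ I, g i x ^ (1 / s)) ^ s ≤ (∑ i ∈ I, (∑ x ∈ Y, g i x) ^ (1 / s)) ^ s := by
  classical
  have hs0 : 0 < s := by linarith
  have key : (∑ x ∈ Y, (∑ i ∈ I, g i x ^ (1 / s)) ^ s) ^ (1 / s) ≤
      ∑ i ∈ I, (∑ x ∈ Y, g i x) ^ (1 / s) := by
    induction I using Finset.induction_on with
    | empty => simp [Real.zero_rpow hs0.ne', Real.zero_rpow (inv_pos.mpr hs0).ne']
    | insert i I hi ih =>
      have h1 := Real.Lp_add_le_of_nonneg Y (f := fun x => g i x ^ (1 / s))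
        (g := fun x => ∑ i ∈ I, g i x ^ (1 / s)) hs
        (fun x _ => Real.rpow_nonneg (hg _ _) _)
        (fun x _ => Finset.sum_nonneg fun i _ => Real.rpow_nonneg (hg _ _) _)
      simp only [Finset.sum_insert hi]
      refine h1.trans (add_le_add (le_of_eq ?_) ih)
      congr 1
      refine Finset.sum_congr rfl fun x _ => ?_
      rw [← Real.rpow_mul (hg _ _), one_div_mul_cancel hs0.ne', Real.rpow_one]
  have h0 : 0 ≤ ∑ x ∈ Y, (∑ i ∈ I, g i x ^ (1 / s)) ^ s :=
    Finset.sum_nonneg fun x _ => Real.rpow_nonneg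
      (Finset.sum_nonneg fun i _ => Real.rpow_nonneg (hg _ _) _) _
  have := Real.rpow_le_rpow (Real.rpow_nonneg h0 _) key hs0.le
  rwa [← Real.rpow_mul h0, one_div_mul_cancel hs0.ne', Real.rpow_one] at this

instance neZero_prime_pow (B : ℕ) : NeZero (p ^ B) :=
  ⟨pow_ne_zero _ (Fact.out : p.Prime).ne_zero⟩

/-- The character `x ↦ exp (2 π i x / p ^ B)` of the `p`-adic integers. -/
def padicChar (B : ℕ) (x : ℤ_[p]) : ℂ := ZMod.stdAddChar (PadicInt.toZModPow B x)

theorem padicChar_add (B : ℕ) (x y : ℤ_[p]) :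
    padicChar B (x + y) = padicChar B x * padicChar B y := by
  simp [padicChar, AddChar.map_add_eq_mul]

theorem norm_padicChar (B : ℕ) (x : ℤ_[p]) : ‖padicChar B x‖ = 1 := by
  simp [padicChar]

theorem padicChar_congr {B : ℕ} {x y : ℤ_[p]} (h : (p : ℤ_[p]) ^ B ∣ x - y) :
    padicChar B x = padicChar B y := by
  have : PadicInt.toZModPow B (x - y) = 0 := by
    rw [← RingHom.mem_ker, PadicInt.ker_toZModPow, Ideal.mem_span_singleton]; exact h
  rw [map_sub, sub_eq_zero] at this
  simp [padicChar, this]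

theorem padicChar_natCast (B n : ℕ) :
    padicChar B (n : ℤ_[p]) = Complex.exp (2 * Real.pi * Complex.I * n / (p ^ B : ℕ)) := by
  have := ZMod.stdAddChar_coe (N := p ^ B) (n : ℤ)
  simp only [padicChar, map_natCast]
  simpa using this

theorem exists_nat_padic (B : ℕ) (x : ℤ_[p]) : ∃ n : ℕ, (p : ℤ_[p]) ^ B ∣ x - n :=
  ⟨x.appr B, by rw [← Ideal.mem_span_singleton]; exact PadicInt.appr_spec B x⟩

theorem padicChar_mul_pow (B m : ℕ) (x : ℤ_[p]) :
    padicChar (B + m) ((p : ℤ_[p]) ^ m * x) = padicChar B x := by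
  obtain ⟨n, y, hn⟩ := exists_nat_padic B x
  rw [padicChar_congr (B := B) (x := x) (y := n) ⟨y, hn⟩,
    padicChar_congr (B := B + m) (y := ((p ^ m * n : ℕ) : ℤ_[p])), padicChar_natCast,
    padicChar_natCast]
  · congr 1
    have hp : (p : ℂ) ≠ 0 := by exact_mod_cast (Fact.out : p.Prime).ne_zero
    push_cast
    rw [pow_add]
    field_simp
  · refine ⟨y, ?_⟩
    push_cast
    rw [← mul_sub, hn]; ring

variable (p) in
/-- Linear phases attached to a frequency `x` modulo `p ^ B`. -/
def phase {k : ℕ} (B : ℕ) (x : Fin k → ZMod (p ^ B)) (v : Fin k → ℤ_[p]) : ℂ :=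
  padicChar B (∑ j, ((x j).val : ℤ_[p]) * v j)

theorem norm_phase {k : ℕ} (B : ℕ) (x : Fin k → ZMod (p ^ B)) (v : Fin k → ℤ_[p]) :
    ‖phase p B x v‖ = 1 := norm_padicChar _ _

theorem phase_add {k : ℕ} (B : ℕ) (x : Fin k → ZMod (p ^ B)) (y v : Fin k → ℤ_[p]) :
    phase p B (fun j => x j + PadicInt.toZModPow B (y j)) v =
      phase p B x v * padicChar B (∑ j, y j * v j) := by
  have h : ∀ z : ZMod (p ^ B), ((z.val : ℕ) : ZMod (p ^ B)) = z := fun z => by simp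
  simp only [phase, padicChar, ← AddChar.map_add_eq_mul, map_sum, map_mul, map_natCast, h,
    ← Finset.sum_add_distrib, add_mul]

/-- Curves congruent to the moment curve modulo `p`. -/
def MomentLike {k : ℕ} (γ : Fin k → Polynomial ℤ_[p]) : Prop :=
  ∀ j, ∃ q, γ j = Polynomial.X ^ (j.val + 1) + Polynomial.C (p : ℤ_[p]) * q

/-- The critical exponent is `2 * critExp k = k * (k + 1)`. -/
def critExp (k : ℕ) : ℕ := k * (k + 1) / 2

theorem two_mul_critExp (k : ℕ) : 2 * critExp k = k * (k + 1) :=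
  Nat.mul_div_cancel' (Nat.even_mul_succ_self k).two_dvd

theorem critExp_pos {k : ℕ} (hk : 1 ≤ k) : 1 ≤ critExp k := by
  have := two_mul_critExp k
  nlinarith

/-- The part of `S` on which `u` lies in a given residue class modulo `p ^ n`. -/
def cell (S : Finset ℕ) (u : ℕ → ℤ_[p]) (n : ℕ) (J : ZMod (p ^ n)) : Finset ℕ :=
  S.filter fun t => PadicInt.toZModPow n (u t) = J

/-- Exponential sum along a curve. -/
def expSum {k : ℕ} (B : ℕ) (γ : Fin k → Polynomial ℤ_[p]) (u : ℕ → ℤ_[p]) (a : ℕ → ℂ)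
    (S : Finset ℕ) (x : Fin k → ZMod (p ^ B)) : ℂ :=
  ∑ t ∈ S, a t * phase p B x (fun j => (γ j).eval (u t))

/-- The moment of critical order. -/
def moment {k : ℕ} (B : ℕ) (γ : Fin k → Polynomial ℤ_[p]) (u : ℕ → ℤ_[p]) (a : ℕ → ℂ)
    (S : Finset ℕ) : ℝ :=
  ∑ x, ‖expSum B γ u a S x‖ ^ (2 * critExp k)

/-- The `ℓ²` sum over the cells of level `n`. -/
def cellNorm {k : ℕ} (n : ℕ) (γ : Fin k → Polynomial ℤ_[p]) (u : ℕ → ℤ_[p]) (a : ℕ → ℂ)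
    (S : Finset ℕ) : ℝ :=
  ∑ J : ZMod (p ^ n), moment (k * n) γ u a (cell S u n J) ^ (1 / (critExp k : ℝ))

variable (p) in
/-- `ℓ²` decoupling at level `n` with constant `K`. -/
def Dec (k n : ℕ) (K : ℝ) : Prop :=
  ∀ γ : Fin k → Polynomial ℤ_[p], MomentLike γ → ∀ (u : ℕ → ℤ_[p]) (a : ℕ → ℂ) (S : Finset ℕ),
    moment (k * n) γ u a S ≤ K * cellNorm n γ u a S ^ critExp k

theorem moment_nonneg {k : ℕ} (B : ℕ) (γ : Fin k → Polynomial ℤ_[p]) (u : ℕ → ℤ_[p]) (a : ℕ → ℂ)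
    (S : Finset ℕ) : 0 ≤ moment B γ u a S :=
  Finset.sum_nonneg fun _ _ => by positivity

theorem cellNorm_nonneg {k : ℕ} (n : ℕ) (γ : Fin k → Polynomial ℤ_[p]) (u : ℕ → ℤ_[p])
    (a : ℕ → ℂ) (S : Finset ℕ) : 0 ≤ cellNorm n γ u a S :=
  Finset.sum_nonneg fun _ _ => Real.rpow_nonneg (moment_nonneg _ _ _ _ _) _

theorem decouple_on {l n : ℕ} (hl : 1 ≤ l) {K : ℝ} (hK : 0 ≤ K) (hD : Dec p l n K)
    {Ω : Type*} [Fintype Ω] [AddCommGroup Ω] (w : Ω → ℝ) (hw : ∀ x, 0 ≤ w x)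
    (F : ℕ → Ω → ℂ) (S : Finset ℕ) (u : ℕ → ℤ_[p]) (γ : Fin l → Polynomial ℤ_[p])
    (hγ : MomentLike γ) (L : (Fin l → ZMod (p ^ (l * n))) → Ω)
    (χ : (Fin l → ZMod (p ^ (l * n))) → ℂ) (hχ : ∀ z, ‖χ z‖ = 1)
    (hF : ∀ t ∈ S, ∀ x z, F t (x + L z) =
      χ z * phase p (l * n) z (fun j => (γ j).eval (u t)) * F t x)
    (hwL : ∀ x z, w (x + L z) = w x) :
    ∑ x, w x * ‖∑ t ∈ S, F t x‖ ^ (2 * critExp l) ≤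
      K * (∑ J : ZMod (p ^ n), (∑ x, w x * ‖∑ t ∈ cell S u n J, F t x‖ ^ (2 * critExp l)) ^
        (1 / (critExp l : ℝ))) ^ critExp l := by
  set s := critExp l with hs
  have hs1 : 1 ≤ s := critExp_pos hl
  have hsr : (1 : ℝ) ≤ s := by exact_mod_cast hs1
  set Z := Fintype.card (Fin l → ZMod (p ^ (l * n))) with hZ
  have hZ0 : (0 : ℝ) < Z := by
    have : 0 < Z := Fintype.card_pos
    exact_mod_cast this
  have avg : ∀ T ⊆ S, ∑ x, w x * moment (l * n) γ u (fun t => F t x) T =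
      Z * ∑ x, w x * ‖∑ t ∈ T, F t x‖ ^ (2 * s) := by
    intro T hT
    simp only [moment, Finset.mul_sum]
    rw [Finset.sum_comm]
    have : ∀ z : Fin l → ZMod (p ^ (l * n)),
        ∑ x, w x * ‖expSum (l * n) γ u (fun t => F t x) T z‖ ^ (2 * s) =
        ∑ x, w x * ‖∑ t ∈ T, F t x‖ ^ (2 * s) := by
      intro z
      rw [← Equiv.sum_comp (Equiv.addRight (L z)) (fun x => w x * ‖∑ t ∈ T, F t x‖ ^ (2 * s))]
      refine Finset.sum_congr rfl fun x _ => ?_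
      simp only [Equiv.coe_addRight]
      rw [hwL, Finset.sum_congr rfl fun t ht => hF t (hT ht) x z]
      simp only [mul_assoc]
      rw [← Finset.mul_sum, norm_mul, hχ, one_mul]
      simp only [expSum, mul_comm]
    rw [Finset.sum_congr rfl fun z _ => this z]
    simp only [Finset.sum_const, Finset.card_univ, nsmul_eq_mul, ← Finset.mul_sum]
    rfl
  have hcell : ∀ J, cell S u n J ⊆ S := fun J => Finset.filter_subset _ _
  have step : (Z : ℝ) * ∑ x, w x * ‖∑ t ∈ S, F t x‖ ^ (2 * s) ≤
      K * (∑ J : ZMod (p ^ n), (Z * ∑ x, w x * ‖∑ t ∈ cell S u n J, F t x‖ ^ (2 * s)) ^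
        (1 / (s : ℝ))) ^ s := by
    rw [← avg S subset_rfl]
    simp only [← fun J => avg _ (hcell J)]
    have h1 := sum_rpow_sum_le (Finset.univ : Finset (ZMod (p ^ n))) (Finset.univ : Finset Ω)
      (fun J x => w x * moment (l * n) γ u (fun t => F t x) (cell S u n J))
      (fun J x => mul_nonneg (hw x) (moment_nonneg _ _ _ _ _)) hsr
    simp only [Real.rpow_natCast] at h1
    refine le_trans ?_ (mul_le_mul_of_nonneg_left h1 hK)
    rw [Finset.mul_sum]
    refine Finset.sum_le_sum fun x _ => ?_
    refine (mul_le_mul_of_nonneg_left (hD γ hγ u (fun t => F t x) S) (hw x)).trans (le_of_eq ?_)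
    rw [mul_left_comm]
    congr 1
    have : ∀ J, (w x * moment (l * n) γ u (fun t => F t x) (cell S u n J)) ^ (1 / (s : ℝ)) =
        w x ^ (1 / (s : ℝ)) * moment (l * n) γ u (fun t => F t x) (cell S u n J) ^ (1 / (s : ℝ)) :=
      fun J => Real.mul_rpow (hw x) (moment_nonneg _ _ _ _ _)
    simp only [this, ← Finset.mul_sum, mul_pow]
    rw [← Real.rpow_natCast (w x ^ (1 / (s : ℝ))), ← Real.rpow_mul (hw x),
      one_div_mul_cancel (by positivity), Real.rpow_one]
    rfl
  have h2 : (∑ J : ZMod (p ^ n), (Z * ∑ x, w x * ‖∑ t ∈ cell S u n J, F t x‖ ^ (2 * s)) ^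
        (1 / (s : ℝ))) ^ s = Z * (∑ J : ZMod (p ^ n),
        (∑ x, w x * ‖∑ t ∈ cell S u n J, F t x‖ ^ (2 * s)) ^ (1 / (s : ℝ))) ^ s := by
    have : ∀ J, (Z * ∑ x, w x * ‖∑ t ∈ cell S u n J, F t x‖ ^ (2 * s)) ^ (1 / (s : ℝ)) =
        (Z : ℝ) ^ (1 / (s : ℝ)) *
          (∑ x, w x * ‖∑ t ∈ cell S u n J, F t x‖ ^ (2 * s)) ^ (1 / (s : ℝ)) :=
      fun J => Real.mul_rpow hZ0.le (Finset.sum_nonneg fun x _ => mul_nonneg (hw x) (by positivity))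
    simp only [this, ← Finset.mul_sum, mul_pow]
    rw [← Real.rpow_natCast ((Z : ℝ) ^ (1 / (s : ℝ))), ← Real.rpow_mul hZ0.le,
      one_div_mul_cancel (by positivity), Real.rpow_one]
  rw [h2, mul_left_comm] at step
  exact le_of_mul_le_mul_left step hZ0

open Polynomial in
theorem eq_zero_of_taylor_coeff_eq_zero {F : Type*} [Field F] {l d : ℕ} (c : F)
    (hc : c ≠ 0 ∨ d = 0) (hchar : ∀ i : ℕ, i ≤ d + l → 0 < i → (i : F) ≠ 0) (y : Fin l → F)
    (hy : ∀ j : Fin l, (taylor c (∑ r, C (y r) * X ^ (d + r.val + 1))).coeff (j.val + 1) = 0) :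
    y = 0 := by
  set P := ∑ r, C (y r) * X ^ (d + r.val + 1) with hP
  set R := ∑ r : Fin l, C (y r * ((d + r.val + 1 : ℕ) : F)) * X ^ r.val with hR
  have hd : derivative P = X ^ d * R := by
    rw [hP, hR, derivative_sum, Finset.mul_sum]
    refine Finset.sum_congr rfl fun r _ => ?_
    rw [derivative_C_mul, derivative_X_pow]
    simp only [Nat.add_sub_cancel, map_mul, pow_add, map_natCast]
    ring
  have h1 : (X - C c) ^ l ∣ derivative P := by
    have h2 : X ^ l ∣ taylor c (derivative P) := by
      rw [X_pow_dvd_iff]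
      intro j hj
      have h3 : taylor c (derivative P) = derivative (taylor c P) := by
        simp [taylor_apply, derivative_comp]
      rw [h3, coeff_derivative, hy ⟨j, hj⟩, zero_mul]
    obtain ⟨Q, hQ⟩ := h2
    refine ⟨taylor (-c) Q, ?_⟩
    have := congrArg (taylor (-c)) hQ
    rw [taylor_taylor, neg_add_cancel, taylor_zero] at this
    rw [this, taylor_mul, taylor_X_pow]
    simp [sub_eq_add_neg]
  have h2 : (X - C c) ^ l ∣ R := by
    rcases hc with hc | hc
    · refine (IsCoprime.pow (n := d) ?_).dvd_of_dvd_mul_left (hd ▸ h1)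
      have := isCoprime_X_sub_C_of_isUnit_sub (R := F) (a := c) (b := 0) (by simpa using hc)
      simpa using this
    · simpa [hd, hc] using h1
  have hR0 : R = 0 := by
    refine eq_zero_of_dvd_of_degree_lt h2 ?_
    rw [degree_pow, degree_X_sub_C]
    refine (Polynomial.degree_sum_fin_lt (fun r : Fin l => y r * ((d + r.val + 1 : ℕ) : F))).trans_le ?_
    simp
  funext r
  have h4 := congrArg (fun q => q.coeff r.val) hR0
  simp only [hR, finsetSum_coeff, coeff_C_mul, coeff_X_pow, coeff_zero] at h4
  rw [Finset.sum_eq_single r] at h4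
  · simp only [if_true, mul_one] at h4
    rcases mul_eq_zero.mp h4 with h | h
    · exact h
    · exact absurd h (hchar _ (by omega) (by omega))
  · intro b _ hb
    have : r.val ≠ b.val := fun h => hb (Fin.ext h.symm)
    simp [this]
  · simp

/-- The matrix of Taylor coefficients of a curve. -/
def hasse {l : ℕ} (φ : Fin l → Polynomial ℤ_[p]) (c : ℤ_[p]) : Matrix (Fin l) (Fin l) ℤ_[p] :=
  Matrix.of fun r j => (Polynomial.taylor c (φ r)).coeff (j.val + 1)

theorem padicInt_toZMod_eq_zero {x : ℤ_[p]} : PadicInt.toZMod x = 0 ↔ (p : ℤ_[p]) ∣ x := by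
  rw [← RingHom.mem_ker, PadicInt.ker_toZMod, PadicInt.maximalIdeal_eq_span_p,
    Ideal.mem_span_singleton]

theorem padicInt_isUnit_iff {x : ℤ_[p]} : IsUnit x ↔ ¬ (p : ℤ_[p]) ∣ x := by
  rw [← padicInt_toZMod_eq_zero, ← RingHom.mem_ker, PadicInt.ker_toZMod,
    IsLocalRing.mem_maximalIdeal, mem_nonunits_iff, not_not]

open Polynomial in
theorem isUnit_det_hasse {l d : ℕ} (hp : d + l < p) (φ : Fin l → Polynomial ℤ_[p])
    (hφ : ∀ r, C (p : ℤ_[p]) ∣ φ r - X ^ (d + r.val + 1)) (c : ℤ_[p])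
    (hc : ¬ (p : ℤ_[p]) ∣ c ∨ d = 0) : IsUnit (hasse φ c).det := by
  rw [padicInt_isUnit_iff, ← padicInt_toZMod_eq_zero, RingHom.map_det]
  intro h0
  obtain ⟨y, hy0, hy⟩ := Matrix.exists_vecMul_eq_zero_iff.mpr h0
  refine hy0 (eq_zero_of_taylor_coeff_eq_zero (d := d) (PadicInt.toZMod c) ?_ ?_ y fun j => ?_)
  · rwa [Ne, padicInt_toZMod_eq_zero]
  · intro i hi hi0 h
    rw [ZMod.natCast_eq_zero_iff] at h
    exact absurd (Nat.le_of_dvd hi0 h) (by omega)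
  · have h1 := congrFun hy j
    simp only [Matrix.vecMul, dotProduct, Pi.zero_apply, RingHom.mapMatrix_apply, Matrix.map_apply,
      hasse, Matrix.of_apply] at h1
    rw [map_sum, finsetSum_coeff, ← h1]
    refine Finset.sum_congr rfl fun r _ => ?_
    obtain ⟨q, hq⟩ := hφ r
    rw [sub_eq_iff_eq_add] at hq
    rw [taylor_mul, taylor_C, coeff_C_mul, hq, map_add, taylor_mul, taylor_C, coeff_add,
      coeff_C_mul, map_add, map_mul]
    have : PadicInt.toZMod ((p : ℤ_[p])) = 0 := padicInt_toZMod_eq_zero.mpr dvd_rfl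
    rw [this, zero_mul, zero_add]
    congr 1
    rw [taylor_X_pow, taylor_X_pow, coeff_X_add_C_pow, coeff_X_add_C_pow]
    simp

open Polynomial in
theorem exists_recenter {l : ℕ} (φ : Fin l → Polynomial ℤ_[p]) (c : ℤ_[p])
    (hdet : IsUnit (hasse φ c).det) :
    ∃ (ψ : Fin l → Polynomial ℤ_[p]) (L : (Fin l → ℤ_[p]) → Fin l → ℤ_[p]),
      (∀ j, X ^ (l + 1) ∣ ψ j - X ^ (j.val + 1)) ∧
      (∀ y u, ∑ r, L y r * (φ r).eval u =
        ∑ r, L y r * (φ r).eval c + ∑ j, y j * (ψ j).eval (u - c)) ∧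
      ((∀ r : Fin l, C (p : ℤ_[p]) ∣ φ r - X ^ (r.val + 1)) →
        ∀ r : Fin l, C (p : ℤ_[p]) ∣ ψ r - X ^ (r.val + 1)) := by
  set M := hasse φ c with hM
  set ψ : Fin l → Polynomial ℤ_[p] := fun j =>
    ∑ r, C (M⁻¹ j r) * (taylor c (φ r) - C ((φ r).eval c)) with hψ
  have hcoef : ∀ j (i : Fin l), (ψ j).coeff (i.val + 1) = if j = i then 1 else 0 := by
    intro j i
    have h := congrFun (congrFun (Matrix.nonsing_inv_mul M hdet) j) i
    rw [Matrix.mul_apply, Matrix.one_apply] at h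
    rw [← h, hψ]
    simp only [finsetSum_coeff, coeff_C_mul, coeff_sub, coeff_C_succ, sub_zero]
    rfl
  have hcoef0 : ∀ j, (ψ j).coeff 0 = 0 := by
    intro j
    simp [hψ, taylor_coeff_zero]
  have hX : ∀ j, X ^ (l + 1) ∣ ψ j - X ^ (j.val + 1) := by
    intro j
    rw [X_pow_dvd_iff]
    rintro (_ | i) hi
    · simp [hcoef0]
    · rw [coeff_sub, hcoef j ⟨i, by omega⟩, coeff_X_pow]
      by_cases h : j.val = i
      · simp [h, Fin.ext_iff]
      · have : ¬ i = j.val := fun h' => h h'.symm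
        simp [h, this, Fin.ext_iff]
  refine ⟨ψ, fun y r => ∑ j, y j * M⁻¹ j r, hX, ?_, ?_⟩
  · intro y u
    have h1 : ∀ j, (ψ j).eval (u - c) = ∑ r, M⁻¹ j r * ((φ r).eval u - (φ r).eval c) := by
      intro j
      simp [hψ, eval_finsetSum, taylor_eval]
    simp only [h1, Finset.sum_mul, Finset.mul_sum]
    rw [Finset.sum_comm (f := fun j r => y j * (M⁻¹ j r * _)), ← Finset.sum_add_distrib]
    refine Finset.sum_congr rfl fun r _ => ?_
    rw [← Finset.sum_add_distrib]
    exact Finset.sum_congr rfl fun j _ => by ring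
  · intro hφ j
    rw [C_dvd_iff_dvd_coeff]
    intro i
    rcases lt_or_ge i (l + 1) with hi | hi
    · rw [X_pow_dvd_iff.mp (hX j) i hi]; exact dvd_zero _
    · have hj : (X ^ (j.val + 1) : ℤ_[p][X]).coeff i = 0 := by
        rw [coeff_X_pow, if_neg]; omega
      rw [coeff_sub, hj, sub_zero, hψ]
      simp only [finsetSum_coeff, coeff_C_mul, coeff_sub]
      refine Finset.dvd_sum fun r _ => Dvd.dvd.mul_left ?_ _
      rw [coeff_C_of_ne_zero (by omega), sub_zero]
      obtain ⟨q, hq⟩ := hφ r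
      rw [sub_eq_iff_eq_add] at hq
      rw [hq, map_add, taylor_mul, taylor_C, coeff_add, coeff_C_mul]
      have : (taylor c (X ^ (r.val + 1) : ℤ_[p][X])).coeff i = 0 := by
        refine coeff_eq_zero_of_natDegree_lt ?_
        rw [natDegree_taylor, natDegree_X_pow]; omega
      rw [this, add_zero]
      exact dvd_mul_right _ _

open Polynomial in
theorem momentLike_iff {k : ℕ} (γ : Fin k → Polynomial ℤ_[p]) :
    MomentLike γ ↔ ∀ r, C (p : ℤ_[p]) ∣ γ r - X ^ (r.val + 1) := by
  refine forall_congr' fun r => exists_congr fun q => ?_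
  rw [sub_eq_iff_eq_add, add_comm]

open Polynomial in
theorem exists_dilate {l i : ℕ} (hi : 1 ≤ i) (ψ : Fin l → Polynomial ℤ_[p])
    (hψ : ∀ j : Fin l, X ^ (l + 1) ∣ ψ j - X ^ (j.val + 1)) :
    ∃ γ : Fin l → Polynomial ℤ_[p], MomentLike γ ∧
      ∀ j v, (ψ j).eval ((p : ℤ_[p]) ^ i * v) = (p : ℤ_[p]) ^ (i * (j.val + 1)) * (γ j).eval v := by
  choose E hE using hψ
  refine ⟨fun j => X ^ (j.val + 1) + C ((p : ℤ_[p]) ^ (i * (l - j.val))) *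
    (X ^ (l + 1) * (E j).comp (C ((p : ℤ_[p]) ^ i) * X)), fun j => ?_, fun j v => ?_⟩
  · refine ⟨C ((p : ℤ_[p]) ^ (i * (l - j.val) - 1)) *
      (X ^ (l + 1) * (E j).comp (C ((p : ℤ_[p]) ^ i) * X)), ?_⟩
    have h0 : 1 ≤ i * (l - j.val) := Nat.mul_pos hi (by omega)
    have h1 : (p : ℤ_[p]) ^ (i * (l - j.val)) = p * (p : ℤ_[p]) ^ (i * (l - j.val) - 1) := by
      rw [← pow_succ', Nat.sub_add_cancel h0]
    beta_reduce
    rw [h1, C_mul, mul_assoc]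
  · have h := hE j
    rw [sub_eq_iff_eq_add] at h
    rw [h]
    have h2 : l + 1 = (j.val + 1) + (l - j.val) := by omega
    simp only [eval_add, eval_mul, eval_pow, eval_X, eval_C, eval_comp, mul_pow, ← pow_mul]
    have h3 : (p : ℤ_[p]) ^ (i * (l + 1)) =
        (p : ℤ_[p]) ^ (i * (j.val + 1)) * (p : ℤ_[p]) ^ (i * (l - j.val)) := by
      rw [← pow_add, ← mul_add, ← h2]
    rw [h3]; ring

theorem sum_filter_refine {A B : Type*} [Fintype A] [DecidableEq A] [Fintype B] [DecidableEq B]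
    (G : Finset ℕ → ℝ) (hG : G ∅ = 0) (S : Finset ℕ) (f : ℕ → A) (g : ℕ → B)
    (h : ∀ t ∈ S, ∀ t' ∈ S, g t = g t' → f t = f t') :
    ∑ a, ∑ b, G ((S.filter fun t => f t = a).filter fun t => g t = b) =
      ∑ b, G (S.filter fun t => g t = b) := by
  rw [Finset.sum_comm]
  refine Finset.sum_congr rfl fun b _ => ?_
  by_cases hb : (S.filter fun t => g t = b).Nonempty
  · obtain ⟨t0, ht0⟩ := hb
    rw [Finset.mem_filter] at ht0
    rw [Finset.sum_eq_single (f t0)]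
    · congr 1
      ext t
      simp only [Finset.mem_filter]
      constructor
      · rintro ⟨⟨h1, -⟩, h3⟩; exact ⟨h1, h3⟩
      · rintro ⟨h1, h3⟩; exact ⟨⟨h1, h t h1 t0 ht0.1 (h3.trans ht0.2.symm)⟩, h3⟩
    · intro a _ ha
      convert hG
      ext t
      simp only [Finset.mem_filter, Finset.notMem_empty, iff_false]
      rintro ⟨⟨h1, h2⟩, h3⟩
      exact ha (h2.symm.trans (h t h1 t0 ht0.1 (h3.trans ht0.2.symm)))
    · simp
  · rw [Finset.not_nonempty_iff_eq_empty] at hb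
    rw [hb, hG]
    refine Finset.sum_eq_zero fun a _ => ?_
    convert hG
    rw [Finset.filter_filter]
    ext t
    simp only [Finset.mem_filter, Finset.notMem_empty, iff_false]
    rintro ⟨h1, -, h3⟩
    exact (Finset.eq_empty_iff_forall_notMem.mp hb t) (Finset.mem_filter.mpr ⟨h1, h3⟩)

theorem sum_filter_single {B : Type*} [Fintype B] [DecidableEq B]
    (G : Finset ℕ → ℝ) (hG : G ∅ = 0) (S : Finset ℕ) (g : ℕ → B)
    (h : ∀ t ∈ S, ∀ t' ∈ S, g t = g t') :
    ∑ b, G (S.filter fun t => g t = b) = G S := by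
  rcases S.eq_empty_or_nonempty with rfl | ⟨t0, ht0⟩
  · simp [hG]
  · rw [Finset.sum_eq_single (g t0)]
    · congr 1
      exact Finset.filter_true_of_mem fun t ht => h t ht t0 ht0
    · intro b _ hb
      rw [Finset.filter_false_of_mem, hG]
      exact fun t ht h' => hb (h'.symm.trans (h t ht t0 ht0))
    · simp

theorem sum_filter_congr {A B : Type*} [Fintype A] [DecidableEq A] [Fintype B] [DecidableEq B]
    (G : Finset ℕ → ℝ) (hG : G ∅ = 0) (S : Finset ℕ) (f : ℕ → A) (g : ℕ → B)
    (h : ∀ t ∈ S, ∀ t' ∈ S, g t = g t' ↔ f t = f t') :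
    ∑ a, G (S.filter fun t => f t = a) = ∑ b, G (S.filter fun t => g t = b) := by
  rw [← sum_filter_refine G hG S f g fun t ht t' ht' => (h t ht t' ht').mp]
  refine Finset.sum_congr rfl fun a _ => (sum_filter_single G hG _ g fun t ht t' ht' => ?_).symm
  rw [Finset.mem_filter] at ht ht'
  exact (h t ht.1 t' ht'.1).mpr (ht.2.trans ht'.2.symm)

theorem toZModPow_eq_iff {n : ℕ} {x y : ℤ_[p]} :
    PadicInt.toZModPow n x = PadicInt.toZModPow n y ↔ (p : ℤ_[p]) ^ n ∣ x - y := by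
  rw [← sub_eq_zero, ← map_sub, ← RingHom.mem_ker, PadicInt.ker_toZModPow,
    Ideal.mem_span_singleton]

theorem natCast_p_ne_zero : (p : ℤ_[p]) ≠ 0 := by exact_mod_cast (Fact.out : p.Prime).ne_zero

theorem moment_empty {k : ℕ} (hk : 1 ≤ k) (B : ℕ) (γ : Fin k → Polynomial ℤ_[p])
    (u : ℕ → ℤ_[p]) (a : ℕ → ℂ) : moment B γ u a ∅ = 0 := by
  have := critExp_pos hk
  have h : 2 * critExp k ≠ 0 := by omega
  simp [moment, expSum, h]

theorem moment_rpow_empty {k : ℕ} (hk : 1 ≤ k) (B : ℕ) (γ : Fin k → Polynomial ℤ_[p])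
    (u : ℕ → ℤ_[p]) (a : ℕ → ℂ) : moment B γ u a ∅ ^ (1 / (critExp k : ℝ)) = 0 := by
  have := critExp_pos hk
  rw [moment_empty hk, Real.zero_rpow]
  positivity

theorem sum_cellNorm_cell {k : ℕ} (hk : 1 ≤ k) {j n : ℕ} (hjn : j ≤ n)
    (γ : Fin k → Polynomial ℤ_[p]) (u : ℕ → ℤ_[p]) (a : ℕ → ℂ) (S : Finset ℕ) :
    ∑ J, cellNorm n γ u a (cell S u j J) = cellNorm n γ u a S :=
  sum_filter_refine (fun T => moment (k * n) γ u a T ^ (1 / (critExp k : ℝ)))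
    (moment_rpow_empty hk _ _ _ _) S (fun t => PadicInt.toZModPow j (u t))
    (fun t => PadicInt.toZModPow n (u t)) fun t _ t' _ h => by
      rw [toZModPow_eq_iff] at h ⊢
      exact (pow_dvd_pow _ hjn).trans h

theorem decouple_shift {k l m i B : ℕ} (hl : 1 ≤ l) (hB : l * m ≤ B) {K : ℝ} (hK : 0 ≤ K)
    (hD : Dec p l m K) (w : (Fin k → ZMod (p ^ B)) → ℝ) (hw : ∀ x, 0 ≤ w x)
    (γ : Fin k → Polynomial ℤ_[p]) (u : ℕ → ℤ_[p]) (a : ℕ → ℂ) (S : Finset ℕ)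
    (c : ℤ_[p]) (v : ℕ → ℤ_[p]) (hv : ∀ t ∈ S, u t = c + (p : ℤ_[p]) ^ i * v t)
    (γ' : Fin l → Polynomial ℤ_[p]) (hγ' : MomentLike γ')
    (Y : (Fin l → ℤ_[p]) → Fin k → ℤ_[p]) (C : (Fin l → ℤ_[p]) → ℤ_[p])
    (hY : ∀ z, ∀ t ∈ S, ∑ r, Y z r * (γ r).eval (u t) =
      C z + (p : ℤ_[p]) ^ (B - l * m) * ∑ j, z j * (γ' j).eval (v t))
    (hwY : ∀ z x, w (fun r => x r + PadicInt.toZModPow B (Y z r)) = w x) :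
    ∑ x, w x * ‖expSum B γ u a S x‖ ^ (2 * critExp l) ≤
      K * (∑ J : ZMod (p ^ (m + i)), (∑ x, w x * ‖expSum B γ u a (cell S u (m + i) J) x‖ ^
        (2 * critExp l)) ^ (1 / (critExp l : ℝ))) ^ critExp l := by
  have h1 := decouple_on hl hK hD w hw
    (fun t x => a t * phase p B x (fun j => (γ j).eval (u t))) S v γ' hγ'
    (fun z r => PadicInt.toZModPow B (Y (fun j => ((z j).val : ℤ_[p])) r))
    (fun z => padicChar B (C (fun j => ((z j).val : ℤ_[p]))))
    (fun z => norm_padicChar _ _) ?_ (fun x z => hwY _ x)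
  · refine h1.trans (le_of_eq ?_)
    congr 2
    have h0 := critExp_pos hl
    refine sum_filter_congr (fun T => (∑ x, w x * ‖∑ t ∈ T, a t * phase p B x
      (fun j => (γ j).eval (u t))‖ ^ (2 * critExp l)) ^ (1 / (critExp l : ℝ))) ?_ S
      (fun t => PadicInt.toZModPow m (v t)) (fun t => PadicInt.toZModPow (m + i) (u t)) ?_
    · have h : 2 * critExp l ≠ 0 := by omega
      simp only [Finset.sum_empty, norm_zero, zero_pow h, mul_zero, Finset.sum_const_zero]
      rw [Real.zero_rpow]; positivity
    · intro t ht t' ht'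
      rw [toZModPow_eq_iff, toZModPow_eq_iff, hv t ht, hv t' ht', add_sub_add_left_eq_sub,
        ← mul_sub, add_comm m, pow_add]
      exact mul_dvd_mul_iff_left (pow_ne_zero _ natCast_p_ne_zero)
  · intro t ht x z
    have h2 := phase_add B x (Y (fun j => ((z j).val : ℤ_[p]))) (fun j => (γ j).eval (u t))
    have h3 : padicChar B ((p : ℤ_[p]) ^ (B - l * m) *
        ∑ j, ((z j).val : ℤ_[p]) * (γ' j).eval (v t)) =
        phase p (l * m) z (fun j => (γ' j).eval (v t)) := by
      have h4 := padicChar_mul_pow (l * m) (B - l * m)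
        (∑ j, ((z j).val : ℤ_[p]) * (γ' j).eval (v t))
      rw [Nat.add_sub_cancel' hB] at h4
      exact h4
    rw [hY _ t ht, padicChar_add, h3] at h2
    exact (congrArg (a t * ·) h2).trans (by ring)

theorem dec_on_ball {k n i : ℕ} (hk : 1 ≤ k) (hkp : k < p) (hi : 1 ≤ i) {K : ℝ}
    (hK : 0 ≤ K) (hD : Dec p k n K) (γ : Fin k → Polynomial ℤ_[p]) (hγ : MomentLike γ)
    (u : ℕ → ℤ_[p]) (a : ℕ → ℂ) (S : Finset ℕ) (c : ℤ_[p])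
    (hS : ∀ t ∈ S, (p : ℤ_[p]) ^ i ∣ u t - c) :
    moment (k * (n + i)) γ u a S ≤ K * cellNorm (n + i) γ u a S ^ critExp k := by
  have hdet : IsUnit (hasse γ c).det := isUnit_det_hasse (d := 0) (by omega) γ
    (fun r => by simpa using (momentLike_iff γ).mp hγ r) c (Or.inr rfl)
  obtain ⟨ψ, L, hψ, hL, -⟩ := exists_recenter γ c hdet
  obtain ⟨γ', hγ', hd⟩ := exists_dilate hi ψ hψ
  have hv : ∀ t, ∃ v, t ∈ S → u t = c + (p : ℤ_[p]) ^ i * v := by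
    intro t
    by_cases ht : t ∈ S
    · obtain ⟨v, hv⟩ := hS t ht
      exact ⟨v, fun _ => by rw [← hv]; ring⟩
    · exact ⟨0, fun h => absurd h ht⟩
  choose v hv using hv
  have h := decouple_shift (B := k * (n + i)) hk (Nat.mul_le_mul_left k (Nat.le_add_right n i)) hK hD
    (fun _ => 1) (fun _ => zero_le_one) γ u a S c v hv γ' hγ'
    (fun z => L (fun j => (p : ℤ_[p]) ^ (i * (k - (j.val + 1))) * z j))
    (fun z => ∑ r, L (fun j => (p : ℤ_[p]) ^ (i * (k - (j.val + 1))) * z j) r * (γ r).eval c)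
    ?_ (fun _ _ => rfl)
  · simp only [one_mul] at h
    exact h
  · intro z t ht
    rw [hL, hv t ht, add_sub_cancel_left]
    congr 1
    rw [Finset.mul_sum]
    refine Finset.sum_congr rfl fun j _ => ?_
    rw [hd, ← Nat.mul_sub, Nat.add_sub_cancel_left]
    have : k * i = i * (k - (j.val + 1)) + i * (j.val + 1) := by
      rw [← Nat.mul_add, Nat.sub_add_cancel (by omega), mul_comm]
    rw [this, pow_add]; ring

variable (p) in
/-- Bilinear decoupling estimate for two separated balls. -/
def Bil (k l i i' n : ℕ) (K : ℝ) : Prop :=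
  ∀ γ : Fin k → Polynomial ℤ_[p], MomentLike γ → ∀ (u : ℕ → ℤ_[p]) (a : ℕ → ℂ)
    (S₁ S₂ : Finset ℕ) (c₁ c₂ : ℤ_[p]), ¬ (p : ℤ_[p]) ∣ c₁ - c₂ →
    (∀ t ∈ S₁, (p : ℤ_[p]) ^ i ∣ u t - c₁) → (∀ t ∈ S₂, (p : ℤ_[p]) ^ i' ∣ u t - c₂) →
    ∑ x, ‖expSum (k * n) γ u a S₁ x‖ ^ (2 * critExp l) *
      ‖expSum (k * n) γ u a S₂ x‖ ^ (2 * (critExp k - critExp l)) ≤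
    K * cellNorm n γ u a S₁ ^ critExp l * cellNorm n γ u a S₂ ^ (critExp k - critExp l)

theorem exists_quotient {i : ℕ} (u : ℕ → ℤ_[p]) (S : Finset ℕ) (c : ℤ_[p])
    (hS : ∀ t ∈ S, (p : ℤ_[p]) ^ i ∣ u t - c) :
    ∃ v : ℕ → ℤ_[p], ∀ t ∈ S, u t = c + (p : ℤ_[p]) ^ i * v t := by
  have hv : ∀ t, ∃ v, t ∈ S → u t = c + (p : ℤ_[p]) ^ i * v := by
    intro t
    by_cases ht : t ∈ S
    · obtain ⟨v, hv⟩ := hS t ht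
      exact ⟨v, fun _ => by rw [← hv]; ring⟩
    · exact ⟨0, fun h => absurd h ht⟩
  choose v hv using hv
  exact ⟨v, hv⟩

theorem critExp_mono {l k : ℕ} (h : l ≤ k) : critExp l ≤ critExp k :=
  Nat.div_le_div_right (Nat.mul_le_mul h (by omega))

theorem bil_step {k l i i' j n : ℕ} (hl : 1 ≤ l) (hlk : l ≤ k) (hkp : k < p) (hi : 1 ≤ i)
    (hi' : 1 ≤ i') (hij : i ≤ j) (hjn : j ≤ n) (hi'n : i' ≤ n) (hlj : l * j ≤ (k - l + 1) * i')
    {K₁ K₂ : ℝ} (hK₁ : 0 ≤ K₁) (hK₂ : 0 ≤ K₂) (hD : Dec p l (j - i) K₁) (hB : Bil p k l j i' n K₂) :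
    Bil p k l i i' n (K₁ * K₂) := by
  intro γ hγ u a S₁ S₂ c₁ c₂ hc hS₁ hS₂
  obtain ⟨m, rfl⟩ := Nat.exists_eq_add_of_le' hij
  rw [Nat.add_sub_cancel] at hD
  obtain ⟨v, hv⟩ := exists_quotient u S₁ c₁ hS₁
  obtain ⟨v₂, hv₂⟩ := exists_quotient u S₂ c₂ hS₂
  obtain ⟨ψ, L, hψ, hL, hψm⟩ := exists_recenter γ c₂ (isUnit_det_hasse (d := 0) (by omega) γ
    (fun r => by simpa using (momentLike_iff γ).mp hγ r) c₂ (Or.inr rfl))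
  replace hψm := hψm ((momentLike_iff γ).mp hγ)
  obtain ⟨d, rfl⟩ := Nat.exists_eq_add_of_le' hlk
  set φ : Fin l → Polynomial ℤ_[p] := fun r => ψ (Fin.natAdd d r) with hφ
  obtain ⟨η, L', hη, hL', -⟩ := exists_recenter φ (c₁ - c₂) (isUnit_det_hasse (d := d) hkp φ
    (fun r => by simpa using hψm (Fin.natAdd d r)) _ (Or.inl hc))
  obtain ⟨γ', hγ', hd⟩ := exists_dilate hi η hη
  obtain ⟨γ'', -, hd₂⟩ := exists_dilate hi' ψ hψ
  have hk1 : 1 ≤ d + l := by omega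
  set B := (d + 1) * i' with hBdef
  have hBn : B ≤ (d + l) * n := Nat.mul_le_mul (by omega) hi'n
  have hlB : l * (m + i) ≤ B := by
    have : d + l - l + 1 = d + 1 := by omega
    rwa [this] at hlj
  have hmB : l * m + l * i ≤ B := by rw [← mul_add]; exact hlB
  set y₁ : (Fin l → ℤ_[p]) → Fin l → ℤ_[p] := fun z =>
    L' (fun j => (p : ℤ_[p]) ^ (B - l * m - i * (j.val + 1)) * z j) with hy₁
  set y₀ : (Fin l → ℤ_[p]) → Fin (d + l) → ℤ_[p] := fun z =>
    Fin.append (fun _ => 0) (fun r => (p : ℤ_[p]) ^ ((d + l) * n - B) * y₁ z r) with hy₀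
  have hsum : ∀ z (x : ℤ_[p]), ∑ j, y₀ z j * (ψ j).eval x =
      (p : ℤ_[p]) ^ ((d + l) * n - B) * ∑ r, y₁ z r * (φ r).eval x := by
    intro z x
    rw [Fin.sum_univ_add, hy₀]
    simp only [Fin.append_left, Fin.append_right, zero_mul, Finset.sum_const_zero, zero_add,
      Finset.mul_sum, mul_assoc]
    rfl
  have h := decouple_shift (B := (d + l) * n) hl
    (by
      have : l * m ≤ B := by omega
      omega) hK₁ hD
    (fun x => ‖expSum ((d + l) * n) γ u a S₂ x‖ ^ (2 * (critExp (d + l) - critExp l)))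
    (fun x => by positivity) γ u a S₁ c₁ v hv γ' hγ' (fun z => L (y₀ z))
    (fun z => ∑ r, L (y₀ z) r * (γ r).eval c₂ +
      (p : ℤ_[p]) ^ ((d + l) * n - B) * ∑ r, y₁ z r * (φ r).eval (c₁ - c₂)) ?_ ?_
  · simp only [mul_comm (‖expSum ((d + l) * n) γ u a S₂ _‖ ^ (2 * (critExp (d + l) - critExp l)))] at h
    refine h.trans ?_
    rw [mul_assoc K₁, mul_assoc K₁]
    refine mul_le_mul_of_nonneg_left ?_ hK₁
    set s := critExp l with hs
    have hs1 : 1 ≤ s := critExp_pos hl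
    set Q₂ := cellNorm n γ u a S₂ ^ (critExp (d + l) - s) with hQ₂
    have hQ₂0 : 0 ≤ Q₂ := pow_nonneg (cellNorm_nonneg _ _ _ _ _) _
    have hcell : ∀ J, (∑ x, ‖expSum ((d + l) * n) γ u a (cell S₁ u (m + i) J) x‖ ^ (2 * s) *
        ‖expSum ((d + l) * n) γ u a S₂ x‖ ^ (2 * (critExp (d + l) - s))) ^ (1 / (s : ℝ)) ≤
        (K₂ * Q₂) ^ (1 / (s : ℝ)) * cellNorm n γ u a (cell S₁ u (m + i) J) := by
      intro J
      have hQ := cellNorm_nonneg n γ u a (cell S₁ u (m + i) J)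
      have hb : ∃ c, ¬ (p : ℤ_[p]) ∣ c - c₂ ∧
          ∀ t ∈ cell S₁ u (m + i) J, (p : ℤ_[p]) ^ (m + i) ∣ u t - c := by
        rcases (cell S₁ u (m + i) J).eq_empty_or_nonempty with he | ⟨t0, ht0⟩
        · exact ⟨c₁, hc, by simp [he]⟩
        · simp only [cell, Finset.mem_filter] at ht0 ⊢
          refine ⟨u t0, fun h' => hc ?_, fun t ht => toZModPow_eq_iff.mp (ht.2.trans ht0.2.symm)⟩
          have h1 : (p : ℤ_[p]) ∣ u t0 - c₁ :=
            (dvd_pow_self _ (by omega)).trans (hS₁ t0 ht0.1)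
          have := dvd_sub h' h1
          rwa [sub_sub_sub_cancel_left] at this
      obtain ⟨c, hcc, hS⟩ := hb
      have h1 := hB γ hγ u a (cell S₁ u (m + i) J) S₂ c c₂ hcc hS hS₂
      have h2 := Real.rpow_le_rpow (Finset.sum_nonneg fun x _ => by positivity) h1
        (by positivity : 0 ≤ 1 / (s : ℝ))
      refine h2.trans (le_of_eq ?_)
      rw [← hs, ← hQ₂, mul_right_comm, Real.mul_rpow (mul_nonneg hK₂ hQ₂0) (pow_nonneg hQ _),
        ← Real.rpow_natCast (cellNorm n γ u a (cell S₁ u (m + i) J)), ← Real.rpow_mul hQ,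
        mul_one_div_cancel (by positivity), Real.rpow_one]
    refine (pow_le_pow_left₀ (Finset.sum_nonneg fun J _ => Real.rpow_nonneg
      (Finset.sum_nonneg fun x _ => by positivity) _)
      (Finset.sum_le_sum fun J _ => hcell J) s).trans (le_of_eq ?_)
    rw [← Finset.mul_sum, sum_cellNorm_cell hk1 hjn, mul_pow, ← Real.rpow_natCast (_ ^ _),
      ← Real.rpow_mul (mul_nonneg hK₂ hQ₂0), one_div_mul_cancel (by positivity), Real.rpow_one]
    ring
  · intro z t ht
    rw [hL, hsum]
    have e1 : ∑ r, y₁ z r * (φ r).eval (u t - c₂) = ∑ r, y₁ z r * (φ r).eval (c₁ - c₂) +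
        (p : ℤ_[p]) ^ (B - l * m) * ∑ j, z j * (γ' j).eval (v t) := by
      simp only [hy₁]
      rw [hL', sub_sub_sub_cancel_right, hv t ht, add_sub_cancel_left]
      congr 1
      rw [Finset.mul_sum]
      refine Finset.sum_congr rfl fun j _ => ?_
      have h1 : i * (j.val + 1) ≤ l * i := by rw [mul_comm]; exact Nat.mul_le_mul_right _ j.2
      have h2 : B - l * m = B - l * m - i * (j.val + 1) + i * (j.val + 1) := by omega
      rw [hd]
      nth_rw 2 [h2]
      rw [pow_add]; ring
    have h3 : (d + l) * n - l * m = (d + l) * n - B + (B - l * m) := by omega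
    rw [e1, h3, pow_add]; ring
  · intro z x
    have key : ∀ t ∈ S₂, padicChar ((d + l) * n) (∑ r, L (y₀ z) r * (γ r).eval (u t)) =
        padicChar ((d + l) * n) (∑ r, L (y₀ z) r * (γ r).eval c₂) := by
      intro t ht
      refine padicChar_congr ?_
      rw [hL, hsum, add_sub_cancel_left, hv₂ t ht, add_sub_cancel_left]
      have h3 : (d + l) * n = (d + l) * n - B + B := by omega
      nth_rw 1 [h3]
      rw [pow_add]
      refine mul_dvd_mul_left _ (Finset.dvd_sum fun r _ => Dvd.dvd.mul_left ?_ _)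
      simp only [hφ]
      rw [hd₂, Fin.val_natAdd]
      refine Dvd.dvd.mul_right (pow_dvd_pow _ ?_) _
      rw [hBdef, mul_comm]
      exact Nat.mul_le_mul_left _ (by omega)
    have h4 : expSum ((d + l) * n) γ u a S₂
        (fun r => x r + PadicInt.toZModPow ((d + l) * n) (L (y₀ z) r)) =
        padicChar ((d + l) * n) (∑ r, L (y₀ z) r * (γ r).eval c₂) *
          expSum ((d + l) * n) γ u a S₂ x := by
      rw [expSum, expSum, Finset.mul_sum]
      refine Finset.sum_congr rfl fun t ht => ?_
      rw [phase_add, key t ht]; ring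
    rw [h4, norm_mul, norm_padicChar, one_mul]

theorem cast_critExp (k : ℕ) : (critExp k : ℝ) = k * (k + 1) / 2 := by
  have := two_mul_critExp k
  have h : (2 : ℝ) * critExp k = k * (k + 1) := by exact_mod_cast this
  linarith

theorem bil_zero {k i i' m : ℕ} (hk : 1 ≤ k) (hkp : k < p) (hi' : 1 ≤ i') {K : ℝ} (hK : 0 ≤ K)
    (hD : Dec p k m K) : Bil p k 0 i i' (m + i') K := by
  intro γ hγ u a S₁ S₂ c₁ c₂ _ _ hS₂
  have h := dec_on_ball hk hkp hi' hK hD γ hγ u a S₂ c₂ hS₂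
  have h0 : critExp 0 = 0 := rfl
  simpa [h0, moment] using h

theorem sum_rpow_mul_rpow_le {X : Type*} (Y : Finset X) (f g : X → ℝ) (hf : ∀ x, 0 ≤ f x)
    (hg : ∀ x, 0 ≤ g x) {θ : ℝ} (h0 : 0 < θ) (h1 : θ < 1) :
    ∑ x ∈ Y, f x ^ θ * g x ^ (1 - θ) ≤ (∑ x ∈ Y, f x) ^ θ * (∑ x ∈ Y, g x) ^ (1 - θ) := by
  have hc : (1 / θ).HolderConjugate (1 / (1 - θ)) := by
    rw [Real.holderConjugate_iff]
    refine ⟨by rw [lt_div_iff₀ h0]; linarith, by simp⟩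
  have h := Real.inner_le_Lp_mul_Lq_of_nonneg Y hc (f := fun x => f x ^ θ)
    (g := fun x => g x ^ (1 - θ)) (fun x _ => Real.rpow_nonneg (hf x) _)
    (fun x _ => Real.rpow_nonneg (hg x) _)
  have h1' : 1 - θ ≠ 0 := by linarith
  simpa only [← Real.rpow_mul (hf _), ← Real.rpow_mul (hg _), mul_one_div_cancel h0.ne',
    mul_one_div_cancel h1', Real.rpow_one, one_div_one_div] using h

theorem pow_mul_pow_interp {A B : ℝ} (hA : 0 ≤ A) (hB : 0 ≤ B) {θ : ℝ} (h0 : 0 ≤ θ) (h1 : θ ≤ 1)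
    {n₁ n₂ m₁ m₂ r₁ r₂ : ℕ} (e₁ : (n₁ : ℝ) = m₁ * θ + r₁ * (1 - θ))
    (e₂ : (n₂ : ℝ) = m₂ * θ + r₂ * (1 - θ)) :
    A ^ n₁ * B ^ n₂ = (A ^ m₁ * B ^ m₂) ^ θ * (A ^ r₁ * B ^ r₂) ^ (1 - θ) := by
  have h1' : 0 ≤ 1 - θ := by linarith
  rw [Real.mul_rpow (by positivity) (by positivity), Real.mul_rpow (by positivity) (by positivity)]
  simp only [← Real.rpow_natCast]
  rw [← Real.rpow_mul hA, ← Real.rpow_mul hA, ← Real.rpow_mul hB, ← Real.rpow_mul hB, e₁, e₂,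
    Real.rpow_add_of_nonneg hA (by positivity) (by positivity),
    Real.rpow_add_of_nonneg hB (by positivity) (by positivity)]
  ring

theorem bil_holder {k l i i' n : ℕ} (hl : 1 ≤ l) (hlk : l < k) {K₁ K₂ : ℝ} (hK₁ : 0 ≤ K₁)
    (hK₂ : 0 ≤ K₂) (h₁ : Bil p k (k - l) i' i n K₁) (h₂ : Bil p k (l - 1) i i' n K₂) :
    Bil p k l i i' n (K₁ ^ (1 / ((k : ℝ) - l + 1)) * K₂ ^ (1 - 1 / ((k : ℝ) - l + 1))) := by
  intro γ hγ u a S₁ S₂ c₁ c₂ hc hS₁ hS₂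
  have hc' : ¬ (p : ℤ_[p]) ∣ c₂ - c₁ := by rwa [dvd_sub_comm]
  have H₁ := h₁ γ hγ u a S₂ S₁ c₂ c₁ hc' hS₂ hS₁
  have H₂ := h₂ γ hγ u a S₁ S₂ c₁ c₂ hc hS₁ hS₂
  obtain ⟨q, rfl⟩ := Nat.exists_eq_add_of_le' hl
  obtain ⟨e, rfl⟩ := Nat.exists_eq_add_of_lt hlk
  have e1 : q + 1 + e + 1 - (q + 1) = e + 1 := by omega
  rw [e1] at H₁
  rw [Nat.add_sub_cancel] at H₂
  set θ : ℝ := 1 / (((q + 1 + e + 1 : ℕ) : ℝ) - ((q + 1 : ℕ) : ℝ) + 1) with hθ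
  have hθ' : θ = 1 / ((e : ℝ) + 2) := by rw [hθ]; congr 1; push_cast; ring
  have h0 : 0 < θ := by rw [hθ']; positivity
  have h1 : θ < 1 := by rw [hθ', div_lt_one (by positivity)]; linarith [e.cast_nonneg (α := ℝ)]
  have c1 := critExp_mono (show e + 1 ≤ q + 1 + e + 1 by omega)
  have c2 := critExp_mono (show q ≤ q + 1 + e + 1 by omega)
  have c3 := critExp_mono (show q + 1 ≤ q + 1 + e + 1 by omega)
  have x1 : (critExp (q + 1) : ℝ) = ((critExp (q + 1 + e + 1) - critExp (e + 1) : ℕ) : ℝ) * θ +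
      (critExp q : ℝ) * (1 - θ) := by
    rw [Nat.cast_sub c1, hθ']
    simp only [cast_critExp]
    push_cast
    field_simp
    ring
  have x2 : ((critExp (q + 1 + e + 1) - critExp (q + 1) : ℕ) : ℝ) = (critExp (e + 1) : ℝ) * θ +
      ((critExp (q + 1 + e + 1) - critExp q : ℕ) : ℝ) * (1 - θ) := by
    rw [Nat.cast_sub c2, Nat.cast_sub c3, hθ']
    simp only [cast_critExp]
    push_cast
    field_simp
    ring
  have y1 : ((2 * critExp (q + 1) : ℕ) : ℝ) =
      ((2 * (critExp (q + 1 + e + 1) - critExp (e + 1)) : ℕ) : ℝ) * θ +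
      ((2 * critExp q : ℕ) : ℝ) * (1 - θ) := by
    simp only [Nat.cast_mul, Nat.cast_two]; rw [x1]; ring
  have y2 : ((2 * (critExp (q + 1 + e + 1) - critExp (q + 1)) : ℕ) : ℝ) =
      ((2 * critExp (e + 1) : ℕ) : ℝ) * θ +
      ((2 * (critExp (q + 1 + e + 1) - critExp q) : ℕ) : ℝ) * (1 - θ) := by
    simp only [Nat.cast_mul, Nat.cast_two]; rw [x2]; ring
  have hQ₁ := cellNorm_nonneg n γ u a S₁
  have hQ₂ := cellNorm_nonneg n γ u a S₂
  rw [Finset.sum_congr rfl fun x _ => pow_mul_pow_interp (norm_nonneg _) (norm_nonneg _) h0.le h1.le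
    y1 y2]
  refine (sum_rpow_mul_rpow_le _ _ _ (fun x => by positivity) (fun x => by positivity)
    h0 h1).trans ?_
  rw [mul_assoc, pow_mul_pow_interp hQ₁ hQ₂ h0.le h1.le x1 x2]
  have z1 := Real.rpow_le_rpow (Finset.sum_nonneg fun x _ => by positivity) H₁ h0.le
  have z2 := Real.rpow_le_rpow (Finset.sum_nonneg fun x _ => by positivity) H₂
    (sub_nonneg.mpr h1.le)
  simp only [mul_comm (‖expSum ((q + 1 + e + 1) * n) γ u a S₂ _‖ ^ (2 * critExp (e + 1)))] at z1
  refine (mul_le_mul z1 z2 (Real.rpow_nonneg (Finset.sum_nonneg fun x _ => by positivity) _)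
    (Real.rpow_nonneg (by positivity) _)).trans (le_of_eq ?_)
  rw [mul_assoc K₁, mul_assoc K₂, Real.mul_rpow hK₁ (by positivity),
    Real.mul_rpow hK₂ (by positivity), mul_comm (cellNorm n γ u a S₂ ^ critExp (e + 1))]
  ring

theorem bil_of_dec {k l i i' n : ℕ} (hl : 1 ≤ l) (hlk : l < k) (hkp : k < p) (hi : 1 ≤ i)
    (hi' : 1 ≤ i') (hin : i ≤ n) (hin' : i' ≤ n) {K₁ K₂ : ℝ} (hK₁ : 0 ≤ K₁) (hK₂ : 0 ≤ K₂)
    (h₁ : Dec p k (n - i) K₁) (h₂ : Dec p k (n - i') K₂) :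
    Bil p k l i i' n (K₁ ^ ((critExp l : ℝ) / critExp k) * K₂ ^ (1 - (critExp l : ℝ) / critExp k)) := by
  intro γ hγ u a S₁ S₂ c₁ c₂ hc hS₁ hS₂
  have H₁ := dec_on_ball (by omega) hkp hi hK₁ h₁ γ hγ u a S₁ c₁ hS₁
  have H₂ := dec_on_ball (by omega) hkp hi' hK₂ h₂ γ hγ u a S₂ c₂ hS₂
  rw [Nat.sub_add_cancel hin] at H₁
  rw [Nat.sub_add_cancel hin'] at H₂
  have c3 : critExp l < critExp k := by
    have h1 := two_mul_critExp k
    have h2 := two_mul_critExp l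
    have h3 : l * (l + 1) < k * (k + 1) := Nat.mul_lt_mul'' hlk (by omega)
    omega
  have hl0 : (0 : ℝ) < critExp l := by exact_mod_cast critExp_pos hl
  have hlk' : (critExp l : ℝ) < critExp k := by exact_mod_cast c3
  set θ : ℝ := (critExp l : ℝ) / critExp k with hθ
  have hk0 : (0 : ℝ) < critExp k := hl0.trans hlk'
  have h0 : 0 < θ := div_pos hl0 hk0
  have h1 : θ < 1 := (div_lt_one hk0).mpr hlk'
  have x1 : (critExp l : ℝ) = (critExp k : ℝ) * θ + (0 : ℕ) * (1 - θ) := by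
    rw [hθ]; field_simp; simp
  have x2 : ((critExp k - critExp l : ℕ) : ℝ) = (0 : ℕ) * θ + (critExp k : ℝ) * (1 - θ) := by
    rw [Nat.cast_sub c3.le, hθ]; field_simp; simp
  have y1 : ((2 * critExp l : ℕ) : ℝ) = ((2 * critExp k : ℕ) : ℝ) * θ + (0 : ℕ) * (1 - θ) := by
    push_cast at x1 ⊢; linarith
  have y2 : ((2 * (critExp k - critExp l) : ℕ) : ℝ) =
      (0 : ℕ) * θ + ((2 * critExp k : ℕ) : ℝ) * (1 - θ) := by
    simp only [Nat.cast_mul, Nat.cast_two]; rw [x2]; simp only [Nat.cast_zero]; ring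
  have hQ₁ := cellNorm_nonneg n γ u a S₁
  have hQ₂ := cellNorm_nonneg n γ u a S₂
  rw [Finset.sum_congr rfl fun x _ => pow_mul_pow_interp (norm_nonneg _) (norm_nonneg _) h0.le h1.le
    y1 y2]
  refine (sum_rpow_mul_rpow_le _ _ _ (fun x => by positivity) (fun x => by positivity)
    h0 h1).trans ?_
  simp only [pow_zero, one_mul, mul_one]
  rw [mul_assoc, pow_mul_pow_interp hQ₁ hQ₂ h0.le h1.le x1 x2]
  simp only [pow_zero, one_mul, mul_one]
  have z1 := Real.rpow_le_rpow (moment_nonneg _ _ _ _ _) H₁ h0.le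
  have z2 := Real.rpow_le_rpow (moment_nonneg _ _ _ _ _) H₂ (sub_nonneg.mpr h1.le)
  refine (mul_le_mul z1 z2 (Real.rpow_nonneg (moment_nonneg _ _ _ _ _) _)
    (Real.rpow_nonneg (by positivity) _)).trans (le_of_eq ?_)
  rw [Real.mul_rpow hK₁ (by positivity), Real.mul_rpow hK₂ (by positivity)]
  ring

theorem Bil.mono {k l i i' n : ℕ} {K K' : ℝ} (h : Bil p k l i i' n K) (hK : K ≤ K') :
    Bil p k l i i' n K' := by
  intro γ hγ u a S₁ S₂ c₁ c₂ hc hS₁ hS₂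
  refine (h γ hγ u a S₁ S₂ c₁ c₂ hc hS₁ hS₂).trans ?_
  have hQ₁ := cellNorm_nonneg n γ u a S₁
  have hQ₂ := cellNorm_nonneg n γ u a S₂
  gcongr

theorem Dec.mono {k n : ℕ} {K K' : ℝ} (h : Dec p k n K) (hK : K ≤ K') : Dec p k n K' := by
  intro γ hγ u a S
  refine (h γ hγ u a S).trans ?_
  have hQ₁ := cellNorm_nonneg n γ u a S
  gcongr

/-- The exponent gained after `r` iterations. -/
def gain (k : ℕ) (η : ℝ) (r l : ℕ) : ℝ :=
  η * ((k : ℝ) - l) * (1 - l) / k + r * η * l * ((k : ℝ) - l) / k ^ 3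

theorem gain_zero (k : ℕ) (hk : 1 ≤ k) (η : ℝ) (r : ℕ) : gain k η r 0 = η := by
  have : (k : ℝ) ≠ 0 := by positivity
  simp [gain, this]

theorem gain_succ {k l : ℕ} {η : ℝ} (hη : 0 ≤ η) (r : ℕ) (hl : 1 ≤ l) (hlk : l < k) :
    gain k η (r + 1) l ≤ 1 / (l : ℝ) * gain k η r (k - l) +
      (1 - 1 / ((k : ℝ) - l + 1)) * gain k η r (l - 1) := by
  have hl' : (1 : ℝ) ≤ l := by exact_mod_cast hl
  have hlk' : (l : ℝ) + 1 ≤ k := by exact_mod_cast hlk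
  have hk0 : (0 : ℝ) < k := by linarith
  have h1 : (k : ℝ) - l + 1 ≠ 0 := by linarith
  have e : 1 / (l : ℝ) * gain k η r (k - l) +
      (1 - 1 / ((k : ℝ) - l + 1)) * gain k η r (l - 1) = gain k η r l + η / k := by
    rw [gain, gain, gain, Nat.cast_sub hlk.le, Nat.cast_sub hl]
    field_simp
    push_cast
    ring
  rw [e]
  have e2 : gain k η (r + 1) l = gain k η r l + η * (l * ((k : ℝ) - l) / k ^ 3) := by
    rw [gain, gain]; push_cast; ring
  rw [e2, div_eq_mul_one_div η]
  refine add_le_add_right (mul_le_mul_of_nonneg_left ?_ hη) _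
  rw [div_le_div_iff₀ (by positivity) hk0]
  have h2 : (l : ℝ) * (k - l) ≤ k * k := by nlinarith
  nlinarith

theorem bil_base {k : ℕ} (hkp : k < p) {η C₀ : ℝ} (hη : 0 ≤ η) (hC₀ : 0 < C₀)
    (hD : ∀ n : ℕ, Dec p k n (C₀ * (p : ℝ) ^ (η * n))) {l i i' n : ℕ} (hl : 1 ≤ l) (hlk : l < k)
    (hi : 1 ≤ i) (hi' : 1 ≤ i') (hin : i ≤ n) (hin' : i' ≤ n) :
    Bil p k l i i' n (C₀ * (p : ℝ) ^ (η * n)) := by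
  have hp1 : (1 : ℝ) ≤ p := by exact_mod_cast (Fact.out : p.Prime).one_le
  have h : ∀ m ≤ n, Dec p k m (C₀ * (p : ℝ) ^ (η * n)) := fun m hm =>
    (hD m).mono (by gcongr)
  have hK : 0 < C₀ * (p : ℝ) ^ (η * n) := by positivity
  have := bil_of_dec hl hlk hkp hi hi' hin hin' hK.le hK.le (h _ (Nat.sub_le _ _))
    (h _ (Nat.sub_le _ _))
  rwa [← Real.rpow_add hK, add_sub_cancel, Real.rpow_one] at this

theorem bil_induct {k : ℕ} (hkp : k < p) {η C₀ : ℝ} (hη : 0 ≤ η) (hC₀ : 0 < C₀)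
    (hD : ∀ n : ℕ, Dec p k n (C₀ * (p : ℝ) ^ (η * n))) {ε C₁ : ℝ} (hε : 0 ≤ ε) (hC₁ : 1 ≤ C₁)
    (hL : ∀ l : ℕ, 1 ≤ l → l < k → ∀ n : ℕ, Dec p l n (C₁ * (p : ℝ) ^ (ε * n))) (r : ℕ) :
    ∃ C : ℝ, C₀ ≤ C ∧ ∀ l b n : ℕ, 1 ≤ l → l < k → 1 ≤ b → k.factorial ^ (r + 1) ∣ b →
      k ^ (r + 2) * b ≤ n → Bil p k l ((k - l + 1) * b / l) b n
        (C * (p : ℝ) ^ ((η + r * ε) * n - gain k η r l * b)) := by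
  have hp1 : (1 : ℝ) ≤ p := by exact_mod_cast (Fact.out : p.Prime).one_le
  have hp0 : (0 : ℝ) < p := by linarith
  induction r with
  | zero =>
    refine ⟨C₀, le_rfl, fun l b n hl hlk hb hdvd hn => ?_⟩
    have hkb : b ≤ k * b := Nat.le_mul_of_pos_left _ (by omega)
    have hkb2 : k * (k * b) ≤ n := by rw [← mul_assoc]; simpa [pow_two] using hn
    have hkb3 : k * b ≤ k * (k * b) := Nat.le_mul_of_pos_left _ (by omega)
    have h1 : (k - l + 1) * b / l ≤ k * b :=
      (Nat.div_le_self _ _).trans (Nat.mul_le_mul_right _ (by omega))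
    have h2 : l ≤ b := by
      have : l ∣ b := (Nat.dvd_factorial hl hlk.le).trans (by simpa using hdvd)
      exact Nat.le_of_dvd hb this
    have h3 : 1 ≤ (k - l + 1) * b / l := by
      rw [Nat.le_div_iff_mul_le hl, one_mul]
      exact h2.trans (Nat.le_mul_of_pos_left _ (by omega))
    refine (bil_base hkp hη hC₀ hD hl hlk h3 hb (by omega) (by omega)).mono ?_
    have hl' : (1 : ℝ) ≤ l := by exact_mod_cast hl
    have hlk' : (l : ℝ) + 1 ≤ k := by exact_mod_cast hlk
    have : gain k η 0 l * b ≤ 0 := by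
      refine mul_nonpos_of_nonpos_of_nonneg ?_ (by positivity)
      simp only [gain, Nat.cast_zero, zero_mul, zero_div, add_zero]
      refine div_nonpos_of_nonpos_of_nonneg ?_ (by linarith)
      refine mul_nonpos_of_nonneg_of_nonpos (mul_nonneg hη (by linarith)) (by linarith)
    refine mul_le_mul_of_nonneg_left (Real.rpow_le_rpow_of_exponent_le hp1 ?_) hC₀.le
    simp only [Nat.cast_zero, zero_mul, add_zero]; linarith
  | succ r ih =>
    obtain ⟨C, hC, ih⟩ := ih
    have hC0 : 0 < C := hC₀.trans_le hC
    refine ⟨C₁ * C, hC.trans (le_mul_of_one_le_left hC0.le hC₁), fun l b n hl hlk hb hdvd hn => ?_⟩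
    set D := C₁ * C with hD'
    have hD0 : 0 < D := by positivity
    have hk2 : k ^ (r + 3) = k * k ^ (r + 2) := by ring
    obtain ⟨b', rfl⟩ := ((Nat.dvd_factorial hl hlk.le).trans
      (dvd_pow_self _ (Nat.succ_ne_zero _))).trans hdvd
    have hb' : 1 ≤ b' := Nat.pos_of_mul_pos_left hb
    have hj : (k - l + 1) * (l * b') / l = (k - l + 1) * b' := by
      rw [mul_left_comm]; exact Nat.mul_div_cancel_left _ hl
    have hfac : k.factorial ^ (r + 1) ∣ (k - l + 1) * b' := by
      obtain ⟨q, hq⟩ := Nat.dvd_factorial hl hlk.le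
      refine Dvd.dvd.mul_left ?_ _
      have h1 : l * k.factorial ^ (r + 1) ∣ l * b' := by
        refine dvd_trans ?_ hdvd
        rw [pow_succ' _ (r + 1), hq]
        exact mul_dvd_mul_right (dvd_mul_right _ _) _
      exact (mul_dvd_mul_iff_left (by omega)).mp h1
    rw [hj]
    set j := (k - l + 1) * b' with hjdef
    set b := l * b' with hbdef
    have hj1 : 1 ≤ j := Nat.mul_pos (by omega) hb'
    have hkb : j ≤ k * b' := Nat.mul_le_mul_right _ (by omega)
    have hkb' : k * b' ≤ k * b := Nat.mul_le_mul_left _ (Nat.le_mul_of_pos_left _ hl)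
    have hbase : k * (k * b) ≤ n := by
      refine le_trans ?_ hn
      rw [← mul_assoc, ← pow_two]
      exact Nat.mul_le_mul_right _ (Nat.pow_le_pow_right (by omega) (by omega))
    have hbk : k * b ≤ k * (k * b) := Nat.le_mul_of_pos_left _ (by omega)
    have hbk0 : b ≤ k * b := Nat.le_mul_of_pos_left _ (by omega)
    have hjn : k ^ (r + 2) * j ≤ n := by
      refine le_trans ?_ hn
      rw [hk2, mul_comm k, mul_assoc]
      exact Nat.mul_le_mul_left _ (hkb.trans hkb')
    have hbn : k ^ (r + 2) * b ≤ n := by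
      refine le_trans ?_ hn
      rw [hk2, mul_assoc]
      exact Nat.le_mul_of_pos_left _ (by omega)
    set E : ℝ := (η + ((r + 1 : ℕ) : ℝ) * ε) * n with hE
    have hcomb : ∀ (m : ℕ) (x : ℝ), m ≤ n → C₁ * (p : ℝ) ^ (ε * m) *
        (C * (p : ℝ) ^ ((η + r * ε) * n - x)) ≤ D * (p : ℝ) ^ (E - x) := by
      intro m x hm
      have e1 : C₁ * (p : ℝ) ^ (ε * m) * (C * (p : ℝ) ^ ((η + r * ε) * n - x)) =
          D * (p : ℝ) ^ (ε * m + ((η + r * ε) * n - x)) := by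
        rw [Real.rpow_add hp0]; ring
      rw [e1]
      refine mul_le_mul_of_nonneg_left (Real.rpow_le_rpow_of_exponent_le hp1 ?_) hD0.le
      have : ε * m ≤ ε * n := by gcongr
      rw [hE]; push_cast; linarith
    have h₁ : Bil p k (k - l) b j n (D * (p : ℝ) ^ (E - gain k η r (k - l) * j)) := by
      set j₂ := (k - (k - l) + 1) * j / (k - l) with hj₂
      have hj₂n : j₂ ≤ n := by
        refine (Nat.div_le_self _ _).trans (le_trans ?_ (hbase))
        exact Nat.mul_le_mul (by omega) (hkb.trans hkb')
      refine (bil_step (l := k - l) (by omega) (by omega) hkp hb hj1 (j := j₂) ?_ hj₂n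
        (by omega) (Nat.mul_div_le _ _) (by positivity) (by positivity)
        (hL (k - l) (by omega) (by omega) _) (ih (k - l) j n (by omega) (by omega) hj1 hfac
          hjn)).mono (hcomb _ _ (by omega))
      rw [Nat.le_div_iff_mul_le (by omega), hbdef, hjdef]
      have : k - (k - l) + 1 = l + 1 := by omega
      rw [this]
      calc l * b' * (k - l) = (l * (k - l)) * b' := by ring
        _ ≤ ((l + 1) * (k - l + 1)) * b' :=
          Nat.mul_le_mul_right _ (Nat.mul_le_mul (by omega) (by omega))
        _ = _ := by ring
    have h₂ : Bil p k (l - 1) j b n (D * (p : ℝ) ^ (E - gain k η r (l - 1) * b)) := by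
      rcases Nat.eq_or_lt_of_le hl with hl1 | hl1
      · have e : l - 1 = 0 := by omega
        rw [e, gain_zero k (by omega)]
        have h3 := bil_zero (i := j) (by omega) hkp hb (by positivity) (hD (n - b))
        rw [Nat.sub_add_cancel (by omega)] at h3
        refine h3.mono ?_
        have hCD : C₀ ≤ D := hC.trans (le_mul_of_one_le_left hC0.le hC₁)
        refine mul_le_mul hCD (Real.rpow_le_rpow_of_exponent_le hp1 ?_) (by positivity) hD0.le
        rw [Nat.cast_sub (by omega), hE]
        have : 0 ≤ ((r + 1 : ℕ) : ℝ) * ε * n := by positivity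
        linarith
      · set j₂ := (k - (l - 1) + 1) * b / (l - 1) with hj₂
        have hj₂n : j₂ ≤ n := by
          refine (Nat.div_le_self _ _).trans (le_trans ?_ (hbase.trans' hbk))
          exact Nat.mul_le_mul_right _ (by omega)
        refine (bil_step (l := l - 1) (by omega) (by omega) hkp hj1 hb (j := j₂) ?_ hj₂n
          (by omega) (Nat.mul_div_le _ _) (by positivity) (by positivity)
          (hL (l - 1) (by omega) (by omega) _) (ih (l - 1) b n (by omega) (by omega) hb
            ((pow_dvd_pow _ (by omega)).trans hdvd) hbn)).mono (hcomb _ _ (by omega))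
        rw [Nat.le_div_iff_mul_le (by omega), hbdef, hjdef]
        calc (k - l + 1) * b' * (l - 1) = ((k - l + 1) * (l - 1)) * b' := by ring
          _ ≤ ((k - (l - 1) + 1) * l) * b' :=
            Nat.mul_le_mul_right _ (Nat.mul_le_mul (by omega) (by omega))
          _ = _ := by ring
    refine (bil_holder hl hlk (by positivity) (by positivity) h₁ h₂).mono ?_
    have hlk' : (l : ℝ) + 1 ≤ k := by exact_mod_cast hlk
    have hl' : (1 : ℝ) ≤ l := by exact_mod_cast hl
    have hg := gain_succ hη r hl hlk
    set θ : ℝ := 1 / ((k : ℝ) - l + 1) with hθ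
    have hkl0 : (k : ℝ) - l + 1 ≠ 0 := by linarith
    have hθj : θ * j = b' := by
      rw [hjdef, hθ]; push_cast [hlk.le]; field_simp
    have hbb : (b : ℝ) = l * b' := by rw [hbdef]; push_cast; ring
    rw [Real.mul_rpow hD0.le (by positivity), Real.mul_rpow hD0.le (by positivity),
      ← Real.rpow_mul hp0.le, ← Real.rpow_mul hp0.le, mul_mul_mul_comm, ← Real.rpow_add hD0,
      ← Real.rpow_add hp0, add_sub_cancel, Real.rpow_one]
    refine mul_le_mul_of_nonneg_left (Real.rpow_le_rpow_of_exponent_le hp1 ?_) hD0.le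
    have hg2 := mul_le_mul_of_nonneg_right hg (Nat.cast_nonneg (α := ℝ) b)
    have h5 : (E - gain k η r (k - l) * j) * θ = E * θ - gain k η r (k - l) * b' := by
      rw [← hθj]; ring
    have h6 : (1 / (l : ℝ) * gain k η r (k - l) + (1 - θ) * gain k η r (l - 1)) * b =
        gain k η r (k - l) * b' + (1 - θ) * gain k η r (l - 1) * b := by
      rw [hbb]; field_simp
    rw [h5]
    rw [h6] at hg2
    linarith

theorem sum_phase_one {n : ℕ} (v w : Fin 1 → ℤ_[p]) :
    ∑ x : Fin 1 → ZMod (p ^ n), phase p n x v * (starRingEnd ℂ) (phase p n x w) =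
      if PadicInt.toZModPow n (v 0) = PadicInt.toZModPow n (w 0) then ((p ^ n : ℕ) : ℂ) else 0 := by
  have h : ∀ x : Fin 1 → ZMod (p ^ n), phase p n x v * (starRingEnd ℂ) (phase p n x w) =
      ZMod.stdAddChar (x 0 * (PadicInt.toZModPow n (v 0) - PadicInt.toZModPow n (w 0))) := by
    intro x
    have h1 : ∀ z : ZMod (p ^ n), ((z.val : ℕ) : ZMod (p ^ n)) = z := fun z => by simp
    simp only [phase, padicChar, Fin.sum_univ_one, map_mul, map_natCast, h1, mul_sub,
      sub_eq_add_neg (x 0 * PadicInt.toZModPow n (v 0)), AddChar.map_add_eq_mul,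
      AddChar.map_neg_eq_conj]
  refine (Finset.sum_congr rfl fun x _ => h x).trans ?_
  refine (Fintype.sum_equiv (Equiv.funUnique (Fin 1) (ZMod (p ^ n))) _
      (fun z => ZMod.stdAddChar (z * (PadicInt.toZModPow n (v 0) - PadicInt.toZModPow n (w 0))))
      (fun x => rfl)).trans ?_
  rw [AddChar.sum_mulShift _ (ZMod.isPrimitive_stdAddChar _), ZMod.card]
  simp [sub_eq_zero]

theorem critExp_one : critExp 1 = 1 := rfl

/-- Square functions: orthogonality of the cells in the linear case. -/
theorem moment_one_eq (n : ℕ) (γ : Fin 1 → Polynomial ℤ_[p]) (u : ℕ → ℤ_[p]) (a : ℕ → ℂ)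
    (S : Finset ℕ) : (moment (1 * n) γ u a S : ℂ) =
      ∑ t ∈ S, ∑ t' ∈ S, a t * (starRingEnd ℂ) (a t') *
        if PadicInt.toZModPow (1 * n) ((γ 0).eval (u t)) =
          PadicInt.toZModPow (1 * n) ((γ 0).eval (u t')) then ((p ^ (1 * n) : ℕ) : ℂ) else 0 := by
  have h : ∀ x : Fin 1 → ZMod (p ^ (1 * n)), ((‖expSum (1 * n) γ u a S x‖ ^ (2 * critExp 1) : ℝ) : ℂ) =
      ∑ t ∈ S, ∑ t' ∈ S, a t * (starRingEnd ℂ) (a t') *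
        (phase p (1 * n) x (fun j => (γ j).eval (u t)) *
          (starRingEnd ℂ) (phase p (1 * n) x (fun j => (γ j).eval (u t')))) := by
    intro x
    rw [critExp_one, mul_one, Complex.ofReal_pow, ← Complex.mul_conj', expSum, map_sum,
      Finset.sum_mul_sum]
    refine Finset.sum_congr rfl fun t _ => Finset.sum_congr rfl fun t' _ => ?_
    rw [map_mul]; ring
  rw [moment, Complex.ofReal_sum, Finset.sum_congr rfl fun x _ => h x, Finset.sum_comm]
  refine Finset.sum_congr rfl fun t _ => ?_
  rw [Finset.sum_comm]
  refine Finset.sum_congr rfl fun t' _ => ?_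
  rw [← Finset.mul_sum, sum_phase_one]

theorem momentLike_eval_congr {n : ℕ} {γ : Fin 1 → Polynomial ℤ_[p]} (hγ : MomentLike γ)
    (x y : ℤ_[p]) :
    PadicInt.toZModPow (1 * n) ((γ 0).eval x) = PadicInt.toZModPow (1 * n) ((γ 0).eval y) ↔
      PadicInt.toZModPow n x = PadicInt.toZModPow n y := by
  obtain ⟨q, hq⟩ := hγ 0
  rw [toZModPow_eq_iff, toZModPow_eq_iff, one_mul]
  obtain ⟨r, hr⟩ := Polynomial.sub_dvd_eval_sub x y q
  have h : (γ 0).eval x - (γ 0).eval y = (x - y) * (1 + p * r) := by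
    rw [hq]
    simp only [Polynomial.eval_add, Polynomial.eval_mul, Polynomial.eval_pow, Polynomial.eval_X,
      Polynomial.eval_C, Fin.val_zero]
    linear_combination (p : ℤ_[p]) * hr
  have hu : IsUnit (1 + (p : ℤ_[p]) * r) := by
    rw [padicInt_isUnit_iff]
    intro hd
    have : (p : ℤ_[p]) ∣ 1 := (dvd_add_left (dvd_mul_right _ _)).1 hd
    exact (padicInt_isUnit_iff.1 isUnit_one) this
  rw [h]
  exact hu.dvd_mul_right

theorem dec_one (n : ℕ) : Dec p 1 n 1 := by
  intro γ hγ u a S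
  have key : moment (1 * n) γ u a S = ∑ J : ZMod (p ^ n), moment (1 * n) γ u a (cell S u n J) := by
    have : (moment (1 * n) γ u a S : ℂ) =
        ((∑ J : ZMod (p ^ n), moment (1 * n) γ u a (cell S u n J) : ℝ) : ℂ) := by
      rw [Complex.ofReal_sum, Finset.sum_congr rfl fun J _ => moment_one_eq n γ u a _,
        moment_one_eq]
      simp only [momentLike_eval_congr hγ, cell, Finset.sum_filter]
      refine Eq.trans ?_ Finset.sum_comm
      refine Finset.sum_congr rfl fun t _ => ?_
      refine Eq.trans ?_ (Finset.sum_ite_eq Finset.univ (PadicInt.toZModPow n (u t)) _).symm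
      rw [if_pos (mem_univ _)]
      refine Finset.sum_congr rfl fun t' _ => ?_
      by_cases h : PadicInt.toZModPow n (u t) = PadicInt.toZModPow n (u t')
      · simp [h]
      · simp [h, Ne.symm h]
    exact_mod_cast this
  simp only [cellNorm, critExp_one, Nat.cast_one, div_one, Real.rpow_one, pow_one, one_mul] at key ⊢
  exact key.le

theorem exists_max_norm {ι : Type*} [Fintype ι] [Nonempty ι] (z : ι → ℂ) :
    ∃ i, ‖∑ j, z j‖ ≤ Fintype.card ι * ‖z i‖ ∧ ∀ j, ‖z j‖ ≤ ‖z i‖ := by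
  obtain ⟨i, -, hi⟩ := Finset.exists_max_image Finset.univ (fun j => ‖z j‖) univ_nonempty
  refine ⟨i, ?_, fun j => hi j (mem_univ j)⟩
  calc ‖∑ j, z j‖ ≤ ∑ j, ‖z j‖ := norm_sum_le _ _
    _ ≤ ∑ _j : ι, ‖z i‖ := Finset.sum_le_sum fun j hj => hi j hj
    _ = _ := by simp

theorem norm_sum_pow_le {ι : Type*} [Fintype ι] [Nonempty ι] (z : ι → ℂ) (m : ℕ) :
    ‖∑ j, z j‖ ^ m ≤ (Fintype.card ι : ℝ) ^ m * ∑ j, ‖z j‖ ^ m := by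
  obtain ⟨i, hi, -⟩ := exists_max_norm z
  calc ‖∑ j, z j‖ ^ m ≤ (Fintype.card ι * ‖z i‖) ^ m := by gcongr
    _ = (Fintype.card ι : ℝ) ^ m * ‖z i‖ ^ m := mul_pow _ _ _
    _ ≤ _ := by
      gcongr
      exact Finset.single_le_sum (f := fun j => ‖z j‖ ^ m) (fun j _ => by positivity) (mem_univ i)

theorem sum_pow_le_pow_sum_of_nonneg {ι : Type*} [Fintype ι] (a : ι → ℝ) (ha : ∀ i, 0 ≤ a i)
    {s : ℕ} (hs : 1 ≤ s) : ∑ i, a i ^ s ≤ (∑ i, a i) ^ s := by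
  obtain ⟨t, rfl⟩ : ∃ t, s = t + 1 := ⟨s - 1, by omega⟩
  rw [pow_succ', Finset.sum_mul]
  refine Finset.sum_le_sum fun i _ => ?_
  rw [pow_succ']
  have := ha i
  have : a i ≤ ∑ i, a i := Finset.single_le_sum (fun j _ => ha j) (mem_univ i)
  gcongr

theorem broad_narrow_pointwise {ι : Type*} [Fintype ι] [Nonempty ι] [DecidableEq ι] (z : ι → ℂ)
    {s : ℕ} (hs : 1 ≤ s) :
    ‖∑ i, z i‖ ^ (2 * s) ≤ 4 ^ s * ∑ i, ‖z i‖ ^ (2 * s) +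
      (2 * Fintype.card ι : ℝ) ^ (2 * s) * ∑ i, ∑ j,
        if i = j then 0 else ‖z i‖ ^ 2 * ‖z j‖ ^ (2 * (s - 1)) := by
  obtain ⟨i, hi, hm⟩ := exists_max_norm z
  set y : ι → ℂ := fun j => if j = i then 0 else z j
  obtain ⟨j, hj, -⟩ := exists_max_norm y
  have hsum : ∑ j, z j = z i + ∑ j, y j := by
    rw [← Finset.add_sum_erase _ _ (mem_univ i), ← Finset.add_sum_erase _ y (mem_univ i)]
    simp only [y, if_true, zero_add]
    congr 1
    exact Finset.sum_congr rfl fun j hj => by simp [Finset.ne_of_mem_erase hj]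
  have hnn : ∀ i j : ι, 0 ≤ if i = j then (0 : ℝ) else ‖z i‖ ^ 2 * ‖z j‖ ^ (2 * (s - 1)) := by
    intro i j; split_ifs <;> positivity
  have hc : (1 : ℝ) ≤ Fintype.card ι := by exact_mod_cast Fintype.card_pos
  rcases le_total ‖∑ j, y j‖ ‖z i‖ with h | h
  · have h1 : ‖∑ i, z i‖ ^ (2 * s) ≤ 4 ^ s * ‖z i‖ ^ (2 * s) := by
      have : ‖∑ i, z i‖ ≤ 2 * ‖z i‖ := by
        rw [hsum]; linarith [norm_add_le (z i) (∑ j, y j)]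
      calc ‖∑ i, z i‖ ^ (2 * s) ≤ (2 * ‖z i‖) ^ (2 * s) := by gcongr
        _ = _ := by rw [mul_pow, pow_mul 2 2 s]; norm_num
    have h2 : ‖z i‖ ^ (2 * s) ≤ ∑ i, ‖z i‖ ^ (2 * s) :=
      Finset.single_le_sum (f := fun j => ‖z j‖ ^ (2 * s)) (fun j _ => by positivity) (mem_univ i)
    have h3 : 0 ≤ ∑ i, ∑ j, if i = j then (0 : ℝ) else ‖z i‖ ^ 2 * ‖z j‖ ^ (2 * (s - 1)) :=
      Finset.sum_nonneg fun i _ => Finset.sum_nonneg fun j _ => hnn i j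
    have h4 : (4 : ℝ) ^ s * ‖z i‖ ^ (2 * s) ≤ 4 ^ s * ∑ i, ‖z i‖ ^ (2 * s) := by gcongr
    have h5 : 0 ≤ (2 * Fintype.card ι : ℝ) ^ (2 * s) * ∑ i, ∑ j,
        if i = j then 0 else ‖z i‖ ^ 2 * ‖z j‖ ^ (2 * (s - 1)) := by positivity
    linarith
  · have hA : ‖∑ i, z i‖ ≤ 2 * Fintype.card ι * ‖y j‖ := by
      rw [hsum]; linarith [norm_add_le (z i) (∑ j, y j)]
    have hB : ‖∑ i, z i‖ ≤ 2 * Fintype.card ι * ‖z i‖ := by nlinarith [norm_nonneg (z i)]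
    have h1 : ‖∑ i, z i‖ ^ (2 * s) ≤
        (2 * Fintype.card ι : ℝ) ^ (2 * s) * (‖y j‖ ^ 2 * ‖z i‖ ^ (2 * (s - 1))) := by
      obtain ⟨t, rfl⟩ : ∃ t, s = t + 1 := ⟨s - 1, by omega⟩
      calc ‖∑ i, z i‖ ^ (2 * (t + 1)) = ‖∑ i, z i‖ ^ 2 * ‖∑ i, z i‖ ^ (2 * t) := by ring
        _ ≤ (2 * Fintype.card ι * ‖y j‖) ^ 2 * (2 * Fintype.card ι * ‖z i‖) ^ (2 * t) := by gcongr
        _ = _ := by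
          rw [Nat.add_sub_cancel, mul_pow _ _ 2, mul_pow _ _ (2 * t)]; ring
    refine h1.trans ?_
    have h2 : 0 ≤ (4 : ℝ) ^ s * ∑ i, ‖z i‖ ^ (2 * s) := by positivity
    have h3 : ‖y j‖ ^ 2 * ‖z i‖ ^ (2 * (s - 1)) ≤
        ∑ i, ∑ j, if i = j then (0 : ℝ) else ‖z i‖ ^ 2 * ‖z j‖ ^ (2 * (s - 1)) := by
      by_cases hji : j = i
      · simp only [y, hji, if_true, norm_zero, ne_eq, OfNat.ofNat_ne_zero, not_false_eq_true,
          zero_pow, zero_mul]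
        exact Finset.sum_nonneg fun i _ => Finset.sum_nonneg fun j _ => hnn i j
      · calc ‖y j‖ ^ 2 * ‖z i‖ ^ (2 * (s - 1)) =
            if j = i then (0 : ℝ) else ‖z j‖ ^ 2 * ‖z i‖ ^ (2 * (s - 1)) := by simp [y, hji]
          _ ≤ ∑ i, if j = i then (0 : ℝ) else ‖z j‖ ^ 2 * ‖z i‖ ^ (2 * (s - 1)) :=
            Finset.single_le_sum (f := fun i =>
              if j = i then (0 : ℝ) else ‖z j‖ ^ 2 * ‖z i‖ ^ (2 * (s - 1)))
              (fun i _ => hnn j i) (mem_univ i)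
          _ ≤ _ := Finset.single_le_sum (f := fun j => ∑ i,
              if j = i then (0 : ℝ) else ‖z j‖ ^ 2 * ‖z i‖ ^ (2 * (s - 1)))
              (fun j _ => Finset.sum_nonneg fun i _ => hnn j i) (mem_univ j)
    have : (2 * Fintype.card ι : ℝ) ^ (2 * s) * (‖y j‖ ^ 2 * ‖z i‖ ^ (2 * (s - 1))) ≤
      (2 * Fintype.card ι : ℝ) ^ (2 * s) * ∑ i, ∑ j,
        if i = j then (0 : ℝ) else ‖z i‖ ^ 2 * ‖z j‖ ^ (2 * (s - 1)) := by gcongr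
    linarith

theorem expSum_eq_sum_cell {k : ℕ} (B n : ℕ) (γ : Fin k → Polynomial ℤ_[p]) (u : ℕ → ℤ_[p])
    (a : ℕ → ℂ) (S : Finset ℕ) (x : Fin k → ZMod (p ^ B)) :
    expSum B γ u a S x = ∑ J : ZMod (p ^ n), expSum B γ u a (cell S u n J) x := by
  simp only [expSum, cell]
  exact (Finset.sum_fiberwise S (fun t => PadicInt.toZModPow n (u t)) _).symm

theorem cellNorm_mono_cell {k : ℕ} (hk : 1 ≤ k) {j n : ℕ} (hjn : j ≤ n)
    (γ : Fin k → Polynomial ℤ_[p]) (u : ℕ → ℤ_[p]) (a : ℕ → ℂ) (S : Finset ℕ) (J : ZMod (p ^ j)) :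
    cellNorm n γ u a (cell S u j J) ≤ cellNorm n γ u a S := by
  rw [← sum_cellNorm_cell hk hjn γ u a S]
  exact Finset.single_le_sum (f := fun J => cellNorm n γ u a (cell S u j J))
    (fun J _ => cellNorm_nonneg _ _ _ _ _) (mem_univ J)

/-- The bilinear estimate controls products over cells in different residue classes mod `p`. -/
theorem broad_le {k b n : ℕ} (hk : 2 ≤ k) (hb : 1 ≤ b) (hbn : k * b ≤ n) {K : ℝ} (hK : 0 ≤ K)
    (hB : Bil p k 1 (k * b) b n K) (γ : Fin k → Polynomial ℤ_[p]) (hγ : MomentLike γ)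
    (u : ℕ → ℤ_[p]) (a : ℕ → ℂ) (S : Finset ℕ) (I I' : ZMod (p ^ 1)) (hI : I ≠ I') :
    ∑ x, ‖expSum (k * n) γ u a (cell S u 1 I) x‖ ^ 2 *
      ‖expSum (k * n) γ u a (cell S u 1 I') x‖ ^ (2 * (critExp k - 1)) ≤
      (p : ℝ) ^ (3 * (k * b) + b * (2 * (critExp k - 1)) + b) * K *
        cellNorm n γ u a S ^ critExp k := by
  have hs : 3 ≤ critExp k := by have := two_mul_critExp k; nlinarith
  set s := critExp k with hsdef
  set Q := cellNorm n γ u a S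
  have hQ : 0 ≤ Q := cellNorm_nonneg _ _ _ _ _
  have hbn' : b ≤ n := by nlinarith
  set T := cell S u 1 I
  set T' := cell S u 1 I'
  have hterm : ∀ (J : ZMod (p ^ (k * b))) (J' : ZMod (p ^ b)),
      ∑ x, ‖expSum (k * n) γ u a (cell T u (k * b) J) x‖ ^ 2 *
        ‖expSum (k * n) γ u a (cell T' u b J') x‖ ^ (2 * (s - 1)) ≤ K * Q ^ s := by
    intro J J'
    rcases (cell T u (k * b) J).eq_empty_or_nonempty with h1 | ⟨t, ht⟩
    · simp only [h1, expSum, Finset.sum_empty, norm_zero, ne_eq, OfNat.ofNat_ne_zero,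
        not_false_eq_true, zero_pow, zero_mul, Finset.sum_const_zero]
      positivity
    rcases (cell T' u b J').eq_empty_or_nonempty with h2 | ⟨t', ht'⟩
    · have : 2 * (s - 1) ≠ 0 := by omega
      simp only [h2, expSum, Finset.sum_empty, norm_zero, ne_eq, this,
        not_false_eq_true, zero_pow, mul_zero, Finset.sum_const_zero]
      positivity
    have hmem : ∀ {m : ℕ} {T : Finset ℕ} {J : ZMod (p ^ m)} {t : ℕ}, t ∈ cell T u m J →
        t ∈ T ∧ PadicInt.toZModPow m (u t) = J := fun h => by simpa [cell] using h
    have key := hB γ hγ u a (cell T u (k * b) J) (cell T' u b J') (u t) (u t') ?_ ?_ ?_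
    · rw [critExp_one, mul_one] at key
      refine key.trans ?_
      have e1 : cellNorm n γ u a (cell T u (k * b) J) ≤ Q :=
        (cellNorm_mono_cell (by omega) hbn _ _ _ _ _).trans
          (cellNorm_mono_cell (by omega) (by omega) _ _ _ _ _)
      have e2 : cellNorm n γ u a (cell T' u b J') ≤ Q :=
        (cellNorm_mono_cell (by omega) hbn' _ _ _ _ _).trans
          (cellNorm_mono_cell (by omega) (by omega) _ _ _ _ _)
      have n1 := cellNorm_nonneg n γ u a (cell T u (k * b) J)
      have n2 := cellNorm_nonneg n γ u a (cell T' u b J')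
      calc _ ≤ K * Q ^ 1 * Q ^ (s - 1) := by gcongr
        _ = K * Q ^ s := by
          rw [mul_assoc, ← pow_add]; congr 2; omega
    · intro h
      apply hI
      have := toZModPow_eq_iff (p := p) (n := 1).2 (by simpa using h)
      rw [(hmem (hmem ht).1).2, (hmem (hmem ht').1).2] at this
      exact this
    · intro r hr
      exact toZModPow_eq_iff.1 ((hmem hr).2.trans (hmem ht).2.symm)
    · intro r hr
      exact toZModPow_eq_iff.1 ((hmem hr).2.trans (hmem ht').2.symm)
  have hp0 : 0 < p := (Fact.out : p.Prime).pos
  calc _ ≤ ∑ x, (((p : ℝ) ^ (k * b)) ^ 2 *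
          ∑ J : ZMod (p ^ (k * b)), ‖expSum (k * n) γ u a (cell T u (k * b) J) x‖ ^ 2) *
        (((p : ℝ) ^ b) ^ (2 * (s - 1)) *
          ∑ J' : ZMod (p ^ b), ‖expSum (k * n) γ u a (cell T' u b J') x‖ ^ (2 * (s - 1))) := by
        refine Finset.sum_le_sum fun x _ => ?_
        have a1 := norm_sum_pow_le (fun J : ZMod (p ^ (k * b)) =>
          expSum (k * n) γ u a (cell T u (k * b) J) x) 2
        have a2 := norm_sum_pow_le (fun J : ZMod (p ^ b) =>
          expSum (k * n) γ u a (cell T' u b J) x) (2 * (s - 1))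
        rw [← expSum_eq_sum_cell, ZMod.card, Nat.cast_pow] at a1 a2
        gcongr
    _ = ((p : ℝ) ^ (k * b)) ^ 2 * ((p : ℝ) ^ b) ^ (2 * (s - 1)) *
        ∑ J : ZMod (p ^ (k * b)), ∑ J' : ZMod (p ^ b),
          ∑ x, ‖expSum (k * n) γ u a (cell T u (k * b) J) x‖ ^ 2 *
            ‖expSum (k * n) γ u a (cell T' u b J') x‖ ^ (2 * (s - 1)) := by
        rw [Finset.sum_congr rfl fun J _ => Finset.sum_comm, Finset.sum_comm, Finset.mul_sum]
        refine Finset.sum_congr rfl fun x _ => ?_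
        rw [← Finset.sum_mul_sum]
        ring
    _ ≤ ((p : ℝ) ^ (k * b)) ^ 2 * ((p : ℝ) ^ b) ^ (2 * (s - 1)) *
        ∑ J : ZMod (p ^ (k * b)), ∑ J' : ZMod (p ^ b), K * Q ^ s := by
        gcongr with J _ J' _
        exact hterm J J'
    _ = _ := by
        simp only [Finset.sum_const, Finset.card_univ, ZMod.card, nsmul_eq_mul, Nat.cast_pow]
        ring

theorem dec_succ {k b n : ℕ} (hk : 2 ≤ k) (hkp : k < p) (hb : 1 ≤ b) (hbn : k * b ≤ n + 1)
    {K K' : ℝ} (hK : 0 ≤ K) (hK' : 0 ≤ K') (hD : Dec p k n K) (hB : Bil p k 1 (k * b) b (n + 1) K') :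
    Dec p k (n + 1) (4 ^ critExp k * K +
      (2 * p) ^ (2 * critExp k) * p ^ 2 *
        (p : ℝ) ^ (3 * (k * b) + b * (2 * (critExp k - 1)) + b) * K') := by
  intro γ hγ u a S
  have hs : 3 ≤ critExp k := by have := two_mul_critExp k; nlinarith
  set s := critExp k with hsdef
  set Q := cellNorm (n + 1) γ u a S with hQdef
  have hQ : 0 ≤ Q := cellNorm_nonneg _ _ _ _ _
  have hnarrow : ∑ I : ZMod (p ^ 1), moment (k * (n + 1)) γ u a (cell S u 1 I) ≤ K * Q ^ s := by
    calc _ ≤ ∑ I : ZMod (p ^ 1), K * cellNorm (n + 1) γ u a (cell S u 1 I) ^ s := by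
          refine Finset.sum_le_sum fun I _ => ?_
          obtain ⟨c, hc⟩ : ∃ c : ℕ, (PadicInt.toZModPow 1 (c : ℤ_[p]) : ZMod (p ^ 1)) = I :=
            ⟨I.val, by simp⟩
          refine dec_on_ball (by omega) hkp le_rfl hK hD γ hγ u a _ c fun t ht => ?_
          rw [← toZModPow_eq_iff, hc]
          exact (by simpa [cell] using ht : _ ∧ _).2
      _ = K * ∑ I : ZMod (p ^ 1), cellNorm (n + 1) γ u a (cell S u 1 I) ^ s := by
          rw [Finset.mul_sum]
      _ ≤ K * (∑ I : ZMod (p ^ 1), cellNorm (n + 1) γ u a (cell S u 1 I)) ^ s := by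
          gcongr
          exact sum_pow_le_pow_sum_of_nonneg _ (fun I => cellNorm_nonneg _ _ _ _ _) (by omega)
      _ = _ := by rw [sum_cellNorm_cell (by omega) (by omega)]
  set Z := (p : ℝ) ^ (3 * (k * b) + b * (2 * (s - 1)) + b) * K' * Q ^ s with hZ
  have hZ0 : 0 ≤ Z := by positivity
  have hbroad : ∑ I : ZMod (p ^ 1), ∑ I' : ZMod (p ^ 1), ∑ x, (if I = I' then 0 else
      ‖expSum (k * (n + 1)) γ u a (cell S u 1 I) x‖ ^ 2 *
      ‖expSum (k * (n + 1)) γ u a (cell S u 1 I') x‖ ^ (2 * (s - 1))) ≤ p ^ 2 * Z := by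
    calc _ ≤ ∑ I : ZMod (p ^ 1), ∑ I' : ZMod (p ^ 1), Z := by
          refine Finset.sum_le_sum fun I _ => Finset.sum_le_sum fun I' _ => ?_
          by_cases h : I = I'
          · simpa [h] using hZ0
          · simp only [h, if_false]
            exact broad_le hk hb hbn hK' hB γ hγ u a S I I' h
      _ = _ := by
          simp only [Finset.sum_const, Finset.card_univ, ZMod.card, nsmul_eq_mul, Nat.cast_pow]
          ring
  calc moment (k * (n + 1)) γ u a S ≤ ∑ x : Fin k → ZMod (p ^ (k * (n + 1))),
        (4 ^ s * ∑ I : ZMod (p ^ 1), ‖expSum (k * (n + 1)) γ u a (cell S u 1 I) x‖ ^ (2 * s) +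
          (2 * p : ℝ) ^ (2 * s) * ∑ I : ZMod (p ^ 1), ∑ I' : ZMod (p ^ 1), if I = I' then 0 else
            ‖expSum (k * (n + 1)) γ u a (cell S u 1 I) x‖ ^ 2 *
            ‖expSum (k * (n + 1)) γ u a (cell S u 1 I') x‖ ^ (2 * (s - 1))) := by
        refine Finset.sum_le_sum fun x _ => ?_
        have := broad_narrow_pointwise (fun I : ZMod (p ^ 1) =>
          expSum (k * (n + 1)) γ u a (cell S u 1 I) x) (s := s) (by omega)
        rw [← expSum_eq_sum_cell, ZMod.card, Nat.cast_pow, pow_one (p : ℝ)] at this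
        exact this
    _ = 4 ^ s * ∑ I : ZMod (p ^ 1), moment (k * (n + 1)) γ u a (cell S u 1 I) +
        (2 * p : ℝ) ^ (2 * s) * ∑ I : ZMod (p ^ 1), ∑ I' : ZMod (p ^ 1), ∑ x, (if I = I' then 0 else
      ‖expSum (k * (n + 1)) γ u a (cell S u 1 I) x‖ ^ 2 *
      ‖expSum (k * (n + 1)) γ u a (cell S u 1 I') x‖ ^ (2 * (s - 1))) := by
        rw [Finset.sum_add_distrib, ← Finset.mul_sum, ← Finset.mul_sum]
        congr 2
        · rw [Finset.sum_comm]; rfl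
        · rw [Finset.sum_comm]
          exact Finset.sum_congr rfl fun I _ => Finset.sum_comm
    _ ≤ 4 ^ s * (K * Q ^ s) + (2 * p : ℝ) ^ (2 * s) * (p ^ 2 * Z) := by gcongr
    _ = _ := by rw [hZ]; ring

end PrimeModulus

/-- Decoupling with constant `O(p ^ (η n))`. -/
def HasExp (p : ℕ) [Fact p.Prime] (k : ℕ) (η : ℝ) : Prop :=
  ∃ C : ℝ, 0 < C ∧ ∀ n : ℕ, Dec p k n (C * (p : ℝ) ^ (η * n))

theorem HasExp.mono {p : ℕ} [Fact p.Prime] {k : ℕ} {η η' : ℝ} (h : HasExp p k η) (hη : η ≤ η') :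
    HasExp p k η' := by
  obtain ⟨C, hC, hD⟩ := h
  have hp : (1 : ℝ) ≤ p := by exact_mod_cast (Fact.out : p.Prime).one_le
  refine ⟨C, hC, fun n => (hD n).mono ?_⟩
  gcongr

theorem hasExp_trivial (p : ℕ) [Fact p.Prime] {k : ℕ} (hk : 1 ≤ k) :
    HasExp p k (2 * critExp k) := by
  refine ⟨1, one_pos, fun n γ _ u a S => ?_⟩
  have hs := critExp_pos hk
  have hp0 : (0 : ℝ) < p := by exact_mod_cast (Fact.out : p.Prime).pos
  have h1 : moment (k * n) γ u a S ≤
      ((p : ℝ) ^ n) ^ (2 * critExp k) * ∑ J : ZMod (p ^ n), moment (k * n) γ u a (cell S u n J) := by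
    simp only [moment]
    rw [Finset.sum_comm, Finset.mul_sum]
    refine Finset.sum_le_sum fun x _ => ?_
    have := norm_sum_pow_le (fun J : ZMod (p ^ n) => expSum (k * n) γ u a (cell S u n J) x)
      (2 * critExp k)
    rwa [← expSum_eq_sum_cell, ZMod.card, Nat.cast_pow] at this
  have h2 : ∑ J : ZMod (p ^ n), moment (k * n) γ u a (cell S u n J) ≤
      cellNorm n γ u a S ^ critExp k := by
    have := sum_pow_le_pow_sum_of_nonneg (fun J : ZMod (p ^ n) =>
      moment (k * n) γ u a (cell S u n J) ^ (1 / (critExp k : ℝ)))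
      (fun J => Real.rpow_nonneg (moment_nonneg _ _ _ _ _) _) hs
    refine le_trans (Finset.sum_le_sum fun J _ => ?_) this
    rw [one_div, Real.rpow_inv_natCast_pow (moment_nonneg _ _ _ _ _) (by omega)]
  have h3 : (p : ℝ) ^ ((2 * critExp k : ℝ) * n) = ((p : ℝ) ^ n) ^ (2 * critExp k) := by
    rw [← pow_mul, ← Real.rpow_natCast]; congr 1; push_cast; ring
  rw [one_mul, h3]
  calc _ ≤ _ := h1
    _ ≤ _ := by gcongr

theorem hasExp_step {k : ℕ} (hk : 2 ≤ k) {η₀ : ℝ} (hη₀ : 0 < η₀) :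
    ∃ ε > (0 : ℝ), ∃ δ > (0 : ℝ), ∀ (p : ℕ) [Fact p.Prime], k < p →
      2 * 4 ^ critExp k ≤ (p : ℝ) ^ η₀ → (∀ l : ℕ, 1 ≤ l → l < k → HasExp p l ε) →
      ∀ η, η₀ ≤ η → HasExp p k η → HasExp p k (max (η - δ) η₀) := by
  set s := critExp k with hs
  set E : ℕ := 3 * k + 2 * (s - 1) + 1 with hE
  have hk' : (2 : ℝ) ≤ k := by exact_mod_cast hk
  have hpos : 0 < η₀ * (k - 1) / k ^ 3 := by
    have : (0 : ℝ) < k - 1 := by linarith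
    positivity
  obtain ⟨R, hR⟩ := exists_nat_ge (((E : ℝ) + 1) / (η₀ * (k - 1) / k ^ 3))
  rw [div_le_iff₀ hpos] at hR
  have hR0 : 0 < R := by
    rcases Nat.eq_zero_or_pos R with h | h
    · rw [h] at hR; simp at hR; linarith [Nat.cast_nonneg (α := ℝ) E]
    · exact h
  set B₀ := k.factorial ^ (R + 1) with hB₀
  set M := k ^ (R + 2) * B₀ with hM
  have hB₀pos : 0 < B₀ := pow_pos (Nat.factorial_pos k) _
  have hMpos : 0 < M := Nat.mul_pos (pow_pos (by omega) _) hB₀pos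
  have hMpos' : (0 : ℝ) < M := by exact_mod_cast hMpos
  have hRpos' : (0 : ℝ) < R := by exact_mod_cast hR0
  refine ⟨1 / (2 * M * R), by positivity, 1 / (2 * M), by positivity, ?_⟩
  intro p _ hkp hp4 hL η hη ⟨C₀, hC₀, hD⟩
  have hη0 : 0 ≤ η := hη₀.le.trans hη
  have hp1 : (1 : ℝ) ≤ p := by exact_mod_cast (Fact.out : p.Prime).one_le
  have hp0 : (0 : ℝ) < p := by linarith
  choose! C hC hDl using hL
  set C₁ := 1 + ∑ l ∈ Finset.Ico 1 k, |C l|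
  have hC₁ : 1 ≤ C₁ := by
    have : 0 ≤ ∑ l ∈ Finset.Ico 1 k, |C l| := Finset.sum_nonneg fun _ _ => abs_nonneg _
    simp only [C₁]; linarith
  obtain ⟨C₂, hC₂, hBil⟩ := bil_induct hkp hη0 hC₀ hD (ε := 1 / (2 * M * R)) (by positivity) hC₁
    (fun l hl hlk n => (hDl l hl hlk n).mono (by
      gcongr
      have h1 : |C l| ≤ ∑ l ∈ Finset.Ico 1 k, |C l| :=
        Finset.single_le_sum (f := fun l => |C l|) (fun _ _ => abs_nonneg _)
          (Finset.mem_Ico.2 ⟨hl, hlk⟩)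
      simp only [C₁]; linarith [le_abs_self (C l)])) R
  have hC₂0 : 0 < C₂ := hC₀.trans_le hC₂
  set η' := max (η - 1 / (2 * M)) η₀ with hη'
  have hη'0 : 0 < η' := hη₀.trans_le (le_max_right _ _)
  set C₃ := (2 * p : ℝ) ^ (2 * s) * p ^ 2 * (C₂ * p ^ (B₀ : ℝ)) with hC₃
  have hC₃0 : 0 < C₃ := by positivity
  set A := 2 * C₃ + C₀ * p ^ (η * M) with hA
  have hA0 : 0 < A := by positivity
  refine ⟨A, hA0, fun n => ?_⟩
  induction n with
  | zero =>
    refine (hD 0).mono ?_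
    simp only [Nat.cast_zero, mul_zero, Real.rpow_zero, mul_one]
    have : (1 : ℝ) ≤ p ^ (η * M) := Real.one_le_rpow hp1 (by positivity)
    nlinarith
  | succ n ih =>
    by_cases hn : n + 1 < M
    · refine (hD (n + 1)).mono ?_
      have h1 : (p : ℝ) ^ (η * (n + 1 : ℕ)) ≤ p ^ (η * M) := by
        gcongr
      have h2 : (1 : ℝ) ≤ p ^ (η' * (n + 1 : ℕ)) := Real.one_le_rpow hp1 (by positivity)
      calc C₀ * (p : ℝ) ^ (η * (n + 1 : ℕ)) ≤ C₀ * p ^ (η * M) := by gcongr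
        _ ≤ A := by rw [hA]; linarith
        _ ≤ _ := le_mul_of_one_le_right hA0.le h2
    · push Not at hn
      set q := (n + 1) / M with hq
      have hq1 : 1 ≤ q := (Nat.one_le_div_iff hMpos).2 hn
      have hqn : M * q ≤ n + 1 := Nat.mul_div_le _ _
      have hqn' : (n + 1 : ℕ) < M * (q + 1) := by
        rw [hq, mul_comm]; exact Nat.lt_mul_of_div_lt (Nat.lt_succ_self _) hMpos
      set b := B₀ * q with hb
      have hb1 : 1 ≤ b := Nat.mul_pos hB₀pos hq1
      have hbn : k ^ (R + 2) * b ≤ n + 1 := by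
        calc k ^ (R + 2) * b = M * q := by rw [hM, hb]; ring
          _ ≤ _ := hqn
      have hkb : k * b ≤ n + 1 := by
        refine le_trans (Nat.mul_le_mul_right b ?_) hbn
        exact Nat.le_self_pow (by omega) k
      have hB := hBil 1 b (n + 1) le_rfl (by omega) hb1 ⟨q, rfl⟩ hbn
      rw [show (k - 1 + 1) * b / 1 = k * b by rw [Nat.div_one, Nat.sub_add_cancel (by omega)]] at hB
      refine (dec_succ hk hkp hb1 hkb (by positivity) (by positivity) ih hB).mono ?_
      have hgain : (E : ℝ) + 1 ≤ gain k η R 1 := by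
        refine hR.trans ?_
        simp only [gain, Nat.cast_one, sub_self, mul_zero, zero_div, zero_add, mul_one]
        have : (0 : ℝ) ≤ k - 1 := by linarith
        rw [← mul_div_assoc, ← mul_assoc]
        gcongr
      have hbig : (n + 1 : ℕ) / (M : ℝ) - B₀ ≤ b := by
        rw [sub_le_iff_le_add, div_le_iff₀ hMpos']
        have h1 : ((n + 1 : ℕ) : ℝ) ≤ M * (q + 1) := by exact_mod_cast hqn'.le
        have h2 : (1 : ℝ) ≤ B₀ := by exact_mod_cast hB₀pos
        calc ((n + 1 : ℕ) : ℝ) ≤ M * (q + 1) := h1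
          _ ≤ (B₀ * q + B₀) * M := by
            have : (0 : ℝ) ≤ M * (q + 1) := by positivity
            nlinarith
          _ = _ := by rw [hb]; push_cast; ring
      have hexp : (p : ℝ) ^ (3 * (k * b) + b * (2 * (s - 1)) + b) *
          (C₂ * (p : ℝ) ^ ((η + R * (1 / (2 * M * R))) * (n + 1 : ℕ) - gain k η R 1 * b)) ≤
          C₂ * (p ^ (B₀ : ℝ) * p ^ (η' * (n + 1 : ℕ))) := by
        rw [mul_left_comm, ← Real.rpow_natCast, ← Real.rpow_add hp0, ← Real.rpow_add hp0]
        refine mul_le_mul_of_nonneg_left (Real.rpow_le_rpow_of_exponent_le hp1 ?_) hC₂0.le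
        have e1 : ((3 * (k * b) + b * (2 * (s - 1)) + b : ℕ) : ℝ) = E * b := by
          rw [hE]; push_cast; ring
        have e2 : (R : ℝ) * (1 / (2 * M * R)) = 1 / (2 * M) := by field_simp
        have e3 : η - 1 / (2 * M) ≤ η' := le_max_left _ _
        have e4 : (E + 1) * (b : ℝ) ≤ gain k η R 1 * b := by gcongr
        have e5 : (η - 1 / (2 * M)) * (n + 1 : ℕ) ≤ η' * (n + 1 : ℕ) := by gcongr
        have e6 : (η + 1 / (2 * M)) * (n + 1 : ℕ) - (n + 1 : ℕ) / (M : ℝ) =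
          (η - 1 / (2 * M)) * (n + 1 : ℕ) := by field_simp; ring
        rw [e1, e2]
        linarith
      have hfin : (4 : ℝ) ^ s * (A * p ^ (η' * n)) ≤ A / 2 * p ^ (η' * (n + 1 : ℕ)) := by
        have : (p : ℝ) ^ (η' * (n + 1 : ℕ)) = p ^ (η' * n) * p ^ η' := by
          rw [← Real.rpow_add hp0]; push_cast; ring_nf
        rw [this]
        have h4 : 2 * 4 ^ s ≤ (p : ℝ) ^ η' :=
          hp4.trans (Real.rpow_le_rpow_of_exponent_le hp1 (le_max_right _ _))
        have : 0 ≤ A * (p : ℝ) ^ (η' * n) := by positivity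
        nlinarith
      have hC3 : C₃ ≤ A / 2 := by
        have : 0 ≤ C₀ * (p : ℝ) ^ (η * M) := by positivity
        rw [hA]; linarith
      calc _ ≤ A / 2 * p ^ (η' * (n + 1 : ℕ)) +
          (2 * p : ℝ) ^ (2 * s) * p ^ 2 * (C₂ * (p ^ (B₀ : ℝ) * p ^ (η' * (n + 1 : ℕ)))) := by
            rw [mul_assoc ((2 * p : ℝ) ^ (2 * s) * p ^ 2)]
            gcongr
        _ = A / 2 * p ^ (η' * (n + 1 : ℕ)) + C₃ * p ^ (η' * (n + 1 : ℕ)) := by rw [hC₃]; ring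
        _ ≤ A / 2 * p ^ (η' * (n + 1 : ℕ)) + A / 2 * p ^ (η' * (n + 1 : ℕ)) := by gcongr
        _ = _ := by ring

/-- `ℓ²` decoupling for the moment curve over `ℤ_[p]`, for all large `p`. -/
theorem exists_hasExp (k : ℕ) (hk : 1 ≤ k) : ∀ ε > (0 : ℝ), ∃ p₀ : ℕ, ∀ (p : ℕ) [Fact p.Prime],
    p₀ ≤ p → HasExp p k ε := by
  induction k using Nat.strong_induction_on with
  | _ k ih =>
  intro η₀ hη₀
  rcases Nat.eq_or_lt_of_le hk with rfl | hk2
  · refine ⟨0, fun p _ _ => HasExp.mono (η := 0) ⟨1, one_pos, fun n => ?_⟩ hη₀.le⟩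
    simpa using dec_one n
  obtain ⟨ε, hε, δ, hδ, hstep⟩ := hasExp_step (k := k) hk2 hη₀
  choose! p₁ hp₁ using fun l (hl : 1 ≤ l) (hlk : l < k) => ih l hlk hl ε hε
  have htend : Tendsto (fun p : ℕ => (p : ℝ) ^ η₀) atTop atTop :=
    (tendsto_rpow_atTop hη₀).comp tendsto_natCast_atTop_atTop
  obtain ⟨p₂, hp₂⟩ := (htend.eventually_ge_atTop (2 * 4 ^ critExp k)).exists_forall_of_atTop
  refine ⟨p₂ + k + 1 + ∑ l ∈ Finset.Ico 1 k, p₁ l, fun p _ hp => ?_⟩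
  have hL : ∀ l : ℕ, 1 ≤ l → l < k → HasExp p l ε := by
    intro l hl hlk
    refine hp₁ l hl hlk p ?_
    have : p₁ l ≤ ∑ l ∈ Finset.Ico 1 k, p₁ l :=
      Finset.single_le_sum (f := p₁) (fun _ _ => Nat.zero_le _) (Finset.mem_Ico.2 ⟨hl, hlk⟩)
    omega
  have hiter : ∀ j : ℕ, HasExp p k (max (2 * critExp k - j * δ) η₀) := by
    intro j
    induction j with
    | zero =>
      refine (hasExp_trivial p hk).mono ?_
      simp
    | succ j ihj =>
      refine (hstep p (by omega) (hp₂ p (by omega)) hL _ (le_max_right _ _) ihj).mono ?_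
      refine max_le ?_ (le_max_right _ _)
      rcases max_cases (2 * (critExp k : ℝ) - j * δ) η₀ with ⟨h, -⟩ | ⟨h, -⟩
      · rw [h]; refine le_max_of_le_left ?_; push_cast; linarith
      · rw [h]; exact le_max_of_le_right (by linarith)
  obtain ⟨j, hj⟩ := exists_nat_ge (2 * (critExp k : ℝ) / δ)
  rw [div_le_iff₀ hδ] at hj
  refine (hiter j).mono (max_le ?_ le_rfl)
  linarith

theorem Dec.sum_le {p : ℕ} [Fact p.Prime] {k n : ℕ} (hk : 1 ≤ k) {K : ℝ} (hK : 0 ≤ K)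
    (hD : Dec p k n K) {H : ℕ} (hH : H ≤ p ^ n) {β : ℕ → ℂ} (hβ : ∀ y, ‖β y‖ ≤ 2) :
    ∑ x : Fin k → ZMod (p ^ (k * n)), ‖∑ y ∈ Finset.range H, β y *
      ZMod.stdAddChar (∑ j, x j * (y : ZMod (p ^ (k * n))) ^ (j.val + 1))‖ ^ (2 * critExp k) ≤
      K * 4 ^ critExp k * (H : ℝ) ^ critExp k * ((p ^ (k * n) : ℕ) : ℝ) ^ k := by
  have hs := critExp_pos hk
  set γ : Fin k → Polynomial ℤ_[p] := fun j => Polynomial.X ^ (j.val + 1)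
  have hγ : MomentLike γ := fun j => ⟨0, by simp [γ]⟩
  set u : ℕ → ℤ_[p] := fun t => (t : ℤ_[p])
  set P := p ^ (k * n)
  have hexp : ∀ S x, expSum (k * n) γ u β S x = ∑ y ∈ S, β y *
      ZMod.stdAddChar (∑ j, x j * (y : ZMod P) ^ (j.val + 1)) := by
    intro S x
    refine Finset.sum_congr rfl fun y _ => ?_
    simp [phase, padicChar, γ, u, map_sum, P]
  have key := hD γ hγ u β (Finset.range H)
  have hcell : ∀ J : ZMod (p ^ n), moment (k * n) γ u β (cell (range H) u n J) ^
      (1 / (critExp k : ℝ)) ≤ if J.val < H then 4 * ((P : ℝ) ^ k) ^ (1 / (critExp k : ℝ)) else 0 := by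
    intro J
    have hsub : ∀ t ∈ cell (range H) u n J, t = J.val := by
      intro t ht
      simp only [cell, u, mem_filter, mem_range, map_natCast] at ht
      rw [← ht.2, ZMod.val_natCast, Nat.mod_eq_of_lt (ht.1.trans_le hH)]
    split_ifs with h
    · have hm : moment (k * n) γ u β (cell (range H) u n J) ≤ (4 : ℝ) ^ critExp k * (P : ℝ) ^ k := by
        have h1 : ∀ x, ‖expSum (k * n) γ u β (cell (range H) u n J) x‖ ≤ 2 := by
          intro x
          have hle : (cell (range H) u n J) ⊆ {J.val} := fun t ht => by simpa using hsub t ht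
          rw [expSum]
          refine (norm_sum_le _ _).trans ?_
          refine (Finset.sum_le_sum_of_subset_of_nonneg hle fun _ _ _ => norm_nonneg _).trans ?_
          simpa [norm_phase] using hβ _
        calc _ ≤ ∑ x : Fin k → ZMod P, (2 : ℝ) ^ (2 * critExp k) := by
              refine Finset.sum_le_sum fun x _ => ?_
              gcongr
              exact h1 x
          _ = _ := by
              simp only [Finset.sum_const, Finset.card_univ, Fintype.card_fun, ZMod.card,
                Fintype.card_fin, nsmul_eq_mul, pow_mul]
              push_cast
              norm_num [mul_comm]
      calc _ ≤ ((4 : ℝ) ^ critExp k * (P : ℝ) ^ k) ^ (1 / (critExp k : ℝ)) :=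
            Real.rpow_le_rpow (moment_nonneg _ _ _ _ _) hm (by positivity)
        _ = _ := by
            rw [Real.mul_rpow (by positivity) (by positivity), one_div,
              Real.pow_rpow_inv_natCast (by norm_num) (by omega)]
    · have : cell (range H) u n J = ∅ := by
        refine Finset.eq_empty_of_forall_notMem fun t ht => h ?_
        rw [← hsub t ht]
        simpa using (Finset.mem_filter.1 ht).1
      rw [this, moment_rpow_empty hk]
  have hcount : (Finset.univ.filter fun J : ZMod (p ^ n) => J.val < H).card ≤ H := by
    refine (Finset.card_le_card_of_injOn (t := range H) ZMod.val ?_ ?_).trans (by simp)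
    · intro J hJ; simpa using hJ
    · intro J _ J' _ h; exact ZMod.val_injective _ h
  have hQ : cellNorm n γ u β (range H) ≤ H * (4 * ((P : ℝ) ^ k) ^ (1 / (critExp k : ℝ))) := by
    refine (Finset.sum_le_sum fun J _ => hcell J).trans ?_
    rw [← Finset.sum_filter, Finset.sum_const, nsmul_eq_mul]
    gcongr
  have hQ0 := cellNorm_nonneg n γ u β (range H)
  simp only [moment, hexp] at key
  refine key.trans ?_
  calc _ ≤ K * (H * (4 * ((P : ℝ) ^ k) ^ (1 / (critExp k : ℝ)))) ^ critExp k := by gcongr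
    _ = _ := by
      rw [mul_pow, mul_pow, one_div, Real.rpow_inv_natCast_pow (by positivity) (by omega)]
      ring

/-- Mean value estimate on a finite grid, at the critical exponent. -/
theorem exists_grid_mean_value (k : ℕ) (hk : 1 ≤ k) {ε : ℝ} (hε : 0 < ε) :
    ∃ C > (0 : ℝ), ∀ H : ℕ, 1 ≤ H → ∃ (P : ℕ) (_ : NeZero P), 8 * k * H ^ (k + 1) ≤ P ∧
      ∀ β : ℕ → ℂ, (∀ y, ‖β y‖ ≤ 2) →
        ∑ x : Fin k → ZMod P, ‖∑ y ∈ Finset.range H, β y *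
          ZMod.stdAddChar (∑ j, x j * (y : ZMod P) ^ (j.val + 1))‖ ^ (2 * critExp k) ≤
        C * (H : ℝ) ^ (critExp k + ε) * (P : ℝ) ^ k := by
  obtain ⟨p₀, hp₀⟩ := exists_hasExp k hk (ε / 2) (by positivity)
  obtain ⟨p, hpp, hp⟩ := Nat.exists_infinite_primes p₀
  have : Fact p.Prime := ⟨hp⟩
  obtain ⟨C, hC, hD⟩ := hp₀ p hpp
  have hp0 : (0 : ℝ) < p := by exact_mod_cast hp.pos
  refine ⟨C * (p * (8 * k)) ^ (ε / 2) * 4 ^ critExp k, by positivity, fun H hH => ?_⟩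
  set n := Nat.clog p (8 * k * H ^ 2) with hn
  have hle : 8 * k * H ^ 2 ≤ p ^ n := Nat.le_pow_clog hp.one_lt _
  have h8 : 1 < 8 * k * H ^ 2 := by nlinarith [Nat.pow_pos (n := 2) (show 0 < H by omega)]
  have hlt : p ^ n ≤ p * (8 * k * H ^ 2) := by
    have h1 := Nat.pow_pred_clog_lt_self hp.one_lt h8
    have h2 : 0 < n := Nat.clog_pos hp.one_lt h8
    rw [← hn] at h1
    calc p ^ n = p * p ^ n.pred := by rw [← pow_succ', ← Nat.succ_eq_add_one, Nat.succ_pred h2.ne']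
      _ ≤ _ := by gcongr
  refine ⟨p ^ (k * n), inferInstance, ?_, fun β hβ => ?_⟩
  · calc 8 * k * H ^ (k + 1) ≤ (8 * k) ^ k * (H ^ 2) ^ k := by
          rw [← pow_mul]
          gcongr
          · exact Nat.le_self_pow (by omega) _
          · omega
      _ = (8 * k * H ^ 2) ^ k := (mul_pow _ _ _).symm
      _ ≤ (p ^ n) ^ k := by gcongr
      _ = p ^ (k * n) := by rw [← pow_mul, mul_comm]
  · have hHn : H ≤ p ^ n := by nlinarith
    refine ((hD n).sum_le hk (by positivity) hHn hβ).trans ?_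
    have h1 : (p : ℝ) ^ (ε / 2 * n) ≤ (p * (8 * k)) ^ (ε / 2) * (H : ℝ) ^ ε := by
      have h2 : ((p ^ n : ℕ) : ℝ) ≤ p * (8 * k) * H ^ 2 := by
        calc ((p ^ n : ℕ) : ℝ) ≤ ((p * (8 * k * H ^ 2) : ℕ) : ℝ) := by exact_mod_cast hlt
          _ = _ := by push_cast; ring
      calc (p : ℝ) ^ (ε / 2 * n) = ((p ^ n : ℕ) : ℝ) ^ (ε / 2) := by
            rw [Nat.cast_pow, ← Real.rpow_natCast, ← Real.rpow_mul hp0.le, mul_comm]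
        _ ≤ (p * (8 * k) * (H : ℝ) ^ 2) ^ (ε / 2) :=
            Real.rpow_le_rpow (by positivity) h2 (by positivity)
        _ = _ := by
            rw [Real.mul_rpow (by positivity) (by positivity), ← Real.rpow_natCast (H : ℝ) 2,
              ← Real.rpow_mul (by positivity)]
            congr 2; push_cast; ring
    have hH0 : (0 : ℝ) < H := by exact_mod_cast hH
    calc _ ≤ C * ((p * (8 * k)) ^ (ε / 2) * (H : ℝ) ^ ε) * 4 ^ critExp k * (H : ℝ) ^ critExp k *
          ((p ^ (k * n) : ℕ) : ℝ) ^ k := by gcongr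
      _ = _ := by
          rw [Real.rpow_add hH0, Real.rpow_natCast]; ring

/-- The additive character `t ↦ exp (2 π i t)`. -/
def expi (t : ℝ) : ℂ := Complex.exp ((2 * Real.pi * t : ℝ) * Complex.I)

theorem expi_add (s t : ℝ) : expi (s + t) = expi s * expi t := by
  rw [expi, expi, expi, ← Complex.exp_add]; push_cast; ring_nf

@[simp] theorem norm_expi (t : ℝ) : ‖expi t‖ = 1 := by
  rw [expi, Complex.norm_exp_ofReal_mul_I]

@[simp] theorem expi_zero : expi 0 = 1 := by simp [expi]

@[simp] theorem expi_intCast (n : ℤ) : expi n = 1 := by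
  rw [expi, Complex.exp_eq_one_iff]
  exact ⟨n, by push_cast; ring⟩

theorem norm_expi_sub_le (s t : ℝ) : ‖expi s - expi t‖ ≤ 2 * Real.pi * |s - t| := by
  have h : expi s - expi t = expi t * (expi (s - t) - 1) := by
    rw [mul_sub, ← expi_add]; simp
  rw [h, norm_mul, norm_expi, one_mul, expi, mul_comm _ Complex.I]
  refine (Real.norm_exp_I_mul_ofReal_sub_one_le (x := 2 * Real.pi * (s - t))).trans ?_
  rw [Real.norm_eq_abs, abs_mul, abs_of_pos (by positivity : (0 : ℝ) < 2 * Real.pi)]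

theorem stdAddChar_intCast_eq_expi (P : ℕ) [NeZero P] (z : ℤ) :
    ZMod.stdAddChar (z : ZMod P) = expi (z / P) := by
  rw [ZMod.stdAddChar_coe, expi]
  congr 1; push_cast; ring

theorem half_le_re_expi {t : ℝ} (h : |t| ≤ 1 / 8) : 1 / 2 ≤ (expi t).re := by
  rw [expi, Complex.exp_ofReal_mul_I_re, ← Real.cos_abs]
  have : |2 * Real.pi * t| ≤ Real.pi / 3 := by
    rw [abs_mul, abs_of_pos (by positivity : (0 : ℝ) < 2 * Real.pi)]
    nlinarith [Real.pi_pos]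
  rw [← Real.cos_pi_div_three]
  exact Real.cos_le_cos_of_nonneg_of_le_pi (abs_nonneg _) (by linarith [Real.pi_pos]) this

/-- Polynomial exponential sum at a grid point. -/
def gridSum {k : ℕ} (P : ℕ) [NeZero P] (H : ℕ) (β : ℕ → ℂ) (x : Fin k → ZMod P) : ℂ :=
  ∑ y ∈ Finset.range H, β y * ZMod.stdAddChar (∑ j, x j * (y : ZMod P) ^ (j.val + 1))

/-- The shift by an integer vector. -/
def gridShift {k P : ℕ} (x : Fin k → ZMod P) (r : Fin k → ℕ) : Fin k → ZMod P :=
  fun j => x j + r j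

theorem exists_smooth_coeff {k : ℕ} (P : ℕ) [NeZero P] (H : ℕ) (U : Fin k → ℕ)
    (hU : ∀ j, 8 * k * H ^ (j.val + 1) * U j ≤ P) (hU0 : ∀ j, 1 ≤ U j) (β : ℕ → ℂ)
    (hβ : ∀ y, ‖β y‖ ≤ 1) :
    ∃ β' : ℕ → ℂ, (∀ y, ‖β' y‖ ≤ 2) ∧ ∀ x : Fin k → ZMod P,
      ((∏ j, U j : ℕ) : ℂ) * gridSum P H β x =
        ∑ r ∈ Fintype.piFinset (fun j => range (U j)), gridSum P H β' (gridShift x r) := by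
  set box := Fintype.piFinset (fun j => range (U j)) with hbox
  have hcard : box.card = ∏ j, U j := by simp [hbox]
  have hP : (0 : ℝ) < P := by exact_mod_cast Nat.pos_of_ne_zero (NeZero.ne P)
  set D : ℕ → ℂ := fun y => ∑ r ∈ box,
    ZMod.stdAddChar (∑ j, (r j : ZMod P) * (y : ZMod P) ^ (j.val + 1)) with hD
  have hDle : ∀ y < H, ((∏ j, U j : ℕ) : ℝ) / 2 ≤ ‖D y‖ := by
    intro y hy
    refine le_trans ?_ (Complex.re_le_norm _)
    rw [hD, Complex.re_sum, ← hcard, div_eq_mul_one_div, ← nsmul_eq_mul]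
    refine Finset.card_nsmul_le_sum _ _ _ fun r hr => ?_
    have h1 : (∑ j, (r j : ZMod P) * (y : ZMod P) ^ (j.val + 1)) =
        ((∑ j, (r j : ℤ) * (y : ℤ) ^ (j.val + 1) : ℤ) : ZMod P) := by push_cast; rfl
    rw [h1, stdAddChar_intCast_eq_expi]
    refine half_le_re_expi ?_
    rcases Nat.eq_zero_or_pos k with hk | hk
    · subst hk; simp
    have hkk : (0 : ℝ) < k := by exact_mod_cast hk
    rw [abs_of_nonneg (by positivity), div_le_iff₀ hP]
    push_cast
    have h2 : ∀ j : Fin k, (r j : ℝ) * (y : ℝ) ^ (j.val + 1) ≤ P / (8 * k) := by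
      intro j
      have hrj : r j < U j := by simpa using Fintype.mem_piFinset.1 hr j
      rw [le_div_iff₀ (by positivity)]
      have h3 : r j * y ^ (j.val + 1) * (8 * k) ≤ P := by
        calc r j * y ^ (j.val + 1) * (8 * k) ≤ U j * H ^ (j.val + 1) * (8 * k) := by gcongr
          _ = 8 * k * H ^ (j.val + 1) * U j := by ring
          _ ≤ P := hU j
      exact_mod_cast h3
    calc _ ≤ ∑ j : Fin k, (P : ℝ) / (8 * k) := Finset.sum_le_sum fun j _ => h2 j
      _ = 1 / 8 * P := by
        simp only [Finset.sum_const, Finset.card_univ, Fintype.card_fin, nsmul_eq_mul]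
        field_simp
  have hUpos : (0 : ℝ) < ((∏ j, U j : ℕ) : ℝ) := by
    exact_mod_cast Finset.prod_pos fun j _ => hU0 j
  refine ⟨fun y => if y < H then β y * ((∏ j, U j : ℕ) : ℂ) / D y else 0, ?_, ?_⟩
  · intro y
    beta_reduce
    split_ifs with hy
    · have hd := hDle y hy
      have : 0 < ‖D y‖ := by linarith
      rw [norm_div, norm_mul, div_le_iff₀ this, Complex.norm_natCast]
      have := hβ y
      nlinarith
    · simp
  · intro x
    simp only [gridSum, gridShift]
    rw [Finset.sum_comm, Finset.mul_sum]
    refine Finset.sum_congr rfl fun y hy => ?_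
    have hy : y < H := by simpa using hy
    have hd := hDle y hy
    have hd0 : D y ≠ 0 := by
      intro h; rw [h, norm_zero] at hd; linarith
    simp only [hy, if_true]
    rw [← Finset.mul_sum]
    have : ∑ r ∈ box, (ZMod.stdAddChar (∑ j, (x j + (r j : ZMod P)) * (y : ZMod P) ^ (j.val + 1)) : ℂ)
        = ZMod.stdAddChar (∑ j, x j * (y : ZMod P) ^ (j.val + 1)) * D y := by
      rw [hD, Finset.mul_sum]
      refine Finset.sum_congr rfl fun r _ => ?_
      rw [← AddChar.map_add_eq_mul, ← Finset.sum_add_distrib]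
      simp only [add_mul]
    rw [this]
    field_simp

theorem card_mul_norm_pow_le {ι : Type*} (s : Finset ι) (z : ι → ℂ) {m : ℕ} (hm : 1 ≤ m) (w : ℂ)
    (h : (s.card : ℂ) * w = ∑ i ∈ s, z i) : s.card * ‖w‖ ^ m ≤ ∑ i ∈ s, ‖z i‖ ^ m := by
  rcases s.eq_empty_or_nonempty with rfl | hs
  · simp
  have hc : (0 : ℝ) < s.card := by exact_mod_cast hs.card_pos
  obtain ⟨n, rfl⟩ : ∃ n, m = n + 1 := ⟨m - 1, by omega⟩
  have h1 : s.card * ‖w‖ ≤ ∑ i ∈ s, ‖z i‖ := by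
    calc s.card * ‖w‖ = ‖(s.card : ℂ) * w‖ := by rw [norm_mul, Complex.norm_natCast]
      _ ≤ _ := by rw [h]; exact norm_sum_le _ _
  refine le_trans ?_ (pow_sum_div_card_le_sum_pow (s := s) (f := fun i => ‖z i‖)
    (fun i _ => norm_nonneg _) n)
  rw [le_div_iff₀ (by positivity)]
  calc _ = (s.card * ‖w‖) ^ (n + 1) := by ring
    _ ≤ _ := by gcongr

theorem gridShift_injOn {k P : ℕ} [NeZero P] (x : Fin k → ZMod P) (U : Fin k → ℕ)
    (hU : ∀ j, U j ≤ P) {r r' : Fin k → ℕ} (hr : r ∈ Fintype.piFinset (fun j => range (U j)))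
    (hr' : r' ∈ Fintype.piFinset (fun j => range (U j))) (h : gridShift x r = gridShift x r') :
    r = r' := by
  funext j
  have h1 := congrFun h j
  simp only [gridShift, add_right_inj] at h1
  have h2 : r j < U j := by simpa using Fintype.mem_piFinset.1 hr j
  have h3 : r' j < U j := by simpa using Fintype.mem_piFinset.1 hr' j
  have := hU j
  rw [ZMod.natCast_eq_natCast_iff'] at h1
  rwa [Nat.mod_eq_of_lt (by omega), Nat.mod_eq_of_lt (by omega)] at h1

theorem sum_gridSum_le {k m : ℕ} (hm : 1 ≤ m) (P : ℕ) [NeZero P] (H : ℕ) (U : Fin k → ℕ)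
    (hUP : ∀ j, U j ≤ P)
    (hU : ∀ j, 8 * k * H ^ (j.val + 1) * U j ≤ P) (hU0 : ∀ j, 1 ≤ U j) {M : ℝ}
    (hM : ∀ β : ℕ → ℂ, (∀ y, ‖β y‖ ≤ 2) → ∑ x : Fin k → ZMod P, ‖gridSum P H β x‖ ^ m ≤ M)
    (A : Finset ℕ) (x : ℕ → Fin k → ZMod P) (R : ℕ)
    (hR : ∀ i ∈ A, (A.filter fun i' => ∃ r ∈ Fintype.piFinset (fun j => range (U j)),
      ∃ r' ∈ Fintype.piFinset (fun j => range (U j)),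
        gridShift (x i) r = gridShift (x i') r').card ≤ R)
    (β : ℕ → ℂ) (hβ : ∀ y, ‖β y‖ ≤ 1) :
    ((∏ j, U j : ℕ) : ℝ) * ∑ i ∈ A, ‖gridSum P H β (x i)‖ ^ m ≤ R * M := by
  classical
  obtain ⟨β', hβ', hs⟩ := exists_smooth_coeff P H U hU hU0 β hβ
  set box := Fintype.piFinset (fun j => range (U j)) with hbox
  have hcard : box.card = ∏ j, U j := by simp [hbox]
  rw [Finset.mul_sum]
  calc _ ≤ ∑ i ∈ A, ∑ r ∈ box, ‖gridSum P H β' (gridShift (x i) r)‖ ^ m := by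
        refine Finset.sum_le_sum fun i _ => ?_
        have := card_mul_norm_pow_le box (fun r => gridSum P H β' (gridShift (x i) r)) hm
          (gridSum P H β (x i)) (by rw [hcard]; exact hs _)
        rwa [hcard] at this
    _ = ∑ i ∈ A, ∑ y ∈ box.image (gridShift (x i)), ‖gridSum P H β' y‖ ^ m := by
        refine Finset.sum_congr rfl fun i _ => ?_
        rw [Finset.sum_image]
        intro r hr r' hr' h
        exact gridShift_injOn (x i) U hUP hr hr' h
    _ = ∑ y : Fin k → ZMod P, ∑ i ∈ A.filter (fun i => y ∈ box.image (gridShift (x i))),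
          ‖gridSum P H β' y‖ ^ m := by
        simp only [Finset.sum_filter]
        rw [Finset.sum_comm]
        refine Finset.sum_congr rfl fun i _ => ?_
        rw [← Finset.sum_filter]
        congr 1
        ext y; simp
    _ ≤ ∑ y : Fin k → ZMod P, R * ‖gridSum P H β' y‖ ^ m := by
        refine Finset.sum_le_sum fun y _ => ?_
        rw [Finset.sum_const, nsmul_eq_mul]
        gcongr
        rcases (A.filter (fun i => y ∈ box.image (gridShift (x i)))).eq_empty_or_nonempty with
          h | ⟨i, hi⟩
        · rw [h]; simp
        obtain ⟨hiA, hiy⟩ := Finset.mem_filter.1 hi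
        obtain ⟨r, hr, hry⟩ := Finset.mem_image.1 hiy
        refine (Finset.card_le_card ?_).trans (hR i hiA)
        intro i' hi'
        obtain ⟨hiA', hiy'⟩ := Finset.mem_filter.1 hi'
        obtain ⟨r', hr', hry'⟩ := Finset.mem_image.1 hiy'
        exact Finset.mem_filter.2 ⟨hiA', r, hr, r', hr', hry.trans hry'.symm⟩
    _ = R * ∑ y : Fin k → ZMod P, ‖gridSum P H β' y‖ ^ m := by rw [Finset.mul_sum]
    _ ≤ R * M := by gcongr; exact hM β' hβ'

/-- Rounding a frequency to the grid. -/
theorem norm_sub_gridSum_le {k : ℕ} (P : ℕ) [NeZero P] (H : ℕ) (γ : Fin k → ℝ) (β : ℕ → ℂ)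
    (hβ : ∀ y, ‖β y‖ ≤ 1) (hk : 1 ≤ k) (hP : 8 * k * H ^ (k + 1) ≤ P) :
    ‖∑ y ∈ range H, β y * expi (∑ j, γ j * (y : ℝ) ^ (j.val + 1))‖ ≤
      ‖gridSum P H β (fun j => ((⌊P * γ j⌋ : ℤ) : ZMod P))‖ + 1 := by
  have hPpos : (0 : ℝ) < P := by exact_mod_cast Nat.pos_of_ne_zero (NeZero.ne P)
  have h : ‖∑ y ∈ range H, β y * expi (∑ j, γ j * (y : ℝ) ^ (j.val + 1)) -
      gridSum P H β (fun j => ((⌊P * γ j⌋ : ℤ) : ZMod P))‖ ≤ 1 := by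
    rw [gridSum, ← Finset.sum_sub_distrib]
    have hterm : ∀ y ∈ range H, ‖β y * expi (∑ j, γ j * (y : ℝ) ^ (j.val + 1)) -
        β y * ZMod.stdAddChar (∑ j, ((⌊P * γ j⌋ : ℤ) : ZMod P) * (y : ZMod P) ^ (j.val + 1))‖ ≤
        2 * Real.pi * (k * (H : ℝ) ^ k / P) := by
      intro y hy
      have hy : y < H := by simpa using hy
      rw [← mul_sub, norm_mul]
      have h1 : (∑ j, ((⌊P * γ j⌋ : ℤ) : ZMod P) * (y : ZMod P) ^ (j.val + 1)) =
        ((∑ j, ⌊P * γ j⌋ * (y : ℤ) ^ (j.val + 1) : ℤ) : ZMod P) := by push_cast; rfl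
      rw [h1, stdAddChar_intCast_eq_expi]
      have h2 := norm_expi_sub_le (∑ j, γ j * (y : ℝ) ^ (j.val + 1))
        (((∑ j, ⌊P * γ j⌋ * (y : ℤ) ^ (j.val + 1) : ℤ) : ℝ) / P)
      have h3 : |∑ j, γ j * (y : ℝ) ^ (j.val + 1) -
          ((∑ j, ⌊P * γ j⌋ * (y : ℤ) ^ (j.val + 1) : ℤ) : ℝ) / P| ≤ k * (H : ℝ) ^ k / P := by
        push_cast
        rw [Finset.sum_div, ← Finset.sum_sub_distrib]
        refine (Finset.abs_sum_le_sum_abs _ _).trans ?_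
        have h4 : ∀ j : Fin k, |γ j * (y : ℝ) ^ (j.val + 1) -
            (⌊P * γ j⌋ : ℝ) * (y : ℝ) ^ (j.val + 1) / P| ≤ (H : ℝ) ^ k / P := by
          intro j
          have e : γ j * (y : ℝ) ^ (j.val + 1) - (⌊P * γ j⌋ : ℝ) * (y : ℝ) ^ (j.val + 1) / P =
            (Int.fract (P * γ j)) * (y : ℝ) ^ (j.val + 1) / P := by
            rw [Int.fract]; field_simp
          rw [e, abs_of_nonneg (by have := Int.fract_nonneg (P * γ j); positivity)]
          gcongr
          have f1 := Int.fract_nonneg (P * γ j)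
          have f2 := (Int.fract_lt_one (P * γ j)).le
          have hH1 : (1 : ℝ) ≤ H := by exact_mod_cast (by omega : 1 ≤ H)
          calc _ ≤ 1 * (H : ℝ) ^ (j.val + 1) := by gcongr
            _ ≤ (H : ℝ) ^ k := by
              rw [one_mul]; exact pow_le_pow_right₀ hH1 (by omega)
        refine (Finset.sum_le_sum fun j _ => h4 j).trans ?_
        simp only [Finset.sum_const, Finset.card_univ, Fintype.card_fin, nsmul_eq_mul]
        exact (mul_div_assoc _ _ _).symm.le
      calc _ ≤ 1 * (2 * Real.pi * (k * (H : ℝ) ^ k / P)) := by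
            gcongr
            · exact hβ y
            · exact h2.trans (by gcongr)
        _ = _ := one_mul _
    refine (norm_sum_le _ _).trans ((Finset.sum_le_sum hterm).trans ?_)
    simp only [Finset.sum_const, card_range, nsmul_eq_mul]
    have hP' : (8 * k * (H : ℝ) ^ (k + 1)) ≤ P := by exact_mod_cast hP
    have : (H : ℝ) * (2 * Real.pi * (k * (H : ℝ) ^ k / P)) =
      2 * Real.pi * k * (H : ℝ) ^ (k + 1) / P := by ring
    rw [this, div_le_one hPpos]
    have h0 : 0 ≤ k * (H : ℝ) ^ (k + 1) := by positivity
    nlinarith [Real.pi_le_four]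
  have := norm_sub_norm_le (∑ y ∈ range H, β y * expi (∑ j, γ j * (y : ℝ) ^ (j.val + 1)))
    (gridSum P H β (fun j => ((⌊P * γ j⌋ : ℤ) : ZMod P)))
  linarith

theorem prod_pow_succ_fin (k : ℕ) (x : ℝ) :
    ∏ j : Fin k, x ^ (j.val + 1) = x ^ critExp k := by
  rw [Finset.prod_pow_eq_pow_sum]
  congr 1
  have h1 : ∑ j : Fin k, (j.val + 1) = ∑ j ∈ range k, (j + 1) :=
    Fin.sum_univ_eq_sum_range (fun j => j + 1) k
  have h2 := Finset.sum_range_id_mul_two (k + 1)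
  rw [Finset.sum_range_succ' (fun i => i), add_zero] at h2
  have h3 := two_mul_critExp k
  rw [h1]
  simp only [Nat.add_sub_cancel] at h2
  nlinarith

theorem abs_sub_lt_of_gridShift_eq {k : ℕ} (P : ℕ) [NeZero P] (γ γ' : Fin k → ℝ) (U : Fin k → ℕ)
    {r r' : Fin k → ℕ} (hr : r ∈ Fintype.piFinset (fun j => range (U j)))
    (hr' : r' ∈ Fintype.piFinset (fun j => range (U j)))
    (h : gridShift (fun j => ((⌊P * γ j⌋ : ℤ) : ZMod P)) r =
      gridShift (fun j => ((⌊P * γ' j⌋ : ℤ) : ZMod P)) r') (j : Fin k) :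
    ∃ z : ℤ, |γ j - γ' j - z| < (U j : ℝ) / P := by
  have hPpos : (0 : ℝ) < P := by exact_mod_cast Nat.pos_of_ne_zero (NeZero.ne P)
  have h1 := congrFun h j
  simp only [gridShift] at h1
  have h2 : ((⌊P * γ j⌋ + r j : ℤ) : ZMod P) = ((⌊P * γ' j⌋ + r' j : ℤ) : ZMod P) := by
    push_cast; exact h1
  rw [ZMod.intCast_eq_intCast_iff_dvd_sub] at h2
  obtain ⟨z, hz⟩ := h2
  have h3 : r j < U j := by simpa using Fintype.mem_piFinset.1 hr j
  have h4 : r' j < U j := by simpa using Fintype.mem_piFinset.1 hr' j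
  have hz' : ((⌊P * γ' j⌋ : ℝ) + r' j) - (⌊P * γ j⌋ + r j) = P * z := by exact_mod_cast hz
  refine ⟨-z, ?_⟩
  have h3' : (r j : ℝ) + 1 ≤ U j := by exact_mod_cast h3
  have h4' : (r' j : ℝ) + 1 ≤ U j := by exact_mod_cast h4
  have a1 := Int.floor_le (P * γ j)
  have a2 := Int.lt_floor_add_one (P * γ j)
  have b1 := Int.floor_le (P * γ' j)
  have b2 := Int.lt_floor_add_one (P * γ' j)
  have c1 : (0 : ℝ) ≤ r j := Nat.cast_nonneg _
  have c2 : (0 : ℝ) ≤ r' j := Nat.cast_nonneg _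
  rw [abs_lt, lt_div_iff₀ hPpos, ← neg_div, div_lt_iff₀ hPpos]
  push_cast
  constructor <;> nlinarith

/-- Mean value estimate over spaced frequencies. -/
theorem exists_spaced_mean_value (k : ℕ) (hk : 1 ≤ k) {ε : ℝ} (hε : 0 < ε) :
    ∃ C > (0 : ℝ), ∀ H : ℕ, 1 ≤ H → ∀ (A : Finset ℕ) (γ : ℕ → Fin k → ℝ) (R : ℕ),
      (∀ i ∈ A, ∀ B ⊆ A, (∀ i' ∈ B, ∀ j, ∃ z : ℤ,
        |γ i j - γ i' j - z| < 1 / (H : ℝ) ^ (j.val + 1)) → B.card ≤ R) →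
      ∀ β : ℕ → ℂ, (∀ y, ‖β y‖ ≤ 1) →
        ∑ i ∈ A, ‖∑ y ∈ range H, β y * expi (∑ j, γ i j * (y : ℝ) ^ (j.val + 1))‖ ^
          (2 * critExp k) ≤ C * R * (H : ℝ) ^ (2 * critExp k + ε) := by
  obtain ⟨C, hC, hgrid⟩ := exists_grid_mean_value k hk hε
  have hs := critExp_pos hk
  have hkr : (0 : ℝ) < k := by exact_mod_cast hk
  refine ⟨2 ^ (2 * critExp k) * (2 * (C * (16 * k) ^ k)), by positivity,
    fun H hH A γ R hR β hβ => ?_⟩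
  obtain ⟨P, hPne, hP, hM⟩ := hgrid H hH
  have hPpos : (0 : ℝ) < P := by exact_mod_cast Nat.pos_of_ne_zero (NeZero.ne P)
  have hH0 : (0 : ℝ) < H := by exact_mod_cast hH
  set U : Fin k → ℕ := fun j => P / (8 * k * H ^ (j.val + 1)) with hUdef
  have hden : ∀ j : Fin k, 0 < 8 * k * H ^ (j.val + 1) := fun j => by positivity
  have hUle : ∀ j, 8 * k * H ^ (j.val + 1) * U j ≤ P := fun j => Nat.mul_div_le _ _
  have hU1 : ∀ j, 1 ≤ U j := by
    intro j
    rw [hUdef]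
    refine (Nat.one_le_div_iff (hden j)).2 (le_trans ?_ hP)
    gcongr
    omega
  have hUP : ∀ j, U j ≤ P := fun j => Nat.div_le_self _ _
  have hUge : ∀ j, (P : ℝ) / (16 * k * (H : ℝ) ^ (j.val + 1)) ≤ U j := by
    intro j
    rw [div_le_iff₀ (by positivity)]
    have h1 : P < 8 * k * H ^ (j.val + 1) * (U j + 1) := Nat.lt_mul_div_succ P (hden j)
    have h2 : (P : ℝ) ≤ 8 * k * (H : ℝ) ^ (j.val + 1) * (U j + 1) := by exact_mod_cast h1.le
    have h3 : (1 : ℝ) ≤ U j := by exact_mod_cast hU1 j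
    calc (P : ℝ) ≤ 8 * k * (H : ℝ) ^ (j.val + 1) * (U j + 1) := h2
      _ ≤ 8 * k * (H : ℝ) ^ (j.val + 1) * (2 * U j) := by gcongr; linarith
      _ = _ := by ring
  have hprod : (P : ℝ) ^ k / ((16 * k) ^ k * (H : ℝ) ^ critExp k) ≤ ((∏ j, U j : ℕ) : ℝ) := by
    push_cast
    calc (P : ℝ) ^ k / ((16 * k) ^ k * (H : ℝ) ^ critExp k) =
        ∏ j : Fin k, (P : ℝ) / (16 * k * (H : ℝ) ^ (j.val + 1)) := by
          rw [Finset.prod_div_distrib, Finset.prod_mul_distrib, prod_pow_succ_fin]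
          simp
      _ ≤ _ := Finset.prod_le_prod (fun j _ => by positivity) fun j _ => hUge j
  set x : ℕ → Fin k → ZMod P := fun i j => ((⌊P * γ i j⌋ : ℤ) : ZMod P) with hx
  have hover : ∀ i ∈ A, (A.filter fun i' => ∃ r ∈ Fintype.piFinset (fun j => range (U j)),
      ∃ r' ∈ Fintype.piFinset (fun j => range (U j)),
        gridShift (x i) r = gridShift (x i') r').card ≤ R := by
    intro i hi
    refine hR i hi _ (Finset.filter_subset _ _) fun i' hi' j => ?_
    obtain ⟨hiA', r, hr, r', hr', h⟩ := Finset.mem_filter.1 hi'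
    obtain ⟨z, hz⟩ := abs_sub_lt_of_gridShift_eq P (γ i) (γ i') U hr hr' h j
    refine ⟨z, hz.trans_le ?_⟩
    rw [div_le_div_iff₀ hPpos (by positivity), one_mul]
    have h1 : H ^ (j.val + 1) * U j ≤ P := by
      refine le_trans ?_ (hUle j)
      gcongr
      exact Nat.le_mul_of_pos_left _ (by positivity)
    rw [mul_comm]
    exact_mod_cast h1
  have hmain : ∀ β : ℕ → ℂ, (∀ y, ‖β y‖ ≤ 1) → ∑ i ∈ A, ‖gridSum P H β (x i)‖ ^ (2 * critExp k) ≤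
      C * (16 * k) ^ k * R * (H : ℝ) ^ (2 * critExp k + ε) := by
    intro β hβ
    have h1 := sum_gridSum_le (m := 2 * critExp k) (by omega) P H U hUP hUle hU1 hM A x R hover β hβ
    set W := ∑ i ∈ A, ‖gridSum P H β (x i)‖ ^ (2 * critExp k) with hW
    have hW0 : 0 ≤ W := Finset.sum_nonneg fun _ _ => by positivity
    have h2 : (P : ℝ) ^ k / ((16 * k) ^ k * (H : ℝ) ^ critExp k) * W ≤
        R * (C * (H : ℝ) ^ (critExp k + ε) * (P : ℝ) ^ k) :=
      le_trans (by gcongr) h1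
    have h3 : (P : ℝ) ^ k / ((16 * k) ^ k * (H : ℝ) ^ critExp k) * W =
      (P : ℝ) ^ k * (W / ((16 * k) ^ k * (H : ℝ) ^ critExp k)) := by ring
    rw [h3, show R * (C * (H : ℝ) ^ (critExp k + ε) * (P : ℝ) ^ k) =
      (P : ℝ) ^ k * (R * (C * (H : ℝ) ^ (critExp k + ε))) by ring,
      mul_le_mul_iff_right₀ (by positivity), div_le_iff₀ (by positivity)] at h2
    refine h2.trans_eq ?_
    rw [show (2 * critExp k + ε : ℝ) = (critExp k + ε) + critExp k by ring,
      Real.rpow_add hH0 _ (critExp k : ℝ), Real.rpow_natCast]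
    ring
  have hone : (A.card : ℝ) ≤ C * (16 * k) ^ k * R * (H : ℝ) ^ (2 * critExp k + ε) := by
    have h1 := hmain (fun y => if y = 0 then 1 else 0) (fun y => by split_ifs <;> simp)
    have h2 : ∀ i, gridSum P H (fun y => if y = 0 then 1 else 0) (x i) = 1 := by
      intro i
      rw [gridSum, Finset.sum_eq_single 0]
      · simp
      · intro b _ hb; simp [hb]
      · intro h; exact absurd (mem_range.2 hH) h
    simpa [h2] using h1
  calc _ ≤ ∑ i ∈ A, (2 : ℝ) ^ (2 * critExp k) * (‖gridSum P H β (x i)‖ ^ (2 * critExp k) + 1) := by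
        refine Finset.sum_le_sum fun i _ => ?_
        have h1 := norm_sub_gridSum_le P H (γ i) β hβ hk hP
        set g := ‖gridSum P H β (x i)‖ with hg
        have hg0 : 0 ≤ g := norm_nonneg _
        have h2 : g + 1 ≤ 2 * max g 1 := by
          have := le_max_left g 1; have := le_max_right g 1; linarith
        calc _ ≤ (2 * max g 1) ^ (2 * critExp k) := by
              gcongr
              exact h1.trans h2
          _ = 2 ^ (2 * critExp k) * (max g 1) ^ (2 * critExp k) := mul_pow _ _ _
          _ ≤ _ := by
              gcongr
              rcases max_cases g 1 with ⟨h, -⟩ | ⟨h, -⟩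
              · rw [h]; linarith
              · rw [h, one_pow]; have : 0 ≤ g ^ (2 * critExp k) := by positivity
                linarith
    _ = 2 ^ (2 * critExp k) * (∑ i ∈ A, ‖gridSum P H β (x i)‖ ^ (2 * critExp k) + A.card) := by
        rw [← Finset.mul_sum, Finset.sum_add_distrib]; simp
    _ ≤ 2 ^ (2 * critExp k) * (C * (16 * k) ^ k * R * (H : ℝ) ^ (2 * critExp k + ε) +
          C * (16 * k) ^ k * R * (H : ℝ) ^ (2 * critExp k + ε)) := by
        gcongr
        exact hmain β hβ
    _ = _ := by ring

/-- The generalized binomial coefficient `θ (θ - 1) ⋯ (θ - j + 1) / j!`. -/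
def binCoef : ℕ → ℝ → ℝ
  | 0, _ => 1
  | j + 1, θ => θ / (j + 1) * binCoef j (θ - 1)

theorem binCoef_ne_zero (j : ℕ) : ∀ {θ : ℝ}, (∀ z : ℤ, (z : ℝ) ≠ θ) → binCoef j θ ≠ 0 := by
  induction j with
  | zero => intro θ _; simp [binCoef]
  | succ j ih =>
    intro θ h
    have h0 : θ ≠ 0 := fun h0 => h 0 (by simp [h0])
    have h1 : binCoef j (θ - 1) ≠ 0 := ih fun z hz => h (z + 1) (by push_cast; linarith)
    have h2 : (j + 1 : ℝ) ≠ 0 := by positivity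
    simp only [binCoef]
    positivity

theorem binomial_taylor (k : ℕ) : ∀ θ : ℝ, ∃ C, 0 ≤ C ∧ ∀ u ∈ Set.Icc (0 : ℝ) 1,
    |(1 + u) ^ θ - ∑ j ∈ range k, binCoef j θ * u ^ j| ≤ C * u ^ k := by
  induction k with
  | zero =>
    intro θ
    refine ⟨2 ^ |θ|, by positivity, fun u hu => ?_⟩
    simp only [range_zero, sum_empty, sub_zero, pow_zero, mul_one]
    have h1 : (1 : ℝ) ≤ 1 + u := by linarith [hu.1]
    rw [abs_of_pos (Real.rpow_pos_of_pos (by linarith) _)]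
    calc (1 + u) ^ θ ≤ (1 + u) ^ |θ| := Real.rpow_le_rpow_of_exponent_le h1 (le_abs_self _)
      _ ≤ 2 ^ |θ| := Real.rpow_le_rpow (by linarith) (by linarith [hu.2]) (abs_nonneg _)
  | succ k ih =>
    intro θ
    obtain ⟨C, hC, h⟩ := ih (θ - 1)
    refine ⟨|θ| * C, by positivity, fun u hu => ?_⟩
    set g : ℝ → ℝ := fun u => (1 + u) ^ θ - ∑ j ∈ range (k + 1), binCoef j θ * u ^ j with hg
    have hd : ∀ v ∈ Set.Icc 0 u, HasDerivWithinAt g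
        (θ * ((1 + v) ^ (θ - 1) - ∑ j ∈ range k, binCoef j (θ - 1) * v ^ j)) (Set.Icc 0 u) v := by
      intro v hv
      have hv1 : (1 + v : ℝ) ≠ 0 := by linarith [hv.1]
      have e1 : HasDerivAt (fun v : ℝ => (1 + v) ^ θ) (θ * (1 + v) ^ (θ - 1)) v := by
        have := ((hasDerivAt_id v).const_add 1).rpow_const (p := θ) (Or.inl hv1)
        simpa using this
      have e2 : HasDerivAt (fun v : ℝ => ∑ j ∈ range (k + 1), binCoef j θ * v ^ j)
          (∑ j ∈ range (k + 1), binCoef j θ * (j * v ^ (j - 1))) v := by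
        refine HasDerivAt.fun_sum fun j _ => ?_
        exact (hasDerivAt_pow j v).const_mul _
      have e3 := (e1.sub e2).hasDerivWithinAt (s := Set.Icc 0 u)
      refine HasDerivWithinAt.congr_deriv e3 ?_
      rw [sum_range_succ', mul_sub, mul_sum]
      simp only [Nat.cast_zero, zero_mul, mul_zero, add_zero, binCoef, Nat.add_sub_cancel]
      congr 1
      refine sum_congr rfl fun j _ => ?_
      have : (j + 1 : ℝ) ≠ 0 := by positivity
      push_cast
      field_simp
    have hb : ∀ v ∈ Set.Icc 0 u,
        ‖θ * ((1 + v) ^ (θ - 1) - ∑ j ∈ range k, binCoef j (θ - 1) * v ^ j)‖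
          ≤ |θ| * (C * u ^ k) := by
      intro v hv
      rw [Real.norm_eq_abs, abs_mul]
      gcongr
      refine (h v ⟨hv.1, hv.2.trans hu.2⟩).trans ?_
      have := hv.1
      have := hv.2
      gcongr
    have key := (convex_Icc 0 u).norm_image_sub_le_of_norm_hasDerivWithin_le hd hb
      (Set.left_mem_Icc.2 hu.1) (Set.right_mem_Icc.2 hu.1)
    have hg0 : g 0 = 0 := by
      simp [hg, sum_range_succ', binCoef]
    rw [hg0, sub_zero, sub_zero, Real.norm_eq_abs, Real.norm_eq_abs, abs_of_nonneg hu.1] at key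
    calc |(1 + u) ^ θ - ∑ j ∈ range (k + 1), binCoef j θ * u ^ j| = |g u| := rfl
      _ ≤ _ := key
      _ = |θ| * C * u ^ (k + 1) := by ring

/-- A real linear combination of real powers. -/
def powSum {d : ℕ} (c e : Fin (d + 1) → ℝ) (x : ℝ) : ℝ := ∑ i, c i * x ^ e i

theorem powSum_mul_taylor {d : ℕ} (c e : Fin (d + 1) → ℝ) (he : StrictMono e) (k : ℕ) :
    ∃ C, 0 < C ∧ ∀ x : ℝ, 1 ≤ x → ∀ u ∈ Set.Icc (0 : ℝ) 1,
      |powSum c e (x * (1 + u)) - ∑ j ∈ range k, powSum (fun i => c i * binCoef j (e i)) e x * u ^ j|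
        ≤ C * x ^ e (Fin.last d) * u ^ k := by
  choose C hC h using fun i => binomial_taylor k (e i)
  refine ⟨∑ i, |c i| * C i + 1, ?_, fun x hx u hu => ?_⟩
  · have : 0 ≤ ∑ i, |c i| * C i := sum_nonneg fun i _ => mul_nonneg (abs_nonneg _) (hC i)
    linarith
  have hu0 := hu.1
  have e1 : powSum c e (x * (1 + u)) -
      ∑ j ∈ range k, powSum (fun i => c i * binCoef j (e i)) e x * u ^ j
      = ∑ i, c i * x ^ e i * ((1 + u) ^ e i - ∑ j ∈ range k, binCoef j (e i) * u ^ j) := by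
    simp only [powSum, sum_mul, mul_sub, sum_sub_distrib, mul_sum]
    congr 1
    · refine sum_congr rfl fun i _ => ?_
      rw [Real.mul_rpow (by linarith) (by linarith)]; ring
    · rw [sum_comm]
      refine sum_congr rfl fun i _ => sum_congr rfl fun j _ => by ring
  rw [e1]
  have hx0 : 0 < x := by linarith
  calc _ ≤ ∑ i, |c i * x ^ e i * ((1 + u) ^ e i - ∑ j ∈ range k, binCoef j (e i) * u ^ j)| :=
        abs_sum_le_sum_abs _ _
    _ ≤ ∑ i, |c i| * C i * (x ^ e (Fin.last d) * u ^ k) := by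
        refine sum_le_sum fun i _ => ?_
        rw [abs_mul, abs_mul, abs_of_pos (Real.rpow_pos_of_pos hx0 _)]
        have h1 : x ^ e i ≤ x ^ e (Fin.last d) :=
          Real.rpow_le_rpow_of_exponent_le hx (he.monotone (Fin.le_last i))
        calc |c i| * x ^ e i * _ ≤ |c i| * x ^ e (Fin.last d) * (C i * u ^ k) := by
              gcongr
              exact h i u hu
          _ = _ := by ring
    _ ≤ (∑ i, |c i| * C i + 1) * (x ^ e (Fin.last d) * u ^ k) := by
        rw [← sum_mul]
        gcongr
        linarith
    _ = _ := by ring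

theorem powSum_spacing {d : ℕ} (c e : Fin (d + 1) → ℝ) (he : StrictMono e)
    (hc : c (Fin.last d) ≠ 0) (he0 : e (Fin.last d) ≠ 0) {M : ℝ} (hM : 1 ≤ M) :
    ∃ c₁ C₁ N₀ : ℝ, 0 < c₁ ∧ 0 < C₁ ∧ 1 ≤ N₀ ∧ ∀ N, N₀ ≤ N → ∀ x ∈ Set.Icc N (M * N),
      ∀ y ∈ Set.Icc N (M * N),
        c₁ * N ^ (e (Fin.last d) - 1) * |x - y| ≤ |powSum c e x - powSum c e y| ∧
        |powSum c e x - powSum c e y| ≤ C₁ * N ^ (e (Fin.last d) - 1) * |x - y| := by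
  set E := e (Fin.last d) with hE
  set q := c (Fin.last d) * E with hq
  have hq0 : 0 < |q| := abs_pos.2 (mul_ne_zero hc he0)
  set g' : ℝ → ℝ := fun x => ∑ i, c i * (e i * x ^ (e i - 1)) with hg'
  have hlim : Tendsto (fun x : ℝ => ∑ i, c i * e i * x ^ (e i - E)) atTop (nhds q) := by
    have : Tendsto (fun x : ℝ => ∑ i, c i * e i * x ^ (e i - E)) atTop
        (nhds (∑ i, if i = Fin.last d then q else 0)) := by
      refine tendsto_finsetSum _ fun i _ => ?_
      split_ifs with hi
      · subst hi
        simp [← hE, ← hq]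
      · have : 0 < E - e i := sub_pos.2 (he (lt_of_le_of_ne (Fin.le_last i) hi))
        have h2 := (tendsto_rpow_neg_atTop this).const_mul (c i * e i)
        simpa using h2
    simpa using this
  clear_value q
  have hev : ∀ᶠ x in atTop, |q| / 2 ≤ |∑ i, c i * e i * x ^ (e i - E)| ∧
      |∑ i, c i * e i * x ^ (e i - E)| ≤ 2 * |q| := by
    have h1 := hlim.abs
    filter_upwards [h1.eventually_const_le (u := |q| / 2) (by linarith),
      h1.eventually_le_const (u := 2 * |q|) (by linarith)] with x h1 h2 using ⟨h1, h2⟩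
  obtain ⟨N₁, hN₁⟩ := eventually_atTop.1 hev
  have hM0 : 0 < M := by linarith
  refine ⟨|q| / 2 * M ^ (-|E - 1|), 2 * |q| * M ^ |E - 1|, max N₁ 1, by positivity, by positivity,
    le_max_right _ _, ?_⟩
  intro N hN
  have hN1 : 1 ≤ N := (le_max_right _ _).trans hN
  have hNp : 0 < N := by linarith
  have hder : ∀ x ∈ Set.Icc N (M * N), |q| / 2 * M ^ (-|E - 1|) * N ^ (E - 1) ≤ |g' x| ∧
      |g' x| ≤ 2 * |q| * M ^ |E - 1| * N ^ (E - 1) := by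
    intro x hx
    have hx0 : 0 < x := by linarith [hx.1]
    obtain ⟨h1, h2⟩ := hN₁ x ((le_max_left _ _).trans (hN.trans hx.1))
    have e1 : g' x = (∑ i, c i * e i * x ^ (e i - E)) * x ^ (E - 1) := by
      rw [hg', sum_mul]
      refine sum_congr rfl fun i _ => ?_
      rw [mul_assoc (c i * e i), ← Real.rpow_add hx0, mul_assoc]
      congr 3; ring
    obtain ⟨r, hr⟩ : ∃ r, x = r * N := ⟨x / N, by field_simp⟩
    have hr1 : 1 ≤ r := by
      by_contra hlt; push Not at hlt; have := hx.1; nlinarith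
    have hr2 : r ≤ M := by
      have := hx.2; rw [hr] at this; exact le_of_mul_le_mul_right this hNp
    have hr0 : 0 < r := by linarith
    have hrle : r ^ (E - 1) ≤ M ^ |E - 1| :=
      (Real.rpow_le_rpow_of_exponent_le hr1 (le_abs_self _)).trans
        (Real.rpow_le_rpow hr0.le hr2 (abs_nonneg _))
    have hrge : M ^ (-|E - 1|) ≤ r ^ (E - 1) := by
      calc M ^ (-|E - 1|) ≤ r ^ (-|E - 1|) :=
            Real.rpow_le_rpow_of_nonpos hr0 hr2 (neg_nonpos.2 (abs_nonneg _))
        _ ≤ _ := Real.rpow_le_rpow_of_exponent_le hr1 (neg_abs_le _)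
    rw [e1, abs_mul, abs_of_pos (Real.rpow_pos_of_pos hx0 _)]
    have hxr : x ^ (E - 1) = r ^ (E - 1) * N ^ (E - 1) := by
      rw [hr, Real.mul_rpow hr0.le hNp.le]
    rw [hxr]
    constructor
    · rw [mul_assoc]
      gcongr
    · rw [mul_assoc]
      gcongr
  have main : ∀ x ∈ Set.Icc N (M * N), ∀ y ∈ Set.Icc N (M * N), x < y →
      ∃ ξ ∈ Set.Icc N (M * N), |powSum c e x - powSum c e y| = |g' ξ| * |x - y| := by
    intro x hx y hy hxy
    have hd : ∀ z ∈ Set.Icc x y, HasDerivAt (powSum c e) (g' z) z := by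
      intro z hz
      have hz0 : z ≠ 0 := by linarith [hz.1, hx.1]
      refine HasDerivAt.fun_sum fun i _ => ?_
      exact (Real.hasDerivAt_rpow_const (Or.inl hz0)).const_mul _
    obtain ⟨ξ, hξ, h⟩ := exists_hasDerivAt_eq_slope (powSum c e) g' hxy
      (fun z hz => (hd z hz).continuousAt.continuousWithinAt)
      (fun z hz => hd z (Set.Ioo_subset_Icc_self hz))
    refine ⟨ξ, ⟨hx.1.trans hξ.1.le, hξ.2.le.trans hy.2⟩, ?_⟩
    rw [h, ← abs_mul, abs_sub_comm]
    have : y - x ≠ 0 := by linarith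
    rw [show x - y = -(y - x) by ring, mul_neg, abs_neg, div_mul_cancel₀ _ this]
  intro x hx y hy
  rcases lt_trichotomy x y with hxy | hxy | hxy
  · obtain ⟨ξ, hξ, h⟩ := main x hx y hy hxy
    rw [h]
    exact ⟨by gcongr; exact (hder ξ hξ).1, by gcongr; exact (hder ξ hξ).2⟩
  · simp [hxy]
  · obtain ⟨ξ, hξ, h⟩ := main y hy x hx hxy
    rw [abs_sub_comm (powSum c e x), h, abs_sub_comm y x]
    exact ⟨by gcongr; exact (hder ξ hξ).1, by gcongr; exact (hder ξ hξ).2⟩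

theorem norm_sum_mul_expi_le_of_close (H : ℕ) (β : ℕ → ℂ) (hβ : ∀ y, ‖β y‖ ≤ 1)
    (φ ψ : ℕ → ℝ) (c δ : ℝ) (h : ∀ y < H, |φ y - (c + ψ y)| ≤ δ) :
    ‖∑ y ∈ range H, β y * expi (φ y)‖ ≤
      ‖∑ y ∈ range H, β y * expi (ψ y)‖ + H * (2 * Real.pi * δ) := by
  have e1 : ∑ y ∈ range H, β y * expi (φ y) = expi c * ∑ y ∈ range H, β y * expi (ψ y) +
      ∑ y ∈ range H, β y * (expi (φ y) - expi (c + ψ y)) := by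
    rw [mul_sum, ← sum_add_distrib]
    refine sum_congr rfl fun y _ => ?_
    rw [expi_add]; ring
  rw [e1]
  refine (norm_add_le _ _).trans (add_le_add ?_ ?_)
  · simp
  · refine (norm_sum_le _ _).trans ?_
    calc _ ≤ ∑ y ∈ range H, 2 * Real.pi * δ := by
          refine sum_le_sum fun y hy => ?_
          rw [norm_mul]
          calc _ ≤ 1 * (2 * Real.pi * |φ y - (c + ψ y)|) := by
                gcongr
                · exact hβ y
                · exact norm_expi_sub_le _ _
            _ ≤ _ := by
                rw [one_mul]
                gcongr
                exact h y (mem_range.1 hy)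
      _ = _ := by simp

theorem exists_block_mean (k : ℕ) (hk : 1 ≤ k) {ε : ℝ} (hε : 0 < ε) : ∃ C > (0 : ℝ),
    ∀ H : ℕ, 1 ≤ H → ∀ (A : Finset ℕ) (γ : ℕ → Fin k → ℝ) (R : ℕ),
    (∀ i ∈ A, ∀ B ⊆ A, (∀ i' ∈ B, ∀ j, ∃ z : ℤ,
      |γ i j - γ i' j - z| < 1 / (H : ℝ) ^ (j.val + 1)) → B.card ≤ R) →
    ∀ β : ℕ → ℂ, (∀ y, ‖β y‖ ≤ 1) → ∀ (φ : ℕ → ℕ → ℝ) (c : ℕ → ℝ) (δ : ℝ),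
    (∀ i ∈ A, ∀ y < H, |φ i y - (c i + ∑ j, γ i j * (y : ℝ) ^ (j.val + 1))| ≤ δ) → 0 ≤ δ →
    ∀ Q : ℝ, 0 < Q → (A.card : ℝ) ≤ Q →
    ∑ i ∈ A, ‖∑ y ∈ range H, β y * expi (φ i y)‖ ≤
      Q * H * ((C * R * (H : ℝ) ^ ε / Q) ^ ((1 : ℝ) / (2 * critExp k : ℕ)) + 2 * Real.pi * δ) := by
  obtain ⟨C, hC, h⟩ := exists_spaced_mean_value k hk hε
  refine ⟨C, hC, fun H hH A γ R hsp β hβ φ c δ hφ hδ Q hQ hA => ?_⟩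
  have key := h H hH A γ R hsp β hβ
  set S := ∑ i ∈ A, ‖∑ y ∈ range H, β y * expi (∑ j, γ i j * (y : ℝ) ^ (j.val + 1))‖ with hS
  have hS0 : 0 ≤ S := sum_nonneg fun _ _ => norm_nonneg _
  have hHp : (0 : ℝ) < H := by exact_mod_cast hH
  have hs : 0 < 2 * critExp k := by have := critExp_pos hk; omega
  have h1 : S ≤ Q * H * (C * R * (H : ℝ) ^ ε / Q) ^ ((1 : ℝ) / (2 * critExp k : ℕ)) := by
    have hX : 0 ≤ C * R * (H : ℝ) ^ ε / Q := by positivity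
    refine le_of_pow_le_pow_left₀ hs.ne' (by positivity) ?_
    rw [mul_pow, one_div, Real.rpow_inv_natCast_pow hX hs.ne']
    obtain ⟨n, hn⟩ : ∃ n, 2 * critExp k = n + 1 := ⟨2 * critExp k - 1, by omega⟩
    rcases A.eq_empty_or_nonempty with hAe | hAe
    · have : S = 0 := by rw [hS, hAe, sum_empty]
      rw [this, zero_pow hs.ne']
      positivity
    have hcard : (0 : ℝ) < A.card := by exact_mod_cast hAe.card_pos
    have h2 := pow_sum_div_card_le_sum_pow (s := A)
      (f := fun i => ‖∑ y ∈ range H, β y * expi (∑ j, γ i j * (y : ℝ) ^ (j.val + 1))‖)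
      (fun _ _ => norm_nonneg _) n
    rw [div_le_iff₀ (by positivity)] at h2
    have e1 : (H : ℝ) ^ (2 * critExp k + ε : ℝ) = (H : ℝ) ^ (2 * critExp k) * (H : ℝ) ^ ε := by
      rw [Real.rpow_add hHp]
      congr 1
      rw [← Real.rpow_natCast]; push_cast; rfl
    rw [e1] at key
    rw [hn] at key ⊢
    calc S ^ (n + 1) ≤ _ * (A.card : ℝ) ^ n := h2
      _ ≤ (C * R * ((H : ℝ) ^ (n + 1) * (H : ℝ) ^ ε)) * Q ^ n := by
          gcongr
      _ = _ := by
          rw [mul_pow, pow_succ Q]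
          field_simp
  calc _ ≤ ∑ i ∈ A, (‖∑ y ∈ range H, β y * expi (∑ j, γ i j * (y : ℝ) ^ (j.val + 1))‖ +
        H * (2 * Real.pi * δ)) :=
        sum_le_sum fun i hi => norm_sum_mul_expi_le_of_close H β hβ _ _ _ _ (hφ i hi)
    _ = S + A.card * (H * (2 * Real.pi * δ)) := by
        rw [sum_add_distrib, sum_const, nsmul_eq_mul]
    _ ≤ Q * H * (C * R * (H : ℝ) ^ ε / Q) ^ ((1 : ℝ) / (2 * critExp k : ℕ)) +
        Q * (H * (2 * Real.pi * δ)) := by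
        have := Real.pi_pos
        gcongr
    _ = _ := by ring

theorem int_eq_zero_of_abs_sub_lt {t a b : ℝ} {z : ℤ} (h : |t - z| < a) (ht : |t| ≤ b)
    (hab : a + b ≤ 1) : z = 0 := by
  have : |(z : ℝ)| < 1 := by
    calc |(z : ℝ)| = |t - (t - z)| := by rw [sub_sub_cancel]
      _ ≤ |t| + |t - z| := abs_sub _ _
      _ < 1 := by linarith
  have h2 : |z| < 1 := by exact_mod_cast this
  exact Int.abs_lt_one_iff.1 h2

theorem card_le_of_dvd_of_abs_sub_le (S : Finset ℕ) {H : ℕ} (hH : 1 ≤ H) (hS : ∀ b ∈ S, H ∣ b)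
    {x r : ℝ} (hr : 0 ≤ r) (h : ∀ b ∈ S, |x - b| ≤ r) : (S.card : ℝ) ≤ 2 * r / H + 1 := by
  have hHp : (0 : ℝ) < H := by exact_mod_cast hH
  have hinj : Set.InjOn (fun b : ℕ => ((b / H : ℕ) : ℤ)) S := by
    intro a ha b hb hab
    have : a / H = b / H := Nat.cast_injective (R := ℤ) hab
    rw [← Nat.div_mul_cancel (hS a ha), ← Nat.div_mul_cancel (hS b hb), this]
  have hsub : S.image (fun b : ℕ => ((b / H : ℕ) : ℤ)) ⊆
      Finset.Icc ⌈(x - r) / H⌉ ⌊(x + r) / H⌋ := by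
    intro z hz
    obtain ⟨b, hb, rfl⟩ := mem_image.1 hz
    have hb2 := abs_le.1 (h b hb)
    have e : (((b / H : ℕ) : ℤ) : ℝ) = b / H := by
      have := Nat.div_mul_cancel (hS b hb)
      rw [eq_div_iff hHp.ne']
      exact_mod_cast this
    rw [mem_Icc, Int.ceil_le, Int.le_floor, e]
    constructor <;> gcongr <;> linarith [hb2.1, hb2.2]
  have hc := card_le_card hsub
  rw [card_image_of_injOn hinj, Int.card_Icc] at hc
  have h1 : (S.card : ℝ) ≤ ((⌊(x + r) / H⌋ + 1 - ⌈(x - r) / H⌉).toNat : ℝ) := by exact_mod_cast hc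
  have h2 : (((⌊(x + r) / H⌋ + 1 - ⌈(x - r) / H⌉).toNat : ℤ) : ℝ) ≤ 2 * r / H + 1 := by
    rw [Int.toNat_eq_max]
    push_cast
    refine max_le ?_ (by positivity)
    have := Int.floor_le ((x + r) / H)
    have := Int.le_ceil ((x - r) / H)
    have e : 2 * r / H = (x + r) / H - (x - r) / H := by ring
    linarith
  exact h1.trans (by exact_mod_cast h2)

/-- Taylor expansion of the phase along a short block. -/
theorem exists_phase_taylor {d : ℕ} (α θ : Fin (d + 1) → ℝ) (hθ : StrictMono θ)
    (h0 : 0 ≤ θ (Fin.last d)) (k : ℕ) {M : ℝ} (hM : 1 ≤ M) :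
    ∃ C > (0 : ℝ), ∀ N : ℝ, 1 ≤ N → ∀ lam : ℝ, 0 < lam → ∀ a b y H : ℕ, 1 ≤ b → y < H → H ≤ b →
      N ≤ a * b → (a * b : ℝ) ≤ M * N →
      |lam * powSum α θ (a * (b + y)) - (lam * powSum α θ (a * b) +
        ∑ j : Fin k, lam * powSum (fun i => α i * binCoef (j.val + 1) (θ i)) θ (a * b) /
          (b : ℝ) ^ (j.val + 1) * (y : ℝ) ^ (j.val + 1))|
      ≤ C * (lam * N ^ θ (Fin.last d) * ((H : ℝ) / b) ^ (k + 1)) := by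
  obtain ⟨C, hC, h⟩ := powSum_mul_taylor α θ hθ (k + 1)
  refine ⟨C * M ^ θ (Fin.last d), by positivity, fun N hN lam hlam a b y H hb hy hH hN1 hN2 => ?_⟩
  have hbp : (0 : ℝ) < b := by exact_mod_cast hb
  have hyH : (y : ℝ) ≤ H := by exact_mod_cast hy.le
  have hHb : (H : ℝ) ≤ b := by exact_mod_cast hH
  have hu : (y : ℝ) / b ∈ Set.Icc (0 : ℝ) 1 :=
    ⟨by positivity, by rw [div_le_one hbp]; linarith⟩
  have h1 := h (a * b) (hN.trans hN1) (y / b) hu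
  have e1 : (a * b * (1 + y / b) : ℝ) = a * (b + y) := by field_simp
  rw [e1, sum_range_succ'] at h1
  simp only [binCoef, mul_one, pow_zero] at h1
  have e2 : lam * powSum α θ (a * (b + y)) - (lam * powSum α θ (a * b) +
        ∑ j : Fin k, lam * powSum (fun i => α i * binCoef (j.val + 1) (θ i)) θ (a * b) /
          (b : ℝ) ^ (j.val + 1) * (y : ℝ) ^ (j.val + 1)) =
      lam * (powSum α θ (a * (b + y)) - (∑ j ∈ range k,
        powSum (fun i => α i * binCoef (j + 1) (θ i)) θ (a * b) * ((y : ℝ) / b) ^ (j + 1) +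
          powSum α θ (a * b))) := by
    have e3 : ∑ j : Fin k, lam * powSum (fun i => α i * binCoef (j.val + 1) (θ i)) θ (a * b) /
          (b : ℝ) ^ (j.val + 1) * (y : ℝ) ^ (j.val + 1) = lam * ∑ j ∈ range k,
        powSum (fun i => α i * binCoef (j + 1) (θ i)) θ (a * b) * ((y : ℝ) / b) ^ (j + 1) := by
      rw [← Fin.sum_univ_eq_sum_range (fun j =>
        powSum (fun i => α i * binCoef (j + 1) (θ i)) θ (a * b) * ((y : ℝ) / b) ^ (j + 1)) k,
        mul_sum]
      refine sum_congr rfl fun j _ => ?_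
      rw [div_pow]
      ring
    rw [e3]
    ring
  rw [e2, abs_mul, abs_of_pos hlam]
  have hMN : (a * b : ℝ) ^ θ (Fin.last d) ≤ M ^ θ (Fin.last d) * N ^ θ (Fin.last d) := by
    rw [← Real.mul_rpow (by linarith) (by linarith)]
    exact Real.rpow_le_rpow (by positivity) hN2 h0
  calc _ ≤ lam * (C * (a * b : ℝ) ^ θ (Fin.last d) * (y / b) ^ (k + 1)) := by
        gcongr
        simpa only [binCoef] using h1
    _ ≤ lam * (C * (M ^ θ (Fin.last d) * N ^ θ (Fin.last d)) * (H / b) ^ (k + 1)) := by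
        gcongr
    _ = _ := by ring

theorem exists_typeII_block {d : ℕ} (α θ : Fin (d + 1) → ℝ) (hθ : StrictMono θ)
    (hα : α (Fin.last d) ≠ 0) (h0 : 0 ≤ θ (Fin.last d))
    (hnonint : ∀ z : ℤ, (z : ℝ) ≠ θ (Fin.last d)) (m : ℕ) {M : ℝ} (hM : 1 ≤ M)
    {ε : ℝ} (hε : 0 < ε) :
    ∃ C > (0 : ℝ), ∃ N₀ ≥ (1 : ℝ), ∀ N ≥ N₀, ∀ lam : ℝ, 0 < lam → ∀ b H : ℕ, 1 ≤ H → H ≤ b →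
      ∀ A : Finset ℕ, (∀ a ∈ A, N ≤ a * b ∧ (a * b : ℝ) ≤ M * N) →
      C * (lam * N ^ θ (Fin.last d)) ≤ (b : ℝ) ^ (m + 2) →
      C * b ≤ (H : ℝ) ^ (m + 2) →
      C * ((b : ℝ) ^ m * N) ≤ lam * N ^ θ (Fin.last d) * (H : ℝ) ^ (m + 1) →
      ∀ β : ℕ → ℂ, (∀ y, ‖β y‖ ≤ 1) →
      ∑ a ∈ A, ‖∑ y ∈ range H, β y * expi (lam * powSum α θ (a * (b + y)))‖ ≤
        C * (N / b * H * (((H : ℝ) ^ ε * b / N) ^ ((1 : ℝ) / (2 * critExp (m + 2) : ℕ)) +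
          lam * N ^ θ (Fin.last d) * ((H : ℝ) / b) ^ (m + 3))) := by
  set Θ := θ (Fin.last d) with hΘ
  have hΘ0 : Θ ≠ 0 := fun h => hnonint 0 (by simp [h])
  obtain ⟨C₁, hC₁, h1⟩ := exists_phase_taylor α θ hθ h0 (m + 2) hM
  obtain ⟨C₂, hC₂, h2⟩ := exists_block_mean (m + 2) (by omega) hε
  obtain ⟨p, P, N₁, hp, hP, hN₁, h3⟩ := powSum_spacing
    (fun i => α i * binCoef (m + 2) (θ i)) θ hθ
    (mul_ne_zero hα (binCoef_ne_zero _ hnonint)) hΘ0 hM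
  obtain ⟨q, Q, N₂, hq, hQ, hN₂, h4⟩ := powSum_spacing
    (fun i => α i * binCoef (m + 1) (θ i)) θ hθ
    (mul_ne_zero hα (binCoef_ne_zero _ hnonint)) hΘ0 hM
  rw [← hΘ] at h1 h3 h4
  have hM0 : 0 < M := by linarith
  have hpi := Real.pi_pos
  set s : ℝ := (1 : ℝ) / (2 * critExp (m + 2) : ℕ) with hs
  set C : ℝ := 2 + 2 * P * M + 2 * Q / p + 1 / q + M * (C₂ / M) ^ s + M * (2 * Real.pi * C₁)
    with hC
  have c0 : 0 < 2 * P * M := by positivity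
  have c1 : 0 < 2 * Q / p := by positivity
  have c2 : 0 < 1 / q := by positivity
  have c3 : 0 < M * (C₂ / M) ^ s := by positivity
  have c4 : 0 < M * (2 * Real.pi * C₁) := by positivity
  refine ⟨C, by positivity, max N₁ N₂, hN₁.trans (le_max_left _ _), ?_⟩
  intro N hN lam hlam b H hH hHb A hA hi hii hiii β hβ
  have hN1 : 1 ≤ N := hN₁.trans ((le_max_left _ _).trans hN)
  have hNp : 0 < N := by linarith
  have hHp : (0 : ℝ) < H := by exact_mod_cast hH
  have hbp : (0 : ℝ) < b := by exact_mod_cast (hH.trans hHb)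
  have hb1 : (1 : ℝ) ≤ b := by exact_mod_cast (hH.trans hHb)
  have hH2 : (2 : ℝ) ≤ H := by
    by_contra hlt
    have : H = 1 := by
      have : (H : ℝ) < 2 := not_le.1 hlt
      have : H < 2 := by exact_mod_cast this
      omega
    rw [this, Nat.cast_one, one_pow] at hii
    nlinarith
  have hHinv : ∀ n : ℕ, 1 / (H : ℝ) ^ (n + 1) ≤ 1 / 2 := by
    intro n
    have : (2 : ℝ) ≤ (H : ℝ) ^ (n + 1) := hH2.trans (le_self_pow₀ (by linarith) (by omega))
    exact one_div_le_one_div_of_le (by norm_num) this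
  set γ : ℕ → Fin (m + 2) → ℝ := fun a j =>
    lam * powSum (fun i => α i * binCoef (j.val + 1) (θ i)) θ (a * b) / (b : ℝ) ^ (j.val + 1)
    with hγ
  have hNpow : N ^ (Θ - 1) = N ^ Θ / N := Real.rpow_sub_one hNp.ne' _
  have hspace : ∀ i ∈ A, ∀ B ⊆ A, (∀ i' ∈ B, ∀ j, ∃ z : ℤ,
      |γ i j - γ i' j - z| < 1 / (H : ℝ) ^ (j.val + 1)) → B.card ≤ 1 := by
    intro i hi' B hB hclose
    have : B ⊆ {i} := by
      intro i' hi''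
      rw [mem_singleton]
      obtain ⟨x1, x2⟩ := hA i hi'
      obtain ⟨y1, y2⟩ := hA i' (hB hi'')
      have k3 := h3 N ((le_max_left _ _).trans hN) _ ⟨x1, x2⟩ _ ⟨y1, y2⟩
      have k4 := h4 N ((le_max_right _ _).trans hN) _ ⟨x1, x2⟩ _ ⟨y1, y2⟩
      set D : ℝ := |(i : ℝ) - i'| with hD
      have hDb : |(i * b : ℝ) - i' * b| = D * b := by
        rw [← sub_mul, abs_mul, abs_of_pos hbp]
      rw [hDb, hNpow] at k3 k4
      have hDbM : D * b ≤ M * N := by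
        rw [← hDb, abs_sub_le_iff]; constructor <;> linarith
      have eγ : ∀ j : Fin (m + 2), |γ i j - γ i' j| = lam / (b : ℝ) ^ (j.val + 1) *
          |powSum (fun i => α i * binCoef (j.val + 1) (θ i)) θ (i * b) -
            powSum (fun i => α i * binCoef (j.val + 1) (θ i)) θ (i' * b)| := by
        intro j
        rw [hγ]
        simp only
        rw [← sub_div, ← mul_sub, abs_div, abs_mul, abs_of_pos hlam,
          abs_of_pos (pow_pos hbp _)]
        ring
      obtain ⟨z, hz⟩ := hclose i' hi'' ⟨m + 1, by omega⟩
      have e1 := eγ ⟨m + 1, by omega⟩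
      simp only at hz e1
      have hsmall1 : |γ i ⟨m + 1, by omega⟩ - γ i' ⟨m + 1, by omega⟩| ≤ 1 / 2 := by
        rw [e1]
        calc _ ≤ lam / (b : ℝ) ^ (m + 2) * (P * (N ^ Θ / N) * (D * b)) := by
              gcongr; exact k3.2
          _ ≤ lam / (b : ℝ) ^ (m + 2) * (P * (N ^ Θ / N) * (M * N)) := by gcongr
          _ = (2 * P * M) * (lam * N ^ Θ) / (2 * (b : ℝ) ^ (m + 2)) := by field_simp
          _ ≤ C * (lam * N ^ Θ) / (2 * (b : ℝ) ^ (m + 2)) := by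
              gcongr
              linarith
          _ ≤ (b : ℝ) ^ (m + 2) / (2 * (b : ℝ) ^ (m + 2)) := by gcongr
          _ = _ := by field_simp
      have z0 := int_eq_zero_of_abs_sub_lt hz hsmall1 (by linarith [hHinv (m + 1)])
      rw [z0, Int.cast_zero, sub_zero, e1] at hz
      have hz1 : lam / (b : ℝ) ^ (m + 2) * (p * (N ^ Θ / N) * (D * b)) <
          1 / (H : ℝ) ^ (m + 2) := lt_of_le_of_lt (by gcongr; exact k3.1) hz
      obtain ⟨z', hz'⟩ := hclose i' hi'' ⟨m, by omega⟩
      have e2 := eγ ⟨m, by omega⟩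
      simp only at hz' e2
      have hsmall2 : |γ i ⟨m, by omega⟩ - γ i' ⟨m, by omega⟩| ≤ 1 / 2 := by
        rw [e2]
        calc _ ≤ lam / (b : ℝ) ^ (m + 1) * (Q * (N ^ Θ / N) * (D * b)) := by
              gcongr; exact k4.2
          _ = (Q / p * b) * (lam / (b : ℝ) ^ (m + 2) * (p * (N ^ Θ / N) * (D * b))) := by
              field_simp
              ring
          _ ≤ (Q / p * b) * (1 / (H : ℝ) ^ (m + 2)) := by gcongr
          _ = (2 * Q / p) * b / (2 * (H : ℝ) ^ (m + 2)) := by field_simp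
          _ ≤ C * b / (2 * (H : ℝ) ^ (m + 2)) := by
              gcongr
              linarith
          _ ≤ (H : ℝ) ^ (m + 2) / (2 * (H : ℝ) ^ (m + 2)) := by gcongr
          _ = _ := by field_simp
      have z0' := int_eq_zero_of_abs_sub_lt hz' hsmall2 (by linarith [hHinv m])
      rw [z0', Int.cast_zero, sub_zero, e2] at hz'
      have hz2 : lam / (b : ℝ) ^ (m + 1) * (q * (N ^ Θ / N) * (D * b)) <
          1 / (H : ℝ) ^ (m + 1) := lt_of_le_of_lt (by gcongr; exact k4.1) hz'
      have hD1 : D < 1 := by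
        by_contra hge
        push Not at hge
        have h5 : 1 / q * ((b : ℝ) ^ m * N) ≤ lam * N ^ Θ * (H : ℝ) ^ (m + 1) :=
          le_trans (by gcongr; linarith) hiii
        have h6 : 1 / (H : ℝ) ^ (m + 1) ≤
            lam / (b : ℝ) ^ (m + 1) * (q * (N ^ Θ / N) * (1 * b)) := by
          rw [div_le_iff₀ (by positivity)]
          have e : lam / (b : ℝ) ^ (m + 1) * (q * (N ^ Θ / N) * (1 * b)) * (H : ℝ) ^ (m + 1)
              = (lam * N ^ Θ * (H : ℝ) ^ (m + 1)) / (1 / q * ((b : ℝ) ^ m * N)) := by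
            rw [pow_succ]
            field_simp
          rw [e, one_le_div (by positivity)]
          exact h5
        have h7 : lam / (b : ℝ) ^ (m + 1) * (q * (N ^ Θ / N) * (1 * b)) ≤
            lam / (b : ℝ) ^ (m + 1) * (q * (N ^ Θ / N) * (D * b)) := by gcongr
        linarith
      have hD2 : |(i : ℤ) - i'| < 1 := by
        rw [hD] at hD1
        exact_mod_cast hD1
      have := Int.abs_lt_one_iff.1 hD2
      omega
    simpa using card_le_card this
  set δ : ℝ := C₁ * (lam * N ^ Θ * ((H : ℝ) / b) ^ (m + 3)) with hδ
  have hδ0 : 0 ≤ δ := by positivity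
  have hcard : (A.card : ℝ) ≤ M * N / b := by
    have hsub : A ⊆ Finset.Icc 1 ⌊M * N / b⌋₊ := by
      intro a ha
      obtain ⟨x1, x2⟩ := hA a ha
      rw [mem_Icc]
      refine ⟨?_, Nat.le_floor ?_⟩
      · rcases Nat.eq_zero_or_pos a with h | h
        · rw [h] at x1; simp at x1; linarith
        · exact h
      · rw [le_div_iff₀ hbp]; exact x2
    have := card_le_card hsub
    rw [Nat.card_Icc, Nat.add_sub_cancel] at this
    exact (by exact_mod_cast this : (A.card : ℝ) ≤ ⌊M * N / b⌋₊).trans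
      (Nat.floor_le (by positivity))
  have key := h2 H hH A γ 1 hspace β hβ (fun a y => lam * powSum α θ (a * (b + y)))
    (fun a => lam * powSum α θ (a * b)) δ (fun a ha y hy => by
      obtain ⟨x1, x2⟩ := hA a ha
      exact h1 N hN1 lam hlam a b y H (hH.trans hHb) hy hHb x1 x2) hδ0 (M * N / b)
      (by positivity) hcard
  refine key.trans ?_
  have e1 : C₂ * ((1 : ℕ) : ℝ) * (H : ℝ) ^ ε / (M * N / b) =
      (C₂ / M) * ((H : ℝ) ^ ε * b / N) := by
    push_cast; field_simp
  rw [e1, Real.mul_rpow (by positivity) (by positivity)]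
  set U := ((H : ℝ) ^ ε * b / N) ^ s with hU
  have hU0 : 0 ≤ U := by positivity
  set W := lam * N ^ Θ * ((H : ℝ) / b) ^ (m + 3) with hW
  have hW0 : 0 ≤ W := by positivity
  calc _ = N / b * H * ((M * (C₂ / M) ^ s) * U + (M * (2 * Real.pi * C₁)) * W) := by
        rw [hδ]; ring
    _ ≤ N / b * H * (C * U + C * W) := by
        gcongr <;> linarith
    _ = _ := by ring

theorem powSum_div_pow {d : ℕ} (c e : Fin (d + 1) → ℝ) (n : ℕ) {x : ℝ} (hx : 0 < x) :
    powSum c e x / x ^ n = powSum c (fun i => e i - n) x := by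
  simp only [powSum, sum_div]
  refine sum_congr rfl fun i _ => ?_
  rw [Real.rpow_sub_natCast hx.ne', mul_div_assoc]

theorem exists_typeI_block {d : ℕ} (α θ : Fin (d + 1) → ℝ) (hθ : StrictMono θ)
    (hα : α (Fin.last d) ≠ 0) (h0 : 0 ≤ θ (Fin.last d))
    (hnonint : ∀ z : ℤ, (z : ℝ) ≠ θ (Fin.last d)) (m : ℕ) {M : ℝ} (hM : 1 ≤ M)
    {ε : ℝ} (hε : 0 < ε) :
    ∃ C > (0 : ℝ), ∃ N₀ ≥ (1 : ℝ), ∀ N ≥ N₀, ∀ lam : ℝ, 0 < lam → ∀ a H : ℕ, 1 ≤ a → 2 ≤ H →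
      ∀ S : Finset ℕ, (∀ b ∈ S, H ∣ b ∧ N ≤ a * b ∧ (a * b : ℝ) ≤ M * N) → (H : ℝ) ≤ N / a →
      C * (lam * N ^ θ (Fin.last d)) ≤ (N / a) ^ (m + 1) →
      ∀ W : ℝ, W = (N / a / H) ^ (m + 2) / (lam * N ^ θ (Fin.last d)) → 1 ≤ W →
      ∀ β : ℕ → ℂ, (∀ y, ‖β y‖ ≤ 1) →
      ∑ b ∈ S, ‖∑ y ∈ range H, β y * expi (lam * powSum α θ (a * (b + y)))‖ ≤
        C * (N / a * ((W * (H : ℝ) ^ (1 + ε) / (N / a)) ^ ((1 : ℝ) / (2 * critExp (m + 1) : ℕ)) +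
          1 / W)) := by
  set Θ := θ (Fin.last d) with hΘ
  obtain ⟨C₁, hC₁, h1⟩ := exists_phase_taylor α θ hθ h0 (m + 1) hM
  obtain ⟨C₂, hC₂, h2⟩ := exists_block_mean (m + 1) (by omega) hε
  obtain ⟨p, P, N₁, hp, hP, hN₁, h3⟩ := powSum_spacing
    (fun i => α i * binCoef (m + 1) (θ i)) (fun i => θ i - (m + 1 : ℕ))
    (fun i j hij => sub_lt_sub_right (hθ hij) _)
    (mul_ne_zero hα (binCoef_ne_zero _ hnonint))
    (fun h => hnonint (m + 1) (by push_cast at h ⊢; linarith)) hM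
  rw [← hΘ] at h1 h3
  have hM0 : 0 < M := by linarith
  have hpi := Real.pi_pos
  set s : ℝ := (1 : ℝ) / (2 * critExp (m + 1) : ℕ) with hs
  have hs0 : 0 ≤ s := by positivity
  set T : ℝ := C₂ * (2 / p + 1) / (M + 1) with hT
  set C : ℝ := 2 * P * M + (M + 1) * T ^ s + (M + 1) * (2 * Real.pi * C₁) with hC
  have hT0 : 0 < T := by positivity
  have c0 : 0 < 2 * P * M := by positivity
  have c3 : 0 < (M + 1) * T ^ s := by positivity
  have c4 : 0 < (M + 1) * (2 * Real.pi * C₁) := by positivity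
  refine ⟨C, by positivity, N₁, hN₁, ?_⟩
  intro N hN lam hlam a H ha hH S hS hHB hi W hW hW1 β hβ
  have hN1 : 1 ≤ N := hN₁.trans hN
  have hNp : 0 < N := by linarith
  have hHp : (0 : ℝ) < H := by exact_mod_cast (by omega : 0 < H)
  have hap : (0 : ℝ) < a := by exact_mod_cast ha
  have hH2 : (2 : ℝ) ≤ H := by exact_mod_cast hH
  have hWp : 0 < W := by linarith
  have hb : ∀ b ∈ S, N / a ≤ b ∧ 0 < (b : ℝ) ∧ 1 ≤ b ∧ H ≤ b := by
    intro b hbS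
    obtain ⟨-, x1, x2⟩ := hS b hbS
    have e1 : N / a ≤ b := by rw [div_le_iff₀ hap]; linarith
    have e2 : (H : ℝ) ≤ b := hHB.trans e1
    exact ⟨e1, by linarith, by exact_mod_cast (by linarith : (1 : ℝ) ≤ b), by exact_mod_cast e2⟩
  set γ : ℕ → Fin (m + 1) → ℝ := fun b j =>
    lam * powSum (fun i => α i * binCoef (j.val + 1) (θ i)) θ (a * b) / (b : ℝ) ^ (j.val + 1)
    with hγ
  set G : ℝ → ℝ := powSum (fun i => α i * binCoef (m + 1) (θ i)) (fun i => θ i - (m + 1 : ℕ))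
    with hG
  have eγ : ∀ b ∈ S, γ b ⟨m, by omega⟩ = lam * (a : ℝ) ^ (m + 1) * G (a * b) := by
    intro b hbS
    have hbp := (hb b hbS).2.1
    rw [hG, ← powSum_div_pow _ _ _ (by positivity), hγ]
    simp only
    rw [mul_pow]
    field_simp
  have hNpow : N ^ (Θ - (m + 1 : ℕ) - 1) = N ^ Θ / N ^ (m + 2) := by
    rw [Real.rpow_sub_one hNp.ne', Real.rpow_sub_natCast hNp.ne', pow_succ N (m + 1)]
    field_simp
  set R : ℕ := ⌊2 / p * W + 1⌋₊ with hR
  have hspace : ∀ i ∈ S, ∀ B ⊆ S, (∀ i' ∈ B, ∀ j, ∃ z : ℤ,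
      |γ i j - γ i' j - z| < 1 / (H : ℝ) ^ (j.val + 1)) → B.card ≤ R := by
    intro i hiS B hB hclose
    refine Nat.le_floor ?_
    have := card_le_of_dvd_of_abs_sub_le B (H := H) (by omega) (fun b hbB => (hS b (hB hbB)).1)
      (x := i) (r := W * H / p) (by positivity) ?_
    · calc _ ≤ _ := this
        _ = _ := by field_simp
    intro i' hi'
    obtain ⟨-, x1, x2⟩ := hS i hiS
    obtain ⟨-, y1, y2⟩ := hS i' (hB hi')
    have k3 := h3 N hN _ ⟨x1, x2⟩ _ ⟨y1, y2⟩
    set D : ℝ := |(i : ℝ) - i'| with hD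
    have hDb : |(a * i : ℝ) - a * i'| = a * D := by
      rw [← mul_sub, abs_mul, abs_of_pos hap]
    rw [hDb, hNpow] at k3
    have hDbM : a * D ≤ M * N := by
      rw [← hDb, abs_sub_le_iff]; constructor <;> linarith
    obtain ⟨z, hz⟩ := hclose i' hi' ⟨m, by omega⟩
    have e1 : |γ i ⟨m, by omega⟩ - γ i' ⟨m, by omega⟩| =
        lam * (a : ℝ) ^ (m + 1) * |G (a * i) - G (a * i')| := by
      rw [eγ i hiS, eγ i' (hB hi'), ← mul_sub, abs_mul, abs_of_pos (by positivity)]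
    simp only at hz
    have hsmall1 : |γ i ⟨m, by omega⟩ - γ i' ⟨m, by omega⟩| ≤ 1 / 2 := by
      rw [e1]
      calc _ ≤ lam * (a : ℝ) ^ (m + 1) * (P * (N ^ Θ / N ^ (m + 2)) * (a * D)) := by
            gcongr; exact k3.2
        _ ≤ lam * (a : ℝ) ^ (m + 1) * (P * (N ^ Θ / N ^ (m + 2)) * (M * N)) := by gcongr
        _ = (2 * P * M) * (lam * N ^ Θ) / (2 * (N / a) ^ (m + 1)) := by
            rw [div_pow, pow_succ N (m + 1)]
            field_simp
        _ ≤ C * (lam * N ^ Θ) / (2 * (N / a) ^ (m + 1)) := by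
            gcongr
            linarith
        _ ≤ (N / a) ^ (m + 1) / (2 * (N / a) ^ (m + 1)) := by gcongr
        _ = _ := by field_simp
    have hHinv : 1 / (H : ℝ) ^ (m + 1) ≤ 1 / 2 := by
      have : (2 : ℝ) ≤ (H : ℝ) ^ (m + 1) := hH2.trans (le_self_pow₀ (by linarith) (by omega))
      exact one_div_le_one_div_of_le (by norm_num) this
    have z0 := int_eq_zero_of_abs_sub_lt hz hsmall1 (by linarith)
    rw [z0, Int.cast_zero, sub_zero, e1] at hz
    have hz1 : lam * (a : ℝ) ^ (m + 1) * (p * (N ^ Θ / N ^ (m + 2)) * (a * D)) <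
        1 / (H : ℝ) ^ (m + 1) := lt_of_le_of_lt (by gcongr; exact k3.1) hz
    have e5 : lam * (a : ℝ) ^ (m + 1) * (p * (N ^ Θ / N ^ (m + 2)) * (a * D)) =
        D / (W * H / p) * (1 / (H : ℝ) ^ (m + 1)) := by
      rw [hW, div_pow, div_pow, pow_succ (H : ℝ) (m + 1), pow_succ (a : ℝ) (m + 1)]
      field_simp
    rw [e5] at hz1
    have h6 : D / (W * H / p) < 1 := by
      by_contra hge
      push Not at hge
      have : 1 * (1 / (H : ℝ) ^ (m + 1)) ≤ D / (W * H / p) * (1 / (H : ℝ) ^ (m + 1)) := by gcongr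
      linarith
    rw [div_lt_one (by positivity)] at h6
    exact h6.le
  have hRle : (R : ℝ) ≤ (2 / p + 1) * W := by
    refine (Nat.floor_le (by positivity)).trans ?_
    linarith
  set δ : ℝ := C₁ * (1 / W) with hδ
  have hδ0 : 0 ≤ δ := by positivity
  have hcard : (S.card : ℝ) ≤ (M + 1) * (N / a / H) := by
    have := card_le_of_dvd_of_abs_sub_le S (H := H) (by omega) (fun b hbB => (hS b hbB).1)
      (x := M * N / (2 * a)) (r := M * N / (2 * a)) (by positivity) ?_
    · refine this.trans ?_
      have e : 2 * (M * N / (2 * a)) / H = M * (N / a / H) := by field_simp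
      have : 1 ≤ N / a / H := by rw [one_le_div hHp]; exact hHB
      rw [e]; linarith
    intro b hbS
    obtain ⟨-, x1, x2⟩ := hS b hbS
    have : (b : ℝ) ≤ M * N / a := by rw [le_div_iff₀ hap]; linarith
    have e : M * N / a = M * N / (2 * a) + M * N / (2 * a) := by field_simp; norm_num
    have := (hb b hbS).2.1
    rw [abs_sub_le_iff]; constructor <;> linarith
  have key := h2 H (by omega) S γ R hspace β hβ (fun b y => lam * powSum α θ (a * (b + y)))
    (fun b => lam * powSum α θ (a * b)) δ (fun b hbS y hy => by
      obtain ⟨-, x1, x2⟩ := hS b hbS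
      obtain ⟨b1, b2, b3, b4⟩ := hb b hbS
      refine (h1 N hN1 lam hlam a b y H b3 hy b4 x1 x2).trans ?_
      rw [hδ]
      gcongr
      have : 1 / W = lam * N ^ Θ * (H / (N / a)) ^ (m + 2) := by
        rw [hW, div_div_eq_mul_div (H : ℝ) N a, div_pow _ N, mul_pow, div_pow _ (H : ℝ),
          div_pow N]
        field_simp
      rw [this]
      gcongr) hδ0 ((M + 1) * (N / a / H))
      (by positivity) hcard
  refine key.trans ?_
  have e1 : C₂ * R * (H : ℝ) ^ ε / ((M + 1) * (N / a / H)) ≤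
      T * (W * (H : ℝ) ^ (1 + ε) / (N / a)) := by
    calc _ ≤ C₂ * ((2 / p + 1) * W) * (H : ℝ) ^ ε / ((M + 1) * (N / a / H)) := by gcongr
      _ = _ := by
        rw [Real.rpow_add hHp, Real.rpow_one, hT]
        field_simp
  set U := (W * (H : ℝ) ^ (1 + ε) / (N / a)) ^ s with hU
  have hU0 : 0 ≤ U := by positivity
  have e2 : (C₂ * R * (H : ℝ) ^ ε / ((M + 1) * (N / a / H))) ^ s ≤ T ^ s * U := by
    rw [hU, ← Real.mul_rpow (by positivity) (by positivity)]
    exact Real.rpow_le_rpow (by positivity) e1 hs0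
  calc _ ≤ (M + 1) * (N / a / H) * H * (T ^ s * U + 2 * Real.pi * δ) := by gcongr
    _ = N / a * (((M + 1) * T ^ s) * U + ((M + 1) * (2 * Real.pi * C₁)) * (1 / W)) := by
        rw [hδ]; field_simp
    _ ≤ N / a * (C * U + C * (1 / W)) := by
        gcongr <;> linarith
    _ = _ := by ring

theorem typeII_quadratic {Θ v : ℝ} (hΘ : 3 ≤ Θ) (hv0 : 0 ≤ v) (hv : v ≤ 0.508) :
    0.3 ≤ Θ ^ 2 * v * (4 - 6 * v + v ^ 2) - 3 * Θ * v ^ 2 + (1 - 6 * v) - 0.53 := by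
  have h1 : 9 * v * (4 - 7 * v + v ^ 2) ≤ Θ ^ 2 * v * (4 - 6 * v + v ^ 2) - 3 * Θ * v ^ 2 := by
    have : 0 ≤ v * (Θ - 3) * ((Θ + 3) * (4 - 6 * v + v ^ 2) - 3 * v) := by
      have h2 : 0.9 ≤ 4 - 6 * v + v ^ 2 := by nlinarith
      have h3 : 3 * v ≤ (Θ + 3) * (4 - 6 * v + v ^ 2) := by nlinarith
      have : 0 ≤ v * (Θ - 3) := mul_nonneg hv0 (by linarith)
      exact mul_nonneg this (by linarith)
    nlinarith
  nlinarith [sq_nonneg (v - 0.3), mul_nonneg hv0 (sq_nonneg (v - 0.4)), mul_nonneg hv0 (sub_nonneg.2 hv)]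

set_option maxHeartbeats 1000000 in
theorem typeII_main_inequality {Θ D ρ τ β κ : ℝ} (hΘ : 3 < Θ)
    (hD : D = 8 * Θ ^ 2 + 12 * Θ + 10) (hρ : ρ = 1 / D) (hτ : τ = ρ / 10 ^ 4)
    (hβ : 1 / 2 ≤ β) (hβ' : β ≤ 0.67) (hκ : 1 ≤ κ) (hκ' : κ ≤ (Θ + ρ + τ) / β) :
    ρ * ((κ + 1 / κ + 1 + 4 * τ) * (κ + 1 / κ + 2 + 4 * τ)) + τ ≤ 1 - β := by
  have hD118 : 118 ≤ D := by rw [hD]; nlinarith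
  have hD0 : 0 < D := by linarith
  have hρD : ρ * D = 1 := by rw [hρ]; field_simp
  have hρ0 : 0 < ρ := by rw [hρ]; positivity
  have hρ1 : ρ ≤ 1 / 118 := by
    rw [hρ]; exact one_div_le_one_div_of_le (by norm_num) hD118
  have hτ0 : 0 < τ := by rw [hτ]; positivity
  have hΘρ : Θ * ρ ≤ 3 / 118 := by
    rw [hρ, mul_one_div, div_le_div_iff₀ hD0 (by norm_num), hD]
    nlinarith
  have hβ0 : 0 < β := by linarith
  set s := (Θ + ρ + τ) / β with hs
  obtain ⟨u, hu⟩ : ∃ u, u = 1 / β := ⟨_, rfl⟩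
  have hu2 : u ≤ 2 := by rw [hu, div_le_iff₀ hβ0]; linarith
  have hu1 : 1.492 ≤ u := by rw [hu, le_div_iff₀ hβ0]; linarith
  have hβu : β * u = 1 := by rw [hu]; field_simp
  have hsu : s = (Θ + ρ + τ) * u := by rw [hs, hu]; field_simp
  have hs3 : 3 * u ≤ s := by
    rw [hsu]
    exact mul_le_mul_of_nonneg_right (by linarith) (by linarith)
  have hs0 : 0 < s := by linarith
  obtain ⟨e, he⟩ : ∃ e, e = 1 / s := ⟨_, rfl⟩
  have hse : s * e = 1 := by rw [he]; field_simp
  have he0 : 0 < e := by rw [he]; positivity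
  have heu : 3 * (e * u) ≤ 1 := by
    have := mul_le_mul_of_nonneg_left hs3 he0.le
    linarith
  have he1 : e ≤ 1 / 4 := by
    rw [he]; exact one_div_le_one_div_of_le (by norm_num) (by linarith)
  have hκs : κ + 1 / κ ≤ s + e := by
    have hκ0 : 0 < κ := by linarith
    have : s + e - (κ + 1 / κ) = (s - κ) * (1 - 1 / (s * κ)) := by
      rw [he]; field_simp; ring
    have h2 : 1 / (s * κ) ≤ 1 := by
      rw [div_le_one (by positivity)]; nlinarith
    have := mul_nonneg (sub_nonneg.2 hκ') (sub_nonneg.2 h2)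
    linarith
  have hκ0 : 0 < κ + 1 / κ := by positivity
  have hP : (κ + 1 / κ + 1 + 4 * τ) * (κ + 1 / κ + 2 + 4 * τ) ≤
      (s + e + 1 + 4 * τ) * (s + e + 2 + 4 * τ) := by gcongr
  have hτsmall : τ ≤ 1 / 10 ^ 6 := by rw [hτ]; linarith
  have hΘτ : Θ * τ ≤ 1 / 10 ^ 5 := by
    have : Θ * τ = Θ * ρ / 10 ^ 4 := by rw [hτ]; ring
    rw [this]; linarith
  have hsτ : s * τ ≤ 1 / 10 ^ 4 := by
    have e1 : s * τ = (Θ * τ + (ρ + τ) * τ) * u := by rw [hsu]; ring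
    have : (ρ + τ) * τ ≤ 1 / 10 ^ 5 := by nlinarith
    have h2 : 0 ≤ Θ * τ + (ρ + τ) * τ := by positivity
    rw [e1]
    calc (Θ * τ + (ρ + τ) * τ) * u ≤ (1 / 10 ^ 5 + 1 / 10 ^ 5) * 2 := by gcongr
      _ ≤ 1 / 10 ^ 4 := by norm_num
  have hs2 : s ^ 2 ≤ Θ ^ 2 * u ^ 2 + 0.051 * u ^ 2 := by
    have e1 : s ^ 2 = Θ ^ 2 * u ^ 2 + (2 * (Θ * ρ) + 2 * (Θ * τ) + (ρ + τ) ^ 2) * u ^ 2 := by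
      rw [hsu]; ring
    rw [e1]
    have : (ρ + τ) ^ 2 ≤ (1 / 115) ^ 2 := by
      apply pow_le_pow_left₀ (by positivity); linarith
    have h3 : 2 * (Θ * ρ) + 2 * (Θ * τ) + (ρ + τ) ^ 2 ≤ 0.051 := by linarith
    have := mul_le_mul_of_nonneg_right h3 (sq_nonneg u)
    linarith
  have hs1 : s ≤ Θ * u + 0.0085 * u := by
    rw [hsu]
    have : ρ + τ ≤ 0.0085 := by linarith
    have := mul_le_mul_of_nonneg_right this (by linarith : (0 : ℝ) ≤ u)
    linarith
  have hP2 : (s + e + 1 + 4 * τ) * (s + e + 2 + 4 * τ) ≤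
      Θ ^ 2 * u ^ 2 + 3 * (Θ * u) + 4 + 0.051 * u ^ 2 + 0.0255 * u + 3 * e + e ^ 2 + 0.001 := by
    have e1 : (s + e + 1 + 4 * τ) * (s + e + 2 + 4 * τ) = s ^ 2 + 3 * s + 2 + 2 * (s * e) + 3 * e +
        e ^ 2 + (8 * (s * τ) + 12 * τ + 8 * (e * τ) + 16 * τ ^ 2) := by ring
    rw [e1, hse]
    have : e * τ ≤ 1 * (1 / 10 ^ 6) := by gcongr; linarith
    have : τ ^ 2 ≤ (1 / 10 ^ 6) ^ 2 := by gcongr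
    linarith
  have hquad := typeII_quadratic hΘ.le (v := 2 - u) (by linarith) (by linarith)
  have hfin : u * ((s + e + 1 + 4 * τ) * (s + e + 2 + 4 * τ)) + u * (τ * D) ≤ (u - 1) * D := by
    have h1 := mul_le_mul_of_nonneg_left hP2 (by linarith : (0 : ℝ) ≤ u)
    have hτD : τ * D = 1 / 10 ^ 4 := by
      have : τ * D = ρ * D / 10 ^ 4 := by rw [hτ]; ring
      rw [this, hρD]
    rw [hτD]
    have hu3 : u ^ 3 ≤ 8 := by
      have := pow_le_pow_left₀ (by linarith : (0 : ℝ) ≤ u) hu2 3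
      linarith
    have hu22 : u ^ 2 ≤ 2 ^ 2 := by gcongr
    have heu2 : (e * u) * e ≤ 1 / 3 * (1 / 4) := by gcongr; linarith
    rw [hD]
    linarith
  have h5 : (s + e + 1 + 4 * τ) * (s + e + 2 + 4 * τ) + τ * D ≤ (1 - β) * D := by
    have h6 := mul_le_mul_of_nonneg_left hfin hβ0.le
    have e1 : β * (u * ((s + e + 1 + 4 * τ) * (s + e + 2 + 4 * τ)) + u * (τ * D)) =
        (β * u) * ((s + e + 1 + 4 * τ) * (s + e + 2 + 4 * τ) + τ * D) := by ring
    have e2 : β * ((u - 1) * D) = (β * u - β) * D := by ring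
    rw [e1, e2, hβu, one_mul] at h6
    exact h6
  have h7 := mul_le_mul_of_nonneg_left (h5.trans' (add_le_add_left hP _)) hρ0.le
  have e3 : ρ * ((1 - β) * D) = (1 - β) * (ρ * D) := by ring
  have e4 : ρ * (τ * D) = τ * (ρ * D) := by ring
  rw [mul_add, e3, e4, hρD, mul_one, mul_one] at h7
  exact h7

theorem rho_tau_bounds {Θ D ρ τ : ℝ} (hΘ : 3 < Θ)
    (hD : D = 8 * Θ ^ 2 + 12 * Θ + 10) (hρ : ρ = 1 / D) (hτ : τ = ρ / 10 ^ 4) :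
    0 < ρ ∧ ρ ≤ 1 / 118 ∧ 0 < τ ∧ τ ≤ 1 / 10 ^ 6 := by
  have hD118 : 118 ≤ D := by rw [hD]; nlinarith
  have hD0 : 0 < D := by linarith
  have hρ0 : 0 < ρ := by rw [hρ]; positivity
  have hρ1 : ρ ≤ 1 / 118 := by
    rw [hρ]; exact one_div_le_one_div_of_le (by norm_num) hD118
  exact ⟨hρ0, hρ1, by rw [hτ]; positivity, by rw [hτ]; linarith⟩

theorem exists_typeII_exponents {Θ D ρ τ β l t : ℝ} (hΘ : 3 < Θ)
    (hD : D = 8 * Θ ^ 2 + 12 * Θ + 10) (hρ : ρ = 1 / D) (hτ : τ = ρ / 10 ^ 4)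
    (hβ : 1 / 2 ≤ β) (hβ' : β ≤ 0.67) (hl : -ρ ≤ l) (hl' : l ≤ τ) (ht : t = l + Θ + ρ) :
    ∃ m : ℕ, (m : ℝ) ≤ 2 * Θ + 10 ∧ l + Θ + τ ≤ (m + 2) * β ∧
      β + τ ≤ (m + 2) * (β - t / (m + 3)) ∧
      m * β + 1 + τ ≤ l + Θ + (m + 1) * (β - t / (m + 3)) ∧
      ρ * ((m + 2) * (m + 3)) + τ ≤ 1 - β ∧ ρ * (m + 3) ≤ t := by
  obtain ⟨hρ0, hρ1, hτ0, hτ1⟩ := rho_tau_bounds hΘ hD hρ hτ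
  have hβ0 : 0 < β := by linarith
  have ht3 : 3 ≤ t := by linarith
  obtain ⟨κ, hκ⟩ : ∃ κ, κ = t / β := ⟨_, rfl⟩
  have hκβ : κ * β = t := by rw [hκ]; field_simp
  have hκ4 : 4 ≤ κ := by rw [hκ, le_div_iff₀ hβ0]; linarith
  have hκ0 : 0 < κ := by linarith
  have hκ2t : κ ≤ 2 * t := by rw [hκ, div_le_iff₀ hβ0]; nlinarith
  have hinv : 1 / κ ≤ 1 / 4 := one_div_le_one_div_of_le (by norm_num) hκ4
  have hinv0 : 0 < 1 / κ := by positivity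
  set n := ⌊κ + 1 / κ + 4 * τ⌋₊ with hn
  have hn1 : (n : ℝ) ≤ κ + 1 / κ + 4 * τ := Nat.floor_le (by positivity)
  have hn2 : κ + 1 / κ + 4 * τ < n + 1 := Nat.lt_floor_add_one _
  have hn4 : 4 ≤ n := Nat.le_floor (by push_cast; linarith)
  obtain ⟨m, hm⟩ : ∃ m, n = m + 1 := ⟨n - 1, by omega⟩
  obtain ⟨k, hk⟩ : ∃ k : ℝ, k = m + 2 := ⟨_, rfl⟩
  have hnk : (n : ℝ) = k - 1 := by rw [hm, hk]; push_cast; ring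
  rw [hnk] at hn1 hn2
  have hk5 : 4 ≤ k := by
    have : (4 : ℝ) ≤ n := by exact_mod_cast hn4
    rw [hnk] at this; linarith
  have e2 : (m + 2 : ℝ) = k := hk.symm
  have e3 : (m + 3 : ℝ) = k + 1 := by rw [hk]; ring
  have e1 : (m + 1 : ℝ) = k - 1 := by rw [hk]; ring
  have e0 : (m : ℝ) = k - 2 := by rw [hk]; ring
  have hk1 : 0 < k + 1 := by linarith
  have hmain := typeII_main_inequality hΘ hD hρ hτ hβ hβ' (by linarith : 1 ≤ κ)
    (by rw [hκ]; gcongr; linarith)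
  have hv : ρ * (k * (k + 1)) + τ ≤ 1 - β := by
    refine le_trans ?_ hmain
    have : k * (k + 1) ≤ (κ + 1 / κ + 1 + 4 * τ) * (κ + 1 / κ + 2 + 4 * τ) := by
      exact mul_le_mul (by linarith) (by linarith) hk1.le (by linarith)
    have := mul_le_mul_of_nonneg_left this hρ0.le
    linarith
  have htk : t / (k + 1) * (k + 1) = t := by field_simp
  refine ⟨m, ?_, ?_, ?_, ?_, ?_, ?_⟩
  · rw [e0]; linarith
  · rw [e2]
    have : κ * β + 4 * τ * β ≤ k * β := by
      rw [← add_mul]; exact mul_le_mul_of_nonneg_right (by linarith) hβ0.le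
    have : τ * 1 ≤ τ * (4 * β) := mul_le_mul_of_nonneg_left (by linarith) hτ0.le
    linarith
  · rw [e2, e3]
    have h1 : (β + τ) * (k + 1) ≤ k * (β - t / (k + 1)) * (k + 1) := by
      have : k * (β - t / (k + 1)) * (k + 1) = k * (β * (k + 1) - t / (k + 1) * (k + 1)) := by ring
      rw [this, htk, ← hκβ]
      have h2 : 1 + 4 * τ * k ≤ k * (k - κ) := by
        have h3 : k * (1 / κ + 4 * τ) ≤ k * (k - κ) :=
          mul_le_mul_of_nonneg_left (by linarith) (by linarith)
        have h4 : 1 ≤ k * (1 / κ) := by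
          rw [mul_one_div, one_le_div hκ0]; linarith
        linarith
      have h5 := mul_le_mul_of_nonneg_left h2 hβ0.le
      have h6 : τ * (k + 1) ≤ τ * (4 * k * β) := by
        apply mul_le_mul_of_nonneg_left _ hτ0.le
        have : k * (1 / 2) ≤ k * β := mul_le_mul_of_nonneg_left hβ (by linarith)
        linarith
      linarith
    exact le_of_mul_le_mul_right h1 hk1
  · rw [e1, e3, e0]
    have h1 : 1 / 2 + τ + ρ ≤ 2 * (t / (k + 1)) := by
      have : 0.27 ≤ t / (k + 1) := by
        rw [le_div_iff₀ hk1]; linarith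
      linarith
    have : (k - 1) * (β - t / (k + 1)) = (k - 1) * β - t / (k + 1) * (k + 1) + 2 * (t / (k + 1)) := by
      ring
    rw [this, htk]
    linarith
  · rw [e2, e3]; exact hv
  · rw [e3]
    have h1 : ρ * (k + 1) ≤ ρ * (k * (k + 1)) := by
      exact mul_le_mul_of_nonneg_left (le_mul_of_one_le_left hk1.le (by linarith)) hρ0.le
    linarith

theorem exists_typeI_exponents {Θ D ρ τ : ℝ} (hΘ : 3 < Θ)
    (hD : D = 8 * Θ ^ 2 + 12 * Θ + 10) (hρ : ρ = 1 / D) (hτ : τ = ρ / 10 ^ 4) :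
    ∃ m : ℕ, ∀ l t : ℝ, -ρ ≤ l → l ≤ τ → t = l + Θ + ρ →
      l + Θ + τ ≤ 2 / 3 * (m + 1) ∧ t / (m + 2) + τ ≤ 2 / 3 ∧
      ρ * ((m + 1) * (m + 2)) + ρ + 2 * τ ≤ t / (m + 2) ∧ ρ * (m + 2) ≤ t := by
  obtain ⟨hρ0, hρ1, hτ0, hτ1⟩ := rho_tau_bounds hΘ hD hρ hτ
  refine ⟨⌊1.5 * Θ + 0.01⌋₊, fun l t hl hl' ht => ?_⟩
  set m := ⌊1.5 * Θ + 0.01⌋₊ with hm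
  have hm1 : (m : ℝ) ≤ 1.5 * Θ + 0.01 := Nat.floor_le (by linarith)
  have hm2 : 1.5 * Θ + 0.01 < m + 1 := Nat.lt_floor_add_one _
  obtain ⟨k, hk⟩ : ∃ k : ℝ, k = m + 1 := ⟨_, rfl⟩
  have e2 : (m + 2 : ℝ) = k + 1 := by rw [hk]; ring
  have hk0 : 0 < k := by rw [hk]; positivity
  rw [e2, ← hk]
  rw [← hk] at hm2
  have hk1 : k ≤ 1.5 * Θ + 1.01 := by rw [hk]; linarith
  have hD0 : 0 < D := by rw [hD]; positivity
  have hρD : ρ * D = 1 := by rw [hρ]; field_simp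
  have hpoly : (k * (k + 1) + 1 + 0.01) * (k + 1) ≤ (Θ - ρ) * D := by
    have h1 : (k * (k + 1) + 1 + 0.01) * (k + 1) ≤
        ((1.5 * Θ + 1.01) * (1.5 * Θ + 2.01) + 1.01) * (1.5 * Θ + 2.01) := by
      have h0 : k * (k + 1) ≤ (1.5 * Θ + 1.01) * (1.5 * Θ + 2.01) :=
        mul_le_mul (by linarith) (by linarith) (by linarith) (by linarith)
      have h01 : 0 ≤ k * (k + 1) := by positivity
      exact mul_le_mul (by linarith) (by linarith) (by linarith) (by linarith)
    have h2 : (Θ - ρ) * D = Θ * D - 1 := by rw [sub_mul, hρD]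
    rw [h2, hD]
    refine h1.trans ?_
    obtain ⟨w, hw⟩ : ∃ w, Θ = 3 + w := ⟨Θ - 3, by ring⟩
    have hw0 : 0 ≤ w := by linarith
    rw [hw]
    have := pow_nonneg hw0 2
    have := pow_nonneg hw0 3
    ring_nf
    linarith
  have hthird : ρ * (k * (k + 1)) + ρ + 2 * τ ≤ t / (k + 1) := by
    rw [le_div_iff₀ (by linarith)]
    have h3 := mul_le_mul_of_nonneg_left hpoly hρ0.le
    have h4 : ρ * ((Θ - ρ) * D) = (Θ - ρ) * (ρ * D) := by ring
    rw [h4, hρD, mul_one] at h3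
    have h5 : 2 * τ * (k + 1) ≤ ρ * 0.01 * (k + 1) := by
      refine mul_le_mul_of_nonneg_right ?_ (by linarith)
      rw [hτ]; linarith
    have h6 : (ρ * (k * (k + 1)) + ρ + 2 * τ) * (k + 1) ≤
        ρ * ((k * (k + 1) + 1 + 0.01) * (k + 1)) := by linarith
    linarith
  refine ⟨by linarith, ?_, hthird, ?_⟩
  · rw [← le_sub_iff_add_le, div_le_iff₀ (by linarith)]
    nlinarith
  · have : ρ ≤ t / (k + 1) := by
      have : 0 ≤ ρ * (k * (k + 1)) := by positivity
      linarith
    rwa [le_div_iff₀ (by linarith)] at this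

theorem norm_sum_Ico_le_of_blocks (Φ : ℕ → ℂ) (G : ℕ → ℝ) (L : ℕ → ℕ) {E : ℝ} (hE : 0 ≤ E)
    (y : ℕ) : ∀ n x : ℕ, y - x = n → x ≤ y → (∀ b, x ≤ b → b < y → 1 ≤ L b) →
    (∀ b, x ≤ b → b < y → b + L b ≤ y →
      ‖∑ i ∈ Ico b (b + L b), Φ i‖ ≤ ∑ i ∈ Ico b (b + L b), G i) →
    (∀ b, x ≤ b → b < y → y < b + L b → ‖∑ i ∈ Ico b y, Φ i‖ ≤ E) →
    (∀ b, x ≤ b → b < y → 0 ≤ G b) →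
    ‖∑ i ∈ Ico x y, Φ i‖ ≤ ∑ i ∈ Ico x y, G i + E := by
  intro n
  induction n using Nat.strong_induction_on with
  | _ n ih =>
    intro x hn hxy hL hfull hshort hG
    rcases hxy.eq_or_lt with h | hlt
    · simp [h, hE]
    by_cases hfit : x + L x ≤ y
    · have h1 := hL x le_rfl hlt
      have h2 := ih (y - (x + L x)) (by omega) (x + L x) rfl hfit
        (fun b hb => hL b (by omega)) (fun b hb => hfull b (by omega))
        (fun b hb => hshort b (by omega)) (fun b hb => hG b (by omega))
      rw [← sum_Ico_consecutive Φ (by omega : x ≤ x + L x) hfit,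
        ← sum_Ico_consecutive G (by omega : x ≤ x + L x) hfit]
      have h3 := hfull x le_rfl hlt hfit
      have h4 := norm_add_le (∑ i ∈ Ico x (x + L x), Φ i) (∑ i ∈ Ico (x + L x) y, Φ i)
      linarith
    · have h1 := hshort x le_rfl hlt (by omega)
      have h2 : 0 ≤ ∑ i ∈ Ico x y, G i :=
        sum_nonneg fun i hi => hG i (mem_Ico.1 hi).1 (mem_Ico.1 hi).2
      linarith

theorem card_le_of_forall_mem_Ioc {p q : ℝ} (hp : 0 ≤ p) (hpq : p ≤ q) (A : Finset ℕ)
    (hA : ∀ a ∈ A, p < a ∧ (a : ℝ) ≤ q) : (A.card : ℝ) ≤ q - p + 1 := by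
  have hsub : A ⊆ Ioc ⌊p⌋₊ ⌊q⌋₊ := by
    intro a ha
    obtain ⟨h1, h2⟩ := hA a ha
    exact mem_Ioc.2 ⟨(Nat.floor_lt hp).2 h1, Nat.le_floor h2⟩
  have h1 := card_le_card hsub
  rw [Nat.card_Ioc] at h1
  have h2 : (A.card : ℝ) ≤ ⌊q⌋₊ - ⌊p⌋₊ := by
    rw [← Nat.cast_sub (Nat.floor_le_floor hpq)]
    exact_mod_cast h1
  have h3 := Nat.floor_le (hp.trans hpq)
  have h4 := Nat.lt_floor_add_one p
  linarith

theorem card_le_of_forall_mul_le {N b : ℝ} (hb : 0 < b) (hN : 0 ≤ N) (A : Finset ℕ)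
    (hA : ∀ a ∈ A, 0 < (a : ℝ) * b ∧ (a : ℝ) * b ≤ N) : (A.card : ℝ) ≤ N / b := by
  have hsub : A ⊆ Ioc 0 ⌊N / b⌋₊ := by
    intro a ha
    obtain ⟨h1, h2⟩ := hA a ha
    refine mem_Ioc.2 ⟨?_, Nat.le_floor ((le_div_iff₀ hb).2 h2)⟩
    exact_mod_cast pos_of_mul_pos_left h1 hb.le
  have h1 := card_le_card hsub
  rw [Nat.card_Ioc, Nat.sub_zero] at h1
  have h2 : (A.card : ℝ) ≤ ⌊N / b⌋₊ := by exact_mod_cast h1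
  exact h2.trans (Nat.floor_le (by positivity))

/-- Truncating the sums over `b + y` to `N < a (b + y) ≤ M N` only affects few values of `a`. -/
theorem sum_norm_truncated_le {M N : ℝ} (hM : 1 ≤ M) (hN : 0 < N) {b H : ℕ} (hb : 1 ≤ b)
    (A : Finset ℕ) (g : ℕ → ℕ → ℂ) (hg : ∀ a y, ‖g a y‖ ≤ 1) :
    ∑ a ∈ A, ‖∑ y ∈ range H,
        if N < (a : ℝ) * (b + y) ∧ (a : ℝ) * (b + y) ≤ M * N then g a y else 0‖ ≤
      (∑ a ∈ A.filter fun a : ℕ => N ≤ (a : ℝ) * b ∧ (a : ℝ) * b ≤ M * N, ‖∑ y ∈ range H, g a y‖) +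
        H * (2 * M * N * H / b ^ 2 + 2) := by
  classical
  set c : ℕ → ℝ := fun a => ‖∑ y ∈ range H,
    if N < (a : ℝ) * (b + y) ∧ (a : ℝ) * (b + y) ≤ M * N then g a y else 0‖ with hc
  have hb0 : (0 : ℝ) < b := by exact_mod_cast hb
  have hcH : ∀ a, c a ≤ H := by
    intro a
    refine (norm_sum_le _ _).trans ?_
    calc _ ≤ ∑ y ∈ range H, (1 : ℝ) := by
          refine sum_le_sum fun y _ => ?_
          split_ifs
          · exact hg a y
          · simp
      _ = H := by simp
  set B1 := A.filter fun a : ℕ => N / (b + H) < (a : ℝ) ∧ (a : ℝ) ≤ N / b with hB1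
  set B2 := A.filter fun a : ℕ => M * N / (b + H) < (a : ℝ) ∧ (a : ℝ) ≤ M * N / b with hB2
  have hpt : ∀ a ∈ A, c a ≤ (if N ≤ (a : ℝ) * b ∧ (a : ℝ) * b ≤ M * N then
      ‖∑ y ∈ range H, g a y‖ else 0) + (if a ∈ B1 then (H : ℝ) else 0) +
      (if a ∈ B2 then (H : ℝ) else 0) := by
    intro a ha
    have hH0 : (0 : ℝ) ≤ H := by positivity
    have n1 : 0 ≤ (if N ≤ (a : ℝ) * b ∧ (a : ℝ) * b ≤ M * N then
      ‖∑ y ∈ range H, g a y‖ else 0) := by split_ifs <;> positivity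
    have n2 : 0 ≤ (if a ∈ B1 then (H : ℝ) else 0) := by split_ifs <;> positivity
    have n3 : 0 ≤ (if a ∈ B2 then (H : ℝ) else 0) := by split_ifs <;> positivity
    by_cases h1 : a ∈ B1
    · rw [if_pos h1]; linarith [hcH a]
    by_cases h2 : a ∈ B2
    · rw [if_pos h2]; linarith [hcH a]
    have hmono : ∀ y ∈ range H, (a : ℝ) * (b + y) ≤ a * (b + H) := by
      intro y hy
      have : (y : ℝ) ≤ H := by exact_mod_cast (mem_range.1 hy).le
      gcongr
    by_cases h3 : N < (a : ℝ) * b ∧ (a : ℝ) * (b + H) ≤ M * N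
    · have h4 : N ≤ (a : ℝ) * b ∧ (a : ℝ) * b ≤ M * N := by
        refine ⟨h3.1.le, le_trans ?_ h3.2⟩
        gcongr; linarith
      rw [if_pos h4]
      have : c a = ‖∑ y ∈ range H, g a y‖ := by
        simp only [hc]
        congr 1
        refine sum_congr rfl fun y hy => if_pos ⟨h3.1.trans_le ?_, (hmono y hy).trans h3.2⟩
        gcongr; linarith [(Nat.cast_nonneg y : (0 : ℝ) ≤ y)]
      linarith
    · have : c a = 0 := by
        simp only [hc, norm_eq_zero]
        refine sum_eq_zero fun y hy => if_neg ?_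
        rintro ⟨h4, h5⟩
        have hyH : (y : ℝ) < H := by exact_mod_cast mem_range.1 hy
        have hbH : (0 : ℝ) < b + H := by positivity
        have ha0 : (0 : ℝ) < a := by
          rcases (Nat.cast_nonneg a : (0 : ℝ) ≤ a).eq_or_lt with h | h
          · rw [← h] at h4; linarith
          · exact h
        rw [not_and_or, not_lt, not_le] at h3
        rcases h3 with h3 | h3
        · refine h1 (mem_filter.2 ⟨ha, ?_, (le_div_iff₀ hb0).2 h3⟩)
          rw [div_lt_iff₀ hbH]
          exact h4.trans_le (hmono y hy)
        · refine h2 (mem_filter.2 ⟨ha, ?_, (le_div_iff₀ hb0).2 (le_trans ?_ h5)⟩)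
          · rw [div_lt_iff₀ hbH]; exact h3
          · gcongr; linarith [(Nat.cast_nonneg y : (0 : ℝ) ≤ y)]
      linarith
  have hdiff : ∀ Q : ℝ, 0 ≤ Q → Q / b - Q / (b + H) ≤ Q * H / b ^ 2 := by
    intro Q hQ
    rw [div_sub_div _ _ hb0.ne' (by positivity), div_le_div_iff₀ (by positivity) (by positivity)]
    have : 0 ≤ Q * (H : ℝ) ^ 2 * b := by positivity
    linarith
  have hle : ∀ Q : ℝ, 0 ≤ Q → Q / (b + H) ≤ Q / b := by
    intro Q hQ
    gcongr; linarith [(Nat.cast_nonneg H : (0 : ℝ) ≤ H)]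
  have hMN : N ≤ M * N := le_mul_of_one_le_left hN.le hM
  have c1 : (B1.card : ℝ) ≤ M * N * H / b ^ 2 + 1 := by
    have h1 := card_le_of_forall_mem_Ioc (by positivity) (hle N hN.le) B1
      (fun a ha => (mem_filter.1 ha).2)
    have h2 := hdiff N hN.le
    have h3 : N * H / (b : ℝ) ^ 2 ≤ M * N * H / b ^ 2 := by gcongr
    linarith
  have c2 : (B2.card : ℝ) ≤ M * N * H / b ^ 2 + 1 := by
    have h1 := card_le_of_forall_mem_Ioc (by positivity) (hle (M * N) (by linarith)) B2
      (fun a ha => (mem_filter.1 ha).2)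
    have h2 := hdiff (M * N) (by linarith)
    linarith
  have hs : ∀ B : Finset ℕ, B ⊆ A → ∑ a ∈ A, (if a ∈ B then (H : ℝ) else 0) = H * B.card := by
    intro B hB
    rw [← sum_filter, filter_mem_eq_inter, inter_eq_right.2 hB, sum_const, nsmul_eq_mul, mul_comm]
  calc ∑ a ∈ A, c a ≤ _ := sum_le_sum hpt
    _ = (∑ a ∈ A.filter fun a : ℕ => N ≤ (a : ℝ) * b ∧ (a : ℝ) * b ≤ M * N, ‖∑ y ∈ range H, g a y‖) +
        H * B1.card + H * B2.card := by
      rw [sum_add_distrib, sum_add_distrib, hs B1 (filter_subset _ _), hs B2 (filter_subset _ _),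
        sum_filter]
    _ ≤ _ := by
      have := mul_le_mul_of_nonneg_left c1 (Nat.cast_nonneg (α := ℝ) H)
      have := mul_le_mul_of_nonneg_left c2 (Nat.cast_nonneg (α := ℝ) H)
      have e : (H : ℝ) * (2 * M * N * H / b ^ 2 + 2) =
        H * (M * N * H / b ^ 2 + 1) + H * (M * N * H / b ^ 2 + 1) := by ring
      linarith

theorem exists_forall_le_rpow (A : ℝ) {τ : ℝ} (hτ : 0 < τ) :
    ∃ N₁ ≥ (1 : ℝ), ∀ N ≥ N₁, A ≤ N ^ τ := by
  obtain ⟨N₁, h⟩ := ((tendsto_rpow_atTop hτ).eventually_ge_atTop A).exists_forall_of_atTop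
  exact ⟨max N₁ 1, le_max_right _ _, fun N hN => h N ((le_max_left _ _).trans hN)⟩

theorem half_le_floor {h : ℝ} (hh : 1 ≤ h) : h / 2 ≤ ⌊h⌋₊ := by
  have h1 := Nat.lt_floor_add_one h
  have h2 : (1 : ℝ) ≤ ⌊h⌋₊ := by exact_mod_cast Nat.le_floor (by exact_mod_cast hh)
  linarith

theorem rpow_div_two_pow_le {N γ : ℝ} (hN : 0 ≤ N) {H : ℕ} (hH : N ^ γ / 2 ≤ H) (n : ℕ) :
    N ^ (n * γ) / 2 ^ n ≤ (H : ℝ) ^ n := by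
  have : N ^ (n * γ) / 2 ^ n = (N ^ γ / 2) ^ n := by
    rw [div_pow, ← Real.rpow_mul_natCast hN, mul_comm]
  rw [this]
  gcongr

set_option maxHeartbeats 1000000 in
theorem exists_typeII_block_of_exponents {d : ℕ} (α θ : Fin (d + 1) → ℝ) (hθ : StrictMono θ)
    (hα : α (Fin.last d) ≠ 0) {Θ : ℝ} (hΘ : θ (Fin.last d) = Θ) (h0 : 0 ≤ Θ)
    (hnonint : ∀ z : ℤ, (z : ℝ) ≠ Θ) (m : ℕ) {M : ℝ} (hM : 1 ≤ M)
    {ρ τ : ℝ} (hρ : 0 ≤ ρ) (hτ : 0 < τ) :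
    ∃ C > (0 : ℝ), ∃ N₀ ≥ (1 : ℝ), ∀ N ≥ N₀, ∀ l β t : ℝ, t = l + Θ + ρ → 0 ≤ β →
      ρ + β ≤ 1 → l + Θ + τ ≤ (m + 2) * β →
      β + τ ≤ (m + 2) * (β - t / (m + 3)) →
      m * β + 1 + τ ≤ l + Θ + (m + 1) * (β - t / (m + 3)) →
      ρ * ((m + 2) * (m + 3)) + τ ≤ 1 - β → ρ * (m + 3) ≤ t →
      ∀ b : ℕ, (b : ℝ) = N ^ β → ∃ H : ℕ, 1 ≤ H ∧ H ≤ b ∧ (H : ℝ) * N ^ ρ ≤ b ∧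
        ∀ (A : Finset ℕ) (u v : ℕ → ℂ), (∀ a, ‖u a‖ ≤ 1) → (∀ y, ‖v y‖ ≤ 1) →
        ‖∑ y ∈ range H, ∑ a ∈ A, if N < (a : ℝ) * (b + y) ∧ (a : ℝ) * (b + y) ≤ M * N then
          u a * v (b + y) * expi (N ^ l * powSum α θ (a * (b + y))) else 0‖ ≤
          C * (N ^ (1 - ρ) * H / b) := by
  obtain ⟨C, hC, N₁, hN₁, hblock⟩ := exists_typeII_block α θ hθ hα (by rwa [hΘ])
    (by rwa [hΘ]) m hM hτ
  rw [hΘ] at hblock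
  obtain ⟨N₂, hN₂, hlarge⟩ := exists_forall_le_rpow (C * 2 ^ (m + 2)) hτ
  refine ⟨2 * C + 2 * M + 2, by positivity, max N₁ N₂, hN₁.trans (le_max_left _ _), ?_⟩
  intro N hN l β t ht hβ hρβ h1 h2 h3 h4 h5 b hb
  have hNN₁ : N₁ ≤ N := (le_max_left _ _).trans hN
  have hN1 : 1 ≤ N := hN₁.trans hNN₁
  have hN0 : 0 < N := by linarith
  have hCτ := hlarge N ((le_max_right _ _).trans hN)
  have hpow1 : (1 : ℝ) ≤ 2 ^ (m + 2) := one_le_pow₀ (by norm_num)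
  have hC1 : C ≤ N ^ τ := le_trans (le_mul_of_one_le_right hC.le hpow1) hCτ
  obtain ⟨γ, hγ⟩ : ∃ γ, γ = β - t / (m + 3) := ⟨_, rfl⟩
  rw [← hγ] at h2 h3
  have hm3 : (0 : ℝ) < m + 3 := by positivity
  have hρt : ρ ≤ t / (m + 3) := by rwa [le_div_iff₀ hm3]
  have hγ0 : 0 ≤ γ := by
    by_contra hneg
    have : (m + 2 : ℝ) * γ ≤ 0 := mul_nonpos_of_nonneg_of_nonpos (by positivity) (by linarith)
    linarith
  have hγβ : γ ≤ β - ρ := by linarith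
  have hh1 : 1 ≤ N ^ γ := Real.one_le_rpow hN1 hγ0
  set H := ⌊N ^ γ⌋₊ with hH
  have hHle : (H : ℝ) ≤ N ^ γ := Nat.floor_le (by positivity)
  have hHge : N ^ γ / 2 ≤ H := half_le_floor hh1
  have hH1 : 1 ≤ H := Nat.le_floor (by exact_mod_cast hh1)
  have hH0 : (0 : ℝ) < H := by exact_mod_cast hH1
  have hHρ : (H : ℝ) * N ^ ρ ≤ b := by
    calc (H : ℝ) * N ^ ρ ≤ N ^ γ * N ^ ρ := by gcongr
      _ = N ^ (γ + ρ) := (Real.rpow_add hN0 _ _).symm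
      _ ≤ N ^ β := Real.rpow_le_rpow_of_exponent_le hN1 (by linarith)
      _ = b := hb.symm
  have hHb : H ≤ b := by
    have : (H : ℝ) ≤ b := le_trans (le_mul_of_one_le_right hH0.le (Real.one_le_rpow hN1 hρ)) hHρ
    exact_mod_cast this
  have hb1 : 1 ≤ b := hH1.trans hHb
  have hb0 : (0 : ℝ) < b := by exact_mod_cast hb1
  have hlamΘ : N ^ l * N ^ Θ = N ^ (l + Θ) := (Real.rpow_add hN0 _ _).symm
  have hexp : ∀ x y : ℝ, x ≤ y → N ^ x ≤ N ^ y :=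
    fun x y h => Real.rpow_le_rpow_of_exponent_le hN1 h
  have hbpow : ∀ n : ℕ, (b : ℝ) ^ n = N ^ (n * β) := by
    intro n; rw [hb, ← Real.rpow_mul_natCast hN0.le, mul_comm]
  have c1 : C * (N ^ l * N ^ Θ) ≤ (b : ℝ) ^ (m + 2) := by
    rw [hlamΘ, hbpow]
    calc C * N ^ (l + Θ) ≤ N ^ τ * N ^ (l + Θ) := by gcongr
      _ = N ^ (τ + (l + Θ)) := (Real.rpow_add hN0 _ _).symm
      _ ≤ _ := hexp _ _ (by push_cast; linarith)
  have c2 : C * b ≤ (H : ℝ) ^ (m + 2) := by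
    refine le_trans ?_ (rpow_div_two_pow_le hN0.le hHge (m + 2))
    rw [le_div_iff₀ (by positivity), hb]
    calc C * N ^ β * 2 ^ (m + 2) = C * 2 ^ (m + 2) * N ^ β := by ring
      _ ≤ N ^ τ * N ^ β := by gcongr
      _ = N ^ (τ + β) := (Real.rpow_add hN0 _ _).symm
      _ ≤ _ := hexp _ _ (by push_cast; linarith)
  have c3 : C * ((b : ℝ) ^ m * N) ≤ N ^ l * N ^ Θ * (H : ℝ) ^ (m + 1) := by
    have e1 : (b : ℝ) ^ m * N = N ^ (m * β + 1) := by
      rw [hbpow, Real.rpow_add hN0, Real.rpow_one]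
    calc C * ((b : ℝ) ^ m * N) = C * 2 ^ (m + 1) * N ^ (m * β + 1) / 2 ^ (m + 1) := by
          rw [e1]; field_simp
      _ ≤ C * 2 ^ (m + 2) * N ^ (m * β + 1) / 2 ^ (m + 1) := by gcongr <;> norm_num
      _ ≤ N ^ τ * N ^ (m * β + 1) / 2 ^ (m + 1) := by gcongr
      _ = N ^ (τ + (m * β + 1)) / 2 ^ (m + 1) := by rw [← Real.rpow_add hN0]
      _ ≤ N ^ (l + Θ + (m + 1 : ℕ) * γ) / 2 ^ (m + 1) := by
          have := hexp (τ + (m * β + 1)) (l + Θ + (m + 1 : ℕ) * γ) (by push_cast; linarith)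
          gcongr
      _ = N ^ l * N ^ Θ * (N ^ ((m + 1 : ℕ) * γ) / 2 ^ (m + 1)) := by
          rw [Real.rpow_add hN0, hlamΘ, mul_div_assoc]
      _ ≤ _ := by
          have := rpow_div_two_pow_le hN0.le hHge (m + 1)
          gcongr
  refine ⟨H, hH1, hHb, hHρ, fun A u v hu hv => ?_⟩
  set A' := A.filter fun a : ℕ => N ≤ (a : ℝ) * b ∧ (a : ℝ) * b ≤ M * N with hA'
  have hmain := hblock N hNN₁ (N ^ l) (by positivity) b H hH1 hHb A'
    (fun a ha => (mem_filter.1 ha).2) c1 c2 c3 (fun y => v (b + y)) (fun y => hv _)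
  have hNρ : N ^ (1 - ρ) = N * N ^ (-ρ) := by
    rw [sub_eq_add_neg, Real.rpow_add hN0, Real.rpow_one]
  have b1 : ((H : ℝ) ^ τ * b / N) ^ ((1 : ℝ) / (2 * critExp (m + 2) : ℕ)) ≤ N ^ (-ρ) := by
    have e1 : ((2 * critExp (m + 2) : ℕ) : ℝ) = (m + 2) * (m + 3) := by
      rw [two_mul_critExp]; push_cast; ring
    rw [e1]
    have e2 : (H : ℝ) ^ τ * b / N ≤ N ^ (τ + β - 1) := by
      rw [Real.rpow_sub hN0, Real.rpow_one, Real.rpow_add hN0, ← hb]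
      have : (H : ℝ) ≤ N := hHle.trans <| (hexp γ 1 (by linarith)).trans (by rw [Real.rpow_one])
      gcongr
    have hp : (0 : ℝ) < (m + 2) * (m + 3) := by positivity
    calc _ ≤ (N ^ (τ + β - 1)) ^ ((1 : ℝ) / ((m + 2) * (m + 3))) := by gcongr
      _ = N ^ ((τ + β - 1) * ((1 : ℝ) / ((m + 2) * (m + 3)))) := by rw [← Real.rpow_mul hN0.le]
      _ ≤ _ := by
        refine hexp _ _ ?_
        rw [mul_one_div, div_le_iff₀ hp]
        linarith
  have b2 : N ^ l * N ^ Θ * ((H : ℝ) / b) ^ (m + 3) ≤ N ^ (-ρ) := by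
    have e1 : ((H : ℝ) / b) ≤ N ^ (-(t / (m + 3))) := by
      have : -(t / (m + 3)) = γ - β := by rw [hγ]; ring
      rw [this, Real.rpow_sub hN0, ← hb]
      gcongr
    calc N ^ l * N ^ Θ * ((H : ℝ) / b) ^ (m + 3)
        ≤ N ^ (l + Θ) * (N ^ (-(t / (m + 3)))) ^ (m + 3) := by rw [hlamΘ]; gcongr
      _ = N ^ (l + Θ + -(t / (m + 3)) * (m + 3 : ℕ)) := by
        rw [← Real.rpow_mul_natCast hN0.le, ← Real.rpow_add hN0]
      _ ≤ _ := by
        refine hexp _ _ ?_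
        have : -(t / (m + 3)) * (m + 3) = -t := by field_simp
        push_cast
        rw [this]; linarith
  have htr := sum_norm_truncated_le hM hN0 (H := H) hb1 A
    (fun a y => v (b + y) * expi (N ^ l * powSum α θ (a * (b + y))))
    (fun a y => by rw [norm_mul, norm_expi, mul_one]; exact hv _)
  have hlhs : ‖∑ y ∈ range H, ∑ a ∈ A,
      if N < (a : ℝ) * (b + y) ∧ (a : ℝ) * (b + y) ≤ M * N then
          u a * v (b + y) * expi (N ^ l * powSum α θ (a * (b + y))) else 0‖ ≤
      ∑ a ∈ A, ‖∑ y ∈ range H, if N < (a : ℝ) * (b + y) ∧ (a : ℝ) * (b + y) ≤ M * N then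
          v (b + y) * expi (N ^ l * powSum α θ (a * (b + y))) else 0‖ := by
    rw [sum_comm]
    refine (norm_sum_le _ _).trans (sum_le_sum fun a _ => ?_)
    have : ∑ y ∈ range H, (if N < (a : ℝ) * (b + y) ∧ (a : ℝ) * (b + y) ≤ M * N then
          u a * v (b + y) * expi (N ^ l * powSum α θ (a * (b + y))) else 0) =
        u a * ∑ y ∈ range H, if N < (a : ℝ) * (b + y) ∧ (a : ℝ) * (b + y) ≤ M * N then
          v (b + y) * expi (N ^ l * powSum α θ (a * (b + y))) else 0 := by
      rw [mul_sum]
      refine sum_congr rfl fun y _ => ?_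
      rw [mul_ite, mul_zero, mul_assoc]
    rw [this, norm_mul]
    exact mul_le_of_le_one_left (norm_nonneg _) (hu a)
  refine hlhs.trans (htr.trans ?_)
  have s1 : C * (N / b * H * (((H : ℝ) ^ τ * b / N) ^ ((1 : ℝ) / (2 * critExp (m + 2) : ℕ)) +
      N ^ l * N ^ Θ * ((H : ℝ) / b) ^ (m + 3))) ≤ C * (N / b * H * (N ^ (-ρ) + N ^ (-ρ))) := by
    gcongr
  have e1 : C * (N / b * H * (N ^ (-ρ) + N ^ (-ρ))) = 2 * C * (N ^ (1 - ρ) * H / b) := by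
    rw [hNρ]; ring
  have s2 : (H : ℝ) * (2 * M * N * H / b ^ 2) ≤ 2 * M * (N ^ (1 - ρ) * H / b) := by
    have : (H : ℝ) ≤ b * N ^ (-ρ) := by
      rw [Real.rpow_neg hN0.le, ← div_eq_mul_inv, le_div_iff₀ (by positivity)]
      exact hHρ
    calc (H : ℝ) * (2 * M * N * H / b ^ 2) ≤ (H : ℝ) * (2 * M * N * (b * N ^ (-ρ)) / b ^ 2) := by
          gcongr
      _ = _ := by rw [hNρ]; field_simp
  have s3 : (H : ℝ) * 2 ≤ 2 * (N ^ (1 - ρ) * H / b) := by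
    have : (b : ℝ) ≤ N ^ (1 - ρ) := by rw [hb]; exact hexp _ _ (by linarith)
    have h6 : 1 ≤ N ^ (1 - ρ) / b := by rwa [one_le_div hb0]
    calc (H : ℝ) * 2 = 2 * (1 * H) := by ring
      _ ≤ 2 * (N ^ (1 - ρ) / b * H) := by gcongr
      _ = _ := by ring
  linarith

theorem sum_Ico_inv_le {x y : ℕ} (hx : 1 ≤ x) {N : ℝ} (hy : (y : ℝ) ≤ N) (hN : 1 ≤ N) :
    ∑ b ∈ Ico x y, (1 / b : ℝ) ≤ 1 + Real.log N := by
  rcases Nat.eq_zero_or_pos y with h | h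
  · rw [h, Ico_eq_empty_of_le (Nat.zero_le x), sum_empty]
    linarith [Real.log_nonneg hN]
  have h1 := harmonic_le_one_add_log y
  rw [harmonic_eq_sum_Icc] at h1
  push_cast at h1
  have h2 : ∑ b ∈ Ico x y, (1 / b : ℝ) ≤ ∑ b ∈ Icc 1 y, (b : ℝ)⁻¹ := by
    simp_rw [one_div]
    refine sum_le_sum_of_subset_of_nonneg (fun b hb => ?_) (fun _ _ _ => by positivity)
    rw [mem_Ico] at hb
    exact mem_Icc.2 ⟨by omega, by omega⟩
  have h3 : Real.log y ≤ Real.log N := Real.log_le_log (by exact_mod_cast h) hy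
  linarith

theorem norm_sum_truncated_le {M N : ℝ} (hM : 1 ≤ M) (hN : 0 < N) {b : ℕ} (hb : 1 ≤ b)
    (A : Finset ℕ) (g : ℕ → ℂ) (hg : ∀ a, ‖g a‖ ≤ 1) :
    ‖∑ a ∈ A, if N < (a : ℝ) * b ∧ (a : ℝ) * b ≤ M * N then g a else 0‖ ≤ M * N / b := by
  rw [← sum_filter]
  refine (norm_sum_le _ _).trans ((sum_le_card_nsmul _ _ 1 fun a _ => hg a).trans ?_)
  rw [nsmul_eq_mul, mul_one]
  refine card_le_of_forall_mul_le (by exact_mod_cast hb) (by positivity) _ fun a ha => ?_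
  have := (mem_filter.1 ha).2
  exact ⟨hN.trans this.1, this.2⟩

set_option maxHeartbeats 1000000 in
theorem exists_typeII_bound_Ico {d : ℕ} (α θ : Fin (d + 1) → ℝ) (hθ : StrictMono θ)
    (hα : α (Fin.last d) ≠ 0) {Θ : ℝ} (hΘ : θ (Fin.last d) = Θ) (h3 : 3 < Θ)
    (hnonint : ∀ z : ℤ, (z : ℝ) ≠ Θ) {M : ℝ} (hM : 1 ≤ M) {D ρ τ : ℝ}
    (hD : D = 8 * Θ ^ 2 + 12 * Θ + 10) (hρ : ρ = 1 / D) (hτ : τ = ρ / 10 ^ 4) :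
    ∃ C > (0 : ℝ), ∃ N₀ ≥ (3 : ℝ), ∀ N ≥ N₀, ∀ l : ℝ, -ρ ≤ l → l ≤ τ → ∀ x y : ℕ,
      N ^ (1 / 2 : ℝ) ≤ x → (y : ℝ) ≤ N ^ (0.67 : ℝ) →
      ∀ (A : Finset ℕ) (u v : ℕ → ℂ), (∀ a, ‖u a‖ ≤ 1) → (∀ y, ‖v y‖ ≤ 1) →
      ‖∑ b ∈ Ico x y, ∑ a ∈ A, if N < (a : ℝ) * b ∧ (a : ℝ) * b ≤ M * N then
          u a * v b * expi (N ^ l * powSum α θ (a * b)) else 0‖ ≤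
          C * (N ^ (1 - ρ) * Real.log N) := by
  obtain ⟨hρ0, hρ1, hτ0, hτ1⟩ := rho_tau_bounds h3 hD hρ hτ
  have hblock := fun m : ℕ => exists_typeII_block_of_exponents α θ hθ hα hΘ (by linarith)
    hnonint m hM hρ0.le hτ0
  choose C hC N₁ hN₁ hblock using hblock
  set K := ⌊2 * Θ + 10⌋₊ + 1 with hK
  set C' := ∑ m ∈ range K, C m with hC'
  have hC'0 : 0 ≤ C' := sum_nonneg fun m _ => (hC m).le
  refine ⟨4 * C' + 2 * M, by positivity, ∑ m ∈ range K, N₁ m + 3, ?_, ?_⟩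
  · have : 0 ≤ ∑ m ∈ range K, N₁ m := sum_nonneg fun m _ => by linarith [hN₁ m]
    linarith
  intro N hN l hl hl' x y hx hy A u v hu hv
  have hNm : ∀ m ∈ range K, N₁ m ≤ N := by
    intro m hm
    have := single_le_sum (f := N₁) (fun m _ => by linarith [hN₁ m]) hm
    linarith
  have hN3 : 3 ≤ N := by
    have : 0 ≤ ∑ m ∈ range K, N₁ m := sum_nonneg fun m _ => by linarith [hN₁ m]
    linarith
  have hN1 : 1 < N := by linarith
  have hN0 : 0 < N := by linarith
  have hlog1 : 1 ≤ Real.log N := by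
    rw [Real.le_log_iff_exp_le hN0]
    exact Real.exp_one_lt_d9.le.trans (by linarith)
  have hR : 0 ≤ N ^ (1 - ρ) := by positivity
  rcases lt_or_ge y x with hyx | hxy
  · rw [Ico_eq_empty_of_le hyx.le, sum_empty, norm_zero]
    positivity
  have hx1 : 1 ≤ x := by
    have : (1 : ℝ) ≤ x := (Real.one_le_rpow hN1.le (by norm_num)).trans hx
    exact_mod_cast this
  have hex : ∀ b : ℕ, ∃ H : ℕ, x ≤ b → b < y → 1 ≤ H ∧ H ≤ b ∧ (H : ℝ) * N ^ ρ ≤ b ∧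
      ‖∑ i ∈ range H, ∑ a ∈ A, if N < (a : ℝ) * (b + i) ∧ (a : ℝ) * (b + i) ≤ M * N then
          u a * v (b + i) * expi (N ^ l * powSum α θ (a * (b + i))) else 0‖ ≤
          C' * (N ^ (1 - ρ) * H / b) := by
    intro b
    by_cases hxb : x ≤ b ∧ b < y
    swap
    · exact ⟨0, fun h1 h2 => absurd ⟨h1, h2⟩ hxb⟩
    have hb0 : (0 : ℝ) < b := by exact_mod_cast hx1.trans hxb.1
    have hbβ : N ^ (Real.logb N b) = b := Real.rpow_logb hN0 hN1.ne' hb0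
    have hbx : (x : ℝ) ≤ b := by exact_mod_cast hxb.1
    have hby : (b : ℝ) ≤ y := by exact_mod_cast hxb.2.le
    have hβ1 : 1 / 2 ≤ Real.logb N b := by
      rw [← Real.rpow_le_rpow_left_iff hN1, hbβ]; linarith
    have hβ2 : Real.logb N b ≤ 0.67 := by
      rw [← Real.rpow_le_rpow_left_iff hN1, hbβ]; linarith
    obtain ⟨m, hm, e1, e2, e3, e4, e5⟩ :=
      exists_typeII_exponents h3 hD hρ hτ hβ1 hβ2 hl hl' rfl
    have hmK : m ∈ range K := by
      rw [mem_range, hK, Nat.lt_succ_iff]; exact Nat.le_floor hm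
    obtain ⟨H, h1, h2, h3, h4⟩ := hblock m N (hNm m hmK) l (Real.logb N b) _ rfl (by linarith)
      (by linarith) e1 e2 e3 e4 e5 b hbβ.symm
    refine ⟨H, fun _ _ => ⟨h1, h2, h3, (h4 A u v hu hv).trans ?_⟩⟩
    have := single_le_sum (f := C) (fun m _ => (hC m).le) hmK
    gcongr
  choose L hL using hex
  have hNρ : N ^ (1 - ρ) * N ^ ρ = N := by
    rw [← Real.rpow_add hN0]; simp
  have key := norm_sum_Ico_le_of_blocks
    (fun b => ∑ a ∈ A, if N < (a : ℝ) * b ∧ (a : ℝ) * b ≤ M * N then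
          u a * v b * expi (N ^ l * powSum α θ (a * b)) else 0)
    (fun b => 2 * C' * N ^ (1 - ρ) * (1 / b)) L (E := M * N ^ (1 - ρ)) (by positivity)
    y (y - x) x rfl hxy (fun b h1 h2 => (hL b h1 h2).1) ?_ ?_ (fun b _ _ => by positivity)
  · rw [← mul_sum] at key
    refine key.trans ?_
    have hyN : (y : ℝ) ≤ N := hy.trans <| by
      conv_rhs => rw [← Real.rpow_one N]
      exact Real.rpow_le_rpow_of_exponent_le hN1.le (by norm_num)
    have hs : ∑ b ∈ Ico x y, (1 / b : ℝ) ≤ 2 * Real.log N :=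
      (sum_Ico_inv_le hx1 hyN hN1.le).trans (by linarith)
    have h1 := mul_le_mul_of_nonneg_left hs (by positivity : 0 ≤ 2 * C' * N ^ (1 - ρ))
    have h2 := mul_le_mul_of_nonneg_left hlog1 (by positivity : 0 ≤ M * N ^ (1 - ρ))
    have h3 : 0 ≤ M * N ^ (1 - ρ) * Real.log N := by positivity
    linarith
  · intro b hxb hby hfit
    obtain ⟨h1, h2, h3, h4⟩ := hL b hxb hby
    have hb0 : (0 : ℝ) < b := by exact_mod_cast hx1.trans hxb
    rw [sum_Ico_eq_sum_range, Nat.add_sub_cancel_left]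
    push_cast
    refine h4.trans ?_
    rw [sum_Ico_eq_sum_range, Nat.add_sub_cancel_left]
    calc C' * (N ^ (1 - ρ) * L b / b) = ∑ i ∈ range (L b), C' * (N ^ (1 - ρ) / b) := by
          rw [sum_const, card_range, nsmul_eq_mul]; ring
      _ ≤ _ := by
        refine sum_le_sum fun i hi => ?_
        have hi' : (i : ℝ) ≤ b := by exact_mod_cast (mem_range.1 hi).le.trans h2
        have : 1 / (b : ℝ) ≤ 2 * (1 / ((b + i : ℕ) : ℝ)) := by
          push_cast
          rw [mul_one_div, div_le_div_iff₀ hb0 (by positivity)]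
          linarith
        have := mul_le_mul_of_nonneg_left this (by positivity : 0 ≤ C' * N ^ (1 - ρ))
        rw [div_eq_mul_one_div]
        linarith
  · intro b hxb hby hsh
    obtain ⟨h1, h2, h3, h4⟩ := hL b hxb hby
    have hb0 : (0 : ℝ) < b := by exact_mod_cast hx1.trans hxb
    calc _ ≤ ∑ i ∈ Ico b y, M * N / b := by
          refine (norm_sum_le _ _).trans (sum_le_sum fun i hi => ?_)
          rw [mem_Ico] at hi
          refine (norm_sum_truncated_le hM hN0 (by omega) A
            (fun a => u a * v i * expi (N ^ l * powSum α θ (a * i))) fun a => ?_).trans ?_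
          · rw [norm_mul, norm_mul, norm_expi, mul_one]
            exact mul_le_one₀ (hu a) (norm_nonneg _) (hv i)
          · have : (b : ℝ) ≤ i := by exact_mod_cast hi.1
            gcongr
      _ = (y - b : ℕ) * (M * N / b) := by rw [sum_const, Nat.card_Ico, nsmul_eq_mul]
      _ ≤ L b * (M * N / b) := by
          have : ((y - b : ℕ) : ℝ) ≤ L b := by exact_mod_cast (by omega : y - b ≤ L b)
          gcongr
      _ = M * N ^ (1 - ρ) * ((L b * N ^ ρ) / b) := by
          conv_lhs => rw [← hNρ]
          ring
      _ ≤ M * N ^ (1 - ρ) * 1 := by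
          have := (div_le_one hb0).2 h3
          gcongr
      _ = _ := mul_one _

theorem sum_eq_sum_Ico_ite (B : Finset ℕ) (G : ℕ → ℂ) (x y : ℕ)
    (h : ∀ b ∈ B, G b ≠ 0 → x ≤ b ∧ b < y) :
    ∑ b ∈ B, G b = ∑ b ∈ Ico x y, if b ∈ B then G b else 0 := by
  rw [← sum_filter, ← sum_filter_add_sum_filter_not B (fun b => x ≤ b ∧ b < y)]
  have h1 : ∑ b ∈ B with ¬(x ≤ b ∧ b < y), G b = 0 := by
    refine sum_eq_zero fun b hb => ?_
    obtain ⟨hb, hn⟩ := mem_filter.1 hb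
    by_contra hne
    exact hn (h b hb hne)
  rw [h1, add_zero]
  refine sum_congr ?_ fun _ _ => rfl
  ext b
  simp only [mem_filter, mem_Ico]
  tauto

/-- The summand of a bilinear exponential sum restricted to `N < a b ≤ M N`. -/
def bilinTerm (M N : ℝ) (g : ℝ → ℝ) (u v : ℕ → ℂ) (a b : ℕ) : ℂ :=
  if N < (a : ℝ) * b ∧ (a : ℝ) * b ≤ M * N then u a * v b * expi (g (a * b)) else 0

theorem bilinTerm_swap (M N : ℝ) (g : ℝ → ℝ) (u v : ℕ → ℂ) (a b : ℕ) :
    bilinTerm M N g u v a b = bilinTerm M N g v u b a := by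
  simp only [bilinTerm, mul_comm (a : ℝ) b, mul_comm (u a)]

theorem ite_bilinTerm (M N : ℝ) (g : ℝ → ℝ) (u v : ℕ → ℂ) (B : Finset ℕ) (a b : ℕ) :
    (if b ∈ B then bilinTerm M N g u v a b else 0) =
      bilinTerm M N g u (fun b => if b ∈ B then v b else 0) a b := by
  by_cases h : b ∈ B <;> simp [bilinTerm, h]

theorem bilinTerm_ne_zero {M N : ℝ} {g : ℝ → ℝ} {u v : ℕ → ℂ} {a b : ℕ}
    (h : bilinTerm M N g u v a b ≠ 0) :
    N < (a : ℝ) * b ∧ (a : ℝ) * b ≤ M * N ∧ u a ≠ 0 ∧ v b ≠ 0 := by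
  unfold bilinTerm at h
  split_ifs at h with hc
  · exact ⟨hc.1, hc.2, fun h0 => h (by simp [h0]), fun h0 => h (by simp [h0])⟩
  · exact absurd rfl h

theorem exists_typeII_bound {d : ℕ} (α θ : Fin (d + 1) → ℝ) (hθ : StrictMono θ)
    (hα : α (Fin.last d) ≠ 0) {Θ : ℝ} (hΘ : θ (Fin.last d) = Θ) (h3 : 3 < Θ)
    (hnonint : ∀ z : ℤ, (z : ℝ) ≠ Θ) {M : ℝ} (hM : 1 ≤ M) {D ρ τ : ℝ}
    (hD : D = 8 * Θ ^ 2 + 12 * Θ + 10) (hρ : ρ = 1 / D) (hτ : τ = ρ / 10 ^ 4) :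
    ∃ C > (0 : ℝ), ∃ N₀ ≥ (3 : ℝ), ∀ N ≥ N₀, ∀ l : ℝ, -ρ ≤ l → l ≤ τ →
      ∀ (A B : Finset ℕ) (u v : ℕ → ℂ), (∀ a, ‖u a‖ ≤ 1) → (∀ y, ‖v y‖ ≤ 1) →
      (∀ a : ℕ, (a : ℝ) ≤ N ^ (1 / 3 : ℝ) → u a = 0) →
      (∀ b : ℕ, (b : ℝ) ≤ N ^ (1 / 3 : ℝ) → v b = 0) →
      ‖∑ b ∈ B, ∑ a ∈ A, bilinTerm M N (fun x => N ^ l * powSum α θ x) u v a b‖ ≤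
          C * (N ^ (1 - ρ) * Real.log N) := by
  obtain ⟨C, hC, N₁, hN₁, hb⟩ := exists_typeII_bound_Ico α θ hθ hα hΘ h3 hnonint hM hD hρ hτ
  obtain ⟨N₂, hN₂, hlarge⟩ := exists_forall_le_rpow (2 * M) (by norm_num : (0 : ℝ) < 1 / 300)
  refine ⟨2 * C, by positivity, max N₁ N₂, hN₁.trans (le_max_left _ _), ?_⟩
  intro N hN l hl hl' A B u v hu hv hu0 hv0
  have hNN₁ : N₁ ≤ N := (le_max_left _ _).trans hN
  have hN3 : 3 ≤ N := hN₁.trans hNN₁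
  have hN0 : 0 < N := by linarith
  have hM2 := hlarge N ((le_max_right _ _).trans hN)
  set g : ℝ → ℝ := fun x => N ^ l * powSum α θ x with hg
  set s := ⌈N ^ (1 / 2 : ℝ)⌉₊ with hs
  set Y := ⌊N ^ (0.67 : ℝ)⌋₊ with hY
  have hYle : (Y : ℝ) ≤ N ^ (0.67 : ℝ) := Nat.floor_le (by positivity)
  have hsge : N ^ (1 / 2 : ℝ) ≤ s := Nat.le_ceil _
  have hsq : N ^ (1 / 2 : ℝ) * N ^ (1 / 2 : ℝ) = N := by
    rw [← Real.rpow_add hN0]; norm_num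
  have hsmall : ∀ a b : ℕ, N ^ (1 / 3 : ℝ) < a → (a : ℝ) * b ≤ M * N → b < Y := by
    intro a b ha hab
    rw [hY, ← Nat.add_one_le_iff]
    refine Nat.le_floor ?_
    push_cast
    have e1 : N ^ (1 / 3 : ℝ) * N ^ (2 / 3 : ℝ) = N := by
      rw [← Real.rpow_add hN0]; norm_num
    have h1 : (b : ℝ) ≤ M * N ^ (2 / 3 : ℝ) := by
      refine le_of_mul_le_mul_left ?_ (by positivity : 0 < N ^ (1 / 3 : ℝ))
      calc N ^ (1 / 3 : ℝ) * b ≤ a * b := by gcongr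
        _ ≤ M * N := hab
        _ = _ := by rw [mul_left_comm, e1]
    have h2 : 1 ≤ M * N ^ (2 / 3 : ℝ) :=
      one_le_mul_of_one_le_of_one_le hM (Real.one_le_rpow (by linarith) (by norm_num))
    calc (b : ℝ) + 1 ≤ 2 * M * N ^ (2 / 3 : ℝ) := by linarith
      _ ≤ N ^ (1 / 300 : ℝ) * N ^ (2 / 3 : ℝ) := by gcongr
      _ = N ^ (0.67 : ℝ) := by rw [← Real.rpow_add hN0]; norm_num
  have hbt : ∀ (A : Finset ℕ) (u v : ℕ → ℂ), (∀ a, ‖u a‖ ≤ 1) → (∀ y, ‖v y‖ ≤ 1) →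
      ‖∑ b ∈ Ico s Y, ∑ a ∈ A, bilinTerm M N g u v a b‖ ≤ C * (N ^ (1 - ρ) * Real.log N) :=
    fun A u v hu hv => hb N hNN₁ l hl hl' s Y hsge hYle A u v hu hv
  have hcut : ∀ (v : ℕ → ℂ) (B : Finset ℕ), (∀ y, ‖v y‖ ≤ 1) →
      ∀ y, ‖(fun b => if b ∈ B then v b else 0) y‖ ≤ 1 := by
    intro v B hv y
    by_cases h : y ∈ B <;> simp [h, hv y]
  have hI : ∀ (A B : Finset ℕ) (u v : ℕ → ℂ), (∀ a, ‖u a‖ ≤ 1) → (∀ y, ‖v y‖ ≤ 1) →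
      (∀ a : ℕ, (a : ℝ) ≤ N ^ (1 / 3 : ℝ) → u a = 0) →
      (∀ b ∈ B, ∀ a ∈ A, bilinTerm M N g u v a b ≠ 0 → s ≤ b) →
      ‖∑ b ∈ B, ∑ a ∈ A, bilinTerm M N g u v a b‖ ≤ C * (N ^ (1 - ρ) * Real.log N) := by
    intro A B u v hu hv hu0 hs'
    rw [sum_eq_sum_Ico_ite B _ s Y]
    · refine le_trans (le_of_eq ?_) (hbt A u (fun b => if b ∈ B then v b else 0) hu (hcut v B hv))
      congr 1
      refine sum_congr rfl fun b _ => ?_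
      simp_rw [← ite_bilinTerm]
      split_ifs <;> simp
    · intro b hbB hne
      obtain ⟨a, haA, hne⟩ := exists_ne_zero_of_sum_ne_zero hne
      obtain ⟨h1, h2, h3, h4⟩ := bilinTerm_ne_zero hne
      refine ⟨hs' b hbB a haA hne, hsmall a b ?_ h2⟩
      by_contra hle
      exact h3 (hu0 a (not_lt.1 hle))
  rw [← sum_filter_add_sum_filter_not B (fun b => s ≤ b)]
  refine (norm_add_le _ _).trans ?_
  have i1 := hI A (B.filter fun b => s ≤ b) u v hu hv hu0
    (fun b hb _ _ _ => (mem_filter.1 hb).2)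
  have i2 := hI (B.filter fun b => ¬ s ≤ b) A v u hv hu hv0 (fun a _ b hb hne => by
    have hbs := (mem_filter.1 hb).2
    rw [← bilinTerm_swap] at hne
    obtain ⟨h1, h2, h3, h4⟩ := bilinTerm_ne_zero hne
    rw [not_le, hs, Nat.lt_ceil] at hbs
    refine Nat.ceil_le.2 ?_
    by_contra hlt
    rw [not_le] at hlt
    have : (a : ℝ) * b ≤ N ^ (1 / 2 : ℝ) * N ^ (1 / 2 : ℝ) := by gcongr
    linarith)
  rw [sum_comm] at i2
  simp_rw [← bilinTerm_swap M N g u v] at i2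
  linarith

theorem norm_sum_Ico_le_sub {Φ : ℕ → ℂ} (hΦ : ∀ i, ‖Φ i‖ ≤ 1) (x y : ℕ) :
    ‖∑ i ∈ Ico x y, Φ i‖ ≤ ((y - x : ℕ) : ℝ) := by
  refine (norm_sum_le _ _).trans ((sum_le_card_nsmul _ _ 1 fun a _ => hΦ a).trans ?_)
  simp

theorem norm_sum_Ico_mul_le (Φ : ℕ → ℂ) (H p n : ℕ) :
    ‖∑ i ∈ Ico (H * p) (H * (p + n)), Φ i‖ ≤
      ∑ q ∈ Ico p (p + n), ‖∑ i ∈ range H, Φ (H * q + i)‖ := by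
  induction n with
  | zero => simp
  | succ n ih =>
    have h1 : H * p ≤ H * (p + n) := by gcongr; omega
    have h2 : H * (p + n) ≤ H * (p + (n + 1)) := by gcongr; omega
    rw [← sum_Ico_consecutive Φ h1 h2, ← add_assoc p n 1, sum_Ico_succ_top (by omega)]
    refine (norm_add_le _ _).trans (add_le_add ih (le_of_eq ?_))
    rw [sum_Ico_eq_sum_range]
    congr 3
    rw [mul_add, mul_one, Nat.add_sub_cancel_left]

theorem exists_multiples_block {Φ : ℕ → ℂ} (hΦ : ∀ i, ‖Φ i‖ ≤ 1) {H : ℕ} (hH : 1 ≤ H) (x y : ℕ) :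
    ∃ S : Finset ℕ, (∀ b ∈ S, H ∣ b ∧ x ≤ b ∧ b < y) ∧
      ‖∑ i ∈ Ico x y, Φ i‖ ≤ ∑ b ∈ S, ‖∑ i ∈ range H, Φ (b + i)‖ + 2 * H := by
  classical
  rcases lt_or_ge y x with hyx | hxy
  · exact ⟨∅, by simp, by rw [Ico_eq_empty_of_le hyx.le]; simp⟩
  obtain ⟨p, hp⟩ : ∃ p, p = (x + H - 1) / H := ⟨_, rfl⟩
  obtain ⟨r, hr⟩ : ∃ r, r = y / H := ⟨_, rfl⟩
  have p1 : x ≤ H * p := by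
    have := Nat.lt_mul_div_succ (x + H - 1) (by omega : 0 < H)
    rw [← hp, mul_add] at this
    omega
  have p2 : H * p ≤ x + H - 1 := by rw [hp]; exact Nat.mul_div_le _ _
  have r1 : H * r ≤ y := by rw [hr]; exact Nat.mul_div_le _ _
  have r2 : y < H * r + H := by
    have := Nat.lt_mul_div_succ y (by omega : 0 < H)
    rwa [← hr, mul_add, mul_one] at this
  by_cases hpr : p ≤ r
  · refine ⟨(Ico p r).image (H * ·), ?_, ?_⟩
    · intro b hb
      obtain ⟨q, hq, rfl⟩ := mem_image.1 hb
      rw [mem_Ico] at hq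
      have h1 : H * p ≤ H * q := by gcongr; exact hq.1
      have h2 : H * q < H * r := by gcongr; exact hq.2
      exact ⟨dvd_mul_right _ _, p1.trans h1, by omega⟩
    · rw [sum_image fun a _ b _ hab => Nat.eq_of_mul_eq_mul_left hH hab]
      have hprH : H * p ≤ H * r := by gcongr
      rw [← sum_Ico_consecutive Φ (p1.trans hprH) r1, ← sum_Ico_consecutive Φ p1 hprH]
      have h1 := norm_sum_Ico_mul_le Φ H p (r - p)
      rw [show p + (r - p) = r by omega] at h1
      have h2 := norm_sum_Ico_le_sub hΦ x (H * p)
      have h3 := norm_sum_Ico_le_sub hΦ (H * r) y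
      have h4 : ((H * p - x : ℕ) : ℝ) ≤ H := by exact_mod_cast (by omega : H * p - x ≤ H)
      have h5 : ((y - H * r : ℕ) : ℝ) ≤ H := by exact_mod_cast (by omega : y - H * r ≤ H)
      have h6 := norm_add_le (∑ i ∈ Ico x (H * p), Φ i + ∑ i ∈ Ico (H * p) (H * r), Φ i)
        (∑ i ∈ Ico (H * r) y, Φ i)
      have h7 := norm_add_le (∑ i ∈ Ico x (H * p), Φ i) (∑ i ∈ Ico (H * p) (H * r), Φ i)
      linarith
  · refine ⟨∅, by simp, ?_⟩
    have h1 : H * (r + 1) ≤ H * p := by gcongr; omega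
    have h2 := norm_sum_Ico_le_sub hΦ x y
    have h4 : ((y - x : ℕ) : ℝ) ≤ H := by
      rw [mul_add] at h1
      exact_mod_cast (by omega : y - x ≤ H)
    simp only [sum_empty, zero_add]
    have : (0 : ℝ) ≤ H := by positivity
    linarith

set_option maxHeartbeats 1000000 in
theorem exists_typeI_bound {d : ℕ} (α θ : Fin (d + 1) → ℝ) (hθ : StrictMono θ)
    (hα : α (Fin.last d) ≠ 0) {Θ : ℝ} (hΘ : θ (Fin.last d) = Θ) (h3 : 3 < Θ)
    (hnonint : ∀ z : ℤ, (z : ℝ) ≠ Θ) {M : ℝ} (hM : 1 ≤ M) {D ρ τ : ℝ}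
    (hD : D = 8 * Θ ^ 2 + 12 * Θ + 10) (hρ : ρ = 1 / D) (hτ : τ = ρ / 10 ^ 4) :
    ∃ C > (0 : ℝ), ∃ N₀ ≥ (3 : ℝ), ∀ N ≥ N₀, ∀ l : ℝ, -ρ ≤ l → l ≤ τ →
      ∀ a : ℕ, 1 ≤ a → (a : ℝ) ≤ N ^ (1 / 3 : ℝ) → ∀ x y : ℕ,
      (∀ b ∈ Ico x y, N < (a : ℝ) * b ∧ (a : ℝ) * b ≤ M * N) →
      ‖∑ b ∈ Ico x y, expi (N ^ l * powSum α θ (a * b))‖ ≤ C * (N ^ (1 - ρ) / a) := by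
  obtain ⟨hρ0, hρ1, hτ0, hτ1⟩ := rho_tau_bounds h3 hD hρ hτ
  obtain ⟨m, hm⟩ := exists_typeI_exponents h3 hD hρ hτ
  obtain ⟨C, hC, N₁, hN₁, hblock⟩ := exists_typeI_block α θ hθ hα (by rw [hΘ]; linarith)
    (by rwa [hΘ]) m hM hτ0
  rw [hΘ] at hblock
  obtain ⟨N₂, hN₂, hlarge⟩ := exists_forall_le_rpow (max C (2 ^ (m + 2))) hτ0
  refine ⟨2 * C + 2, by positivity, max N₁ N₂ + 3, ?_, ?_⟩
  · have := hN₂.trans (le_max_right N₁ N₂); linarith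
  intro N hN l hl hl' a ha ha' x y hxy
  have hNN₁ : N₁ ≤ N := by have := le_max_left N₁ N₂; linarith
  have hN1 : 1 ≤ N := hN₁.trans hNN₁
  have hN0 : 0 < N := by linarith
  have hl1 := hlarge N (by have := le_max_right N₁ N₂; linarith)
  have hCτ : C ≤ N ^ τ := (le_max_left _ _).trans hl1
  have h2τ : 2 ^ (m + 2) ≤ N ^ τ := (le_max_right _ _).trans hl1
  obtain ⟨t, ht⟩ : ∃ t, t = l + Θ + ρ := ⟨_, rfl⟩
  obtain ⟨q1, q2, q3, q4⟩ := hm l t hl hl' ht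
  have ha0 : (0 : ℝ) < a := by exact_mod_cast ha
  have hexp : ∀ x y : ℝ, x ≤ y → N ^ x ≤ N ^ y :=
    fun x y h => Real.rpow_le_rpow_of_exponent_le hN1 h
  obtain ⟨P, hP⟩ : ∃ P, P = N / a := ⟨_, rfl⟩
  have hP0 : 0 < P := by rw [hP]; positivity
  have hP23 : N ^ (2 / 3 : ℝ) ≤ P := by
    rw [hP, le_div_iff₀ ha0]
    calc N ^ (2 / 3 : ℝ) * a ≤ N ^ (2 / 3 : ℝ) * N ^ (1 / 3 : ℝ) := by gcongr
      _ = N := by rw [← Real.rpow_add hN0]; norm_num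
  have hPN : P ≤ N := by rw [hP]; exact div_le_self hN0.le (by exact_mod_cast ha)
  obtain ⟨γ, hγ⟩ : ∃ γ, γ = t / (m + 2) := ⟨_, rfl⟩
  rw [← hγ] at q2 q3
  have hm2 : (0 : ℝ) < m + 2 := by positivity
  have hργ : ρ ≤ γ := by rw [hγ]; rwa [le_div_iff₀ hm2]
  have hγm : γ * (m + 2) = t := by rw [hγ]; field_simp
  set h := P * N ^ (-γ) with hh
  have hh4 : 4 ≤ h := by
    calc (4 : ℝ) = 2 ^ 2 := by norm_num
      _ ≤ 2 ^ (m + 2) := pow_le_pow_right₀ (by norm_num) (by omega)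
      _ ≤ N ^ τ := h2τ
      _ ≤ N ^ (2 / 3 + -γ) := hexp _ _ (by linarith)
      _ = N ^ (2 / 3 : ℝ) * N ^ (-γ) := Real.rpow_add hN0 _ _
      _ ≤ h := by rw [hh]; gcongr
  set H := ⌊h⌋₊ with hH
  have hHle : (H : ℝ) ≤ h := Nat.floor_le (by linarith)
  have hHge : h / 2 ≤ H := half_le_floor (by linarith)
  have hH2 : 2 ≤ H := Nat.le_floor (by push_cast; linarith)
  have hH0 : (0 : ℝ) < H := by positivity
  have hγ1 : N ^ (-γ) ≤ 1 := Real.rpow_le_one_of_one_le_of_nonpos hN1 (by linarith)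
  have hHP : (H : ℝ) ≤ P := hHle.trans (mul_le_of_le_one_right hP0.le hγ1)
  have hNγ : N ^ γ * N ^ (-γ) = 1 := by rw [← Real.rpow_add hN0]; simp
  have hN0γ : 0 < N ^ γ := by positivity
  have hr1 : N ^ γ ≤ P / H := by
    rw [le_div_iff₀ hH0]
    calc N ^ γ * H ≤ N ^ γ * h := by gcongr
      _ = P := by rw [hh, mul_left_comm, hNγ, mul_one]
  have hr2 : P / H ≤ 2 * N ^ γ := by
    rw [div_le_iff₀ hH0]
    calc P = 2 * N ^ γ * (h / 2) := by
          have : N ^ γ * h = P := by rw [hh, mul_left_comm, hNγ, mul_one]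
          linarith
      _ ≤ _ := by gcongr
  have hlamΘ : N ^ l * N ^ Θ = N ^ (l + Θ) := (Real.rpow_add hN0 _ _).symm
  have hγpow : (N ^ γ) ^ (m + 2) = N ^ t := by
    rw [← Real.rpow_mul_natCast hN0.le]
    congr 1
    push_cast
    exact hγm
  obtain ⟨W, hW⟩ : ∃ W, W = (N / a / H) ^ (m + 2) / (N ^ l * N ^ Θ) := ⟨_, rfl⟩
  have hNt : N ^ t / N ^ (l + Θ) = N ^ ρ := by
    rw [← Real.rpow_sub hN0]; congr 1; rw [ht]; ring
  have hW1 : N ^ ρ ≤ W := by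
    rw [hW, ← hP, hlamΘ, ← hNt, ← hγpow]
    gcongr
  have hW2 : W ≤ 2 ^ (m + 2) * N ^ ρ := by
    rw [hW, ← hP, hlamΘ, ← hNt, ← hγpow, ← mul_div_assoc, ← mul_pow]
    gcongr
  have hW0 : 0 < W := lt_of_lt_of_le (by positivity) hW1
  have c1 : C * (N ^ l * N ^ Θ) ≤ (N / a) ^ (m + 1) := by
    rw [← hP, hlamΘ]
    calc C * N ^ (l + Θ) ≤ N ^ τ * N ^ (l + Θ) := by gcongr
      _ = N ^ (τ + (l + Θ)) := (Real.rpow_add hN0 _ _).symm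
      _ ≤ N ^ ((2 / 3 : ℝ) * (m + 1 : ℕ)) := hexp _ _ (by push_cast; linarith)
      _ = (N ^ (2 / 3 : ℝ)) ^ (m + 1) := Real.rpow_mul_natCast hN0.le _ _
      _ ≤ _ := by gcongr
  obtain ⟨S, hS, hle⟩ := exists_multiples_block
    (Φ := fun b : ℕ => expi (N ^ l * powSum α θ (a * b))) (fun b => (norm_expi _).le)
    (by omega : 1 ≤ H) x y
  have hmain := hblock N hNN₁ (N ^ l) (by positivity) a H ha hH2 S
    (fun b hb => by
      obtain ⟨h1, h2, h3⟩ := hS b hb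
      have := hxy b (mem_Ico.2 ⟨h2, h3⟩)
      exact ⟨h1, this.1.le, this.2⟩)
    (by rwa [← hP]) c1 W hW ((Real.one_le_rpow hN1 hρ0.le).trans hW1) (fun _ => 1)
    (fun _ => by simp)
  simp only [one_mul] at hmain
  push_cast at hle
  have hNρ : N ^ (1 - ρ) / a = P * N ^ (-ρ) := by
    rw [sub_eq_add_neg, Real.rpow_add hN0, Real.rpow_one, hP]; ring
  have b1 : (W * (H : ℝ) ^ (1 + τ) / (N / a)) ^ ((1 : ℝ) / (2 * critExp (m + 1) : ℕ)) ≤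
      N ^ (-ρ) := by
    have e1 : ((2 * critExp (m + 1) : ℕ) : ℝ) = (m + 1) * (m + 2) := by
      rw [two_mul_critExp]; push_cast; ring
    rw [e1, ← hP]
    have e2 : W * (H : ℝ) ^ (1 + τ) / P ≤ N ^ (τ + ρ + -γ + τ) := by
      rw [div_le_iff₀ hP0, Real.rpow_add hH0, Real.rpow_one]
      have hHτ : (H : ℝ) ^ τ ≤ N ^ τ := by
        have : (H : ℝ) ≤ N := hHP.trans hPN
        gcongr
      calc W * (H * (H : ℝ) ^ τ) ≤ (N ^ τ * N ^ ρ) * ((P * N ^ (-γ)) * N ^ τ) := by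
            have : W ≤ N ^ τ * N ^ ρ := hW2.trans (by gcongr)
            gcongr
        _ = N ^ τ * N ^ ρ * N ^ (-γ) * N ^ τ * P := by ring
        _ = _ := by rw [← Real.rpow_add hN0, ← Real.rpow_add hN0, ← Real.rpow_add hN0]
    have hp : (0 : ℝ) < (m + 1) * (m + 2) := by positivity
    calc _ ≤ (N ^ (τ + ρ + -γ + τ)) ^ ((1 : ℝ) / ((m + 1) * (m + 2))) := by gcongr
      _ = N ^ ((τ + ρ + -γ + τ) * ((1 : ℝ) / ((m + 1) * (m + 2)))) := by
        rw [← Real.rpow_mul hN0.le]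
      _ ≤ _ := by
        refine hexp _ _ ?_
        rw [mul_one_div, div_le_iff₀ hp]
        linarith
  have b2 : 1 / W ≤ N ^ (-ρ) := by
    rw [Real.rpow_neg hN0.le, one_div]
    gcongr
  have s1 : C * (N / a * ((W * (H : ℝ) ^ (1 + τ) / (N / a)) ^
      ((1 : ℝ) / (2 * critExp (m + 1) : ℕ)) + 1 / W)) ≤ C * (P * (N ^ (-ρ) + N ^ (-ρ))) := by
    rw [← hP] at b1 ⊢
    gcongr
  have s2 : (H : ℝ) ≤ P * N ^ (-ρ) := by
    refine hHle.trans ?_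
    rw [hh]
    have := hexp (-γ) (-ρ) (by linarith)
    gcongr
  rw [hNρ]
  linarith

theorem sum_Ico_mul_eq_sub (w : ℕ → ℝ) (Φ : ℕ → ℂ) {x y : ℕ} (hxy : x ≤ y) :
    ∑ b ∈ Ico x y, (w b : ℂ) * Φ b = w y * ∑ b ∈ Ico x y, Φ b -
      ∑ b ∈ Ico x y, ((w (b + 1) - w b : ℝ) : ℂ) * ∑ i ∈ Ico x (b + 1), Φ i := by
  induction y, hxy using Nat.le_induction with
  | base => simp
  | succ y hxy ih =>
    rw [sum_Ico_succ_top hxy, sum_Ico_succ_top hxy (fun b => ((w (b + 1) - w b : ℝ) : ℂ) * _), ih,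
      sum_Ico_succ_top hxy]
    push_cast
    ring

theorem norm_sum_Ico_monotone_mul_le {w : ℕ → ℝ} (hw : Monotone w) (hw0 : ∀ n, 0 ≤ w n)
    {Φ : ℕ → ℂ} {x y : ℕ} {B : ℝ} (hB : ∀ z ≤ y, ‖∑ i ∈ Ico x z, Φ i‖ ≤ B) :
    ‖∑ b ∈ Ico x y, (w b : ℂ) * Φ b‖ ≤ 2 * w y * B := by
  have hB0 : 0 ≤ B := (norm_nonneg _).trans (hB y le_rfl)
  rcases lt_or_ge y x with hyx | hxy
  · rw [Ico_eq_empty_of_le hyx.le, sum_empty, norm_zero]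
    have := hw0 y
    positivity
  rw [sum_Ico_mul_eq_sub w Φ hxy]
  have h1 : ‖(w y : ℂ) * ∑ b ∈ Ico x y, Φ b‖ ≤ w y * B := by
    rw [norm_mul, Complex.norm_real, Real.norm_of_nonneg (hw0 y)]
    exact mul_le_mul_of_nonneg_left (hB y le_rfl) (hw0 y)
  have h2 : ‖∑ b ∈ Ico x y, ((w (b + 1) - w b : ℝ) : ℂ) * ∑ i ∈ Ico x (b + 1), Φ i‖ ≤
      ∑ b ∈ Ico x y, (w (b + 1) - w b) * B := by
    refine (norm_sum_le _ _).trans (sum_le_sum fun b hb => ?_)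
    have h0 : 0 ≤ w (b + 1) - w b := sub_nonneg.2 (hw (Nat.le_succ b))
    rw [norm_mul, Complex.norm_real, Real.norm_of_nonneg h0]
    exact mul_le_mul_of_nonneg_left (hB _ (mem_Ico.1 hb).2) h0
  rw [← sum_mul, sum_Ico_sub w hxy] at h2
  have h3 := mul_nonneg (hw0 x) hB0
  have h4 := norm_sub_le ((w y : ℂ) * ∑ b ∈ Ico x y, Φ b)
    (∑ b ∈ Ico x y, ((w (b + 1) - w b : ℝ) : ℂ) * ∑ i ∈ Ico x (b + 1), Φ i)
  linarith

theorem exists_typeI_sum_bound {d : ℕ} (α θ : Fin (d + 1) → ℝ) (hθ : StrictMono θ)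
    (hα : α (Fin.last d) ≠ 0) {Θ : ℝ} (hΘ : θ (Fin.last d) = Θ) (h3 : 3 < Θ)
    (hnonint : ∀ z : ℤ, (z : ℝ) ≠ Θ) {M : ℝ} (hM : 1 ≤ M) {D ρ τ : ℝ}
    (hD : D = 8 * Θ ^ 2 + 12 * Θ + 10) (hρ : ρ = 1 / D) (hτ : τ = ρ / 10 ^ 4) :
    ∃ C > (0 : ℝ), ∃ N₀ ≥ (3 : ℝ), ∀ N ≥ N₀, ∀ l : ℝ, -ρ ≤ l → l ≤ τ →
      ∀ R : ℕ, M * N < R → ∀ w : ℕ → ℝ, Monotone w → (∀ n, 0 ≤ w n) →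
      ∀ (B : Finset ℕ) (c : ℕ → ℂ) (K : ℝ), (∀ b, ‖c b‖ ≤ K) → c 0 = 0 →
      (∀ b : ℕ, N ^ (1 / 3 : ℝ) < b → c b = 0) →
      ‖∑ b ∈ B, ∑ a ∈ range R,
          bilinTerm M N (fun x => N ^ l * powSum α θ x) (fun a => (w a : ℂ)) c a b‖ ≤
        C * (w R * K * (N ^ (1 - ρ) * Real.log N)) := by
  obtain ⟨C, hC, N₁, hN₁, hb⟩ := exists_typeI_bound α θ hθ hα hΘ h3 hnonint hM hD hρ hτ
  refine ⟨4 * C, by positivity, N₁, hN₁, ?_⟩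
  intro N hN l hl hl' R hR w hw hw0 B c K hK hc0 hc
  have hN3 : 3 ≤ N := hN₁.trans hN
  have hN0 : 0 < N := by linarith
  have hN1 : 1 ≤ N := by linarith
  have hK0 : 0 ≤ K := (norm_nonneg _).trans (hK 0)
  have hlog1 : 1 ≤ Real.log N := by
    rw [Real.le_log_iff_exp_le hN0]
    exact Real.exp_one_lt_d9.le.trans (by linarith)
  set U := ⌊N ^ (1 / 3 : ℝ)⌋₊ with hU
  have hinner : ∀ b ∈ B, ‖∑ a ∈ range R,
      bilinTerm M N (fun x => N ^ l * powSum α θ x) (fun a => (w a : ℂ)) c a b‖ ≤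
      if b ∈ Ico 1 (U + 1) then K * (2 * w R * (C * (N ^ (1 - ρ) / b))) else 0 := by
    intro b _
    split_ifs with hbU
    · rw [mem_Ico] at hbU
      have hb1 : 1 ≤ b := hbU.1
      have hbN : (b : ℝ) ≤ N ^ (1 / 3 : ℝ) :=
        (Nat.le_floor_iff (by positivity)).1 (Nat.lt_succ_iff.1 hbU.2)
      have hb0 : (0 : ℝ) < b := by exact_mod_cast hb1
      set x := ⌊N / b⌋₊ + 1 with hx
      set y := ⌊M * N / b⌋₊ + 1 with hy
      have hmem : ∀ a : ℕ, a ∈ Ico x y ↔ N < (a : ℝ) * b ∧ (a : ℝ) * b ≤ M * N := by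
        intro a
        rw [mem_Ico, hx, hy, Nat.add_one_le_iff, Nat.lt_succ_iff, Nat.floor_lt (by positivity),
          Nat.le_floor_iff (by positivity), div_lt_iff₀ hb0, le_div_iff₀ hb0]
      have hyR : y ≤ R := by
        rw [hy, Nat.add_one_le_iff, Nat.floor_lt (by positivity)]
        exact (div_le_self (by positivity) (by exact_mod_cast hb1)).trans_lt hR
      have heq : ∑ a ∈ range R,
          bilinTerm M N (fun x => N ^ l * powSum α θ x) (fun a => (w a : ℂ)) c a b =
          c b * ∑ a ∈ Ico x y, (w a : ℂ) * expi (N ^ l * powSum α θ (b * a)) := by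
        unfold bilinTerm
        rw [← sum_filter, mul_sum]
        refine sum_congr ?_ fun a _ => ?_
        · ext a
          rw [mem_filter, hmem, mem_range]
          refine ⟨fun h => h.2, fun h => ⟨?_, h⟩⟩
          exact (mem_Ico.1 ((hmem a).2 h)).2.trans_le hyR
        · rw [mul_comm (a : ℝ) b]; ring
      rw [heq, norm_mul]
      have hsub : ∀ z ≤ y, ‖∑ i ∈ Ico x z, expi (N ^ l * powSum α θ (b * i))‖ ≤
          C * (N ^ (1 - ρ) / b) := by
        intro z hz
        refine hb N hN l hl hl' b hb1 hbN x z fun i hi => ?_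
        rw [mul_comm (b : ℝ), ← hmem]
        rw [mem_Ico] at hi ⊢
        exact ⟨hi.1, hi.2.trans_le hz⟩
      have h1 := norm_sum_Ico_monotone_mul_le hw hw0 hsub
      have h2 := hw hyR
      have h4 : 0 ≤ C * (N ^ (1 - ρ) / b) := by positivity
      refine mul_le_mul (hK b) (h1.trans ?_) (norm_nonneg _) hK0
      gcongr
    · have : c b = 0 := by
        rw [mem_Ico, not_and_or, not_le, not_lt] at hbU
        rcases hbU with h | h
        · rwa [Nat.lt_one_iff.1 h]
        · exact hc b ((Nat.floor_lt (by positivity)).1 h)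
      simp [bilinTerm, this]
  refine (norm_sum_le _ _).trans ((sum_le_sum hinner).trans ?_)
  have hle1 : ∑ b ∈ B, (if b ∈ Ico 1 (U + 1) then K * (2 * w R * (C * (N ^ (1 - ρ) / b))) else 0) ≤
      ∑ b ∈ Ico 1 (U + 1), K * (2 * w R * (C * (N ^ (1 - ρ) / b))) := by
    rw [← sum_filter]
    refine sum_le_sum_of_subset_of_nonneg (fun b hb => (mem_filter.1 hb).2) fun b _ _ => ?_
    have := hw0 R
    positivity
  refine hle1.trans ?_
  have hUN : ((U + 1 : ℕ) : ℝ) ≤ N := by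
    have h1 : (U : ℝ) ≤ N ^ (1 / 3 : ℝ) := Nat.floor_le (by positivity)
    have h2 : N ^ (1 / 3 : ℝ) ≤ N / 2 := by
      have e : (N ^ (1 / 3 : ℝ)) ^ 3 = N := by
        rw [← Real.rpow_mul_natCast hN0.le]; norm_num
      obtain ⟨r, hr⟩ : ∃ r, r = N ^ (1 / 3 : ℝ) := ⟨_, rfl⟩
      have hr0 : 0 ≤ r := by rw [hr]; positivity
      rw [← hr] at e ⊢
      by_contra hlt
      rw [not_le] at hlt
      have : r ^ 2 < 2 := by
        by_contra h2
        have := mul_le_mul_of_nonneg_left (not_lt.1 h2) hr0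
        nlinarith
      have : r < 3 / 2 := by nlinarith
      linarith
    push_cast
    linarith
  have hs := sum_Ico_inv_le le_rfl hUN hN1
  have hs2 : ∑ b ∈ Ico 1 (U + 1), (1 / b : ℝ) ≤ 2 * Real.log N := by linarith
  have e : ∑ b ∈ Ico 1 (U + 1), K * (2 * w R * (C * (N ^ (1 - ρ) / b))) =
      K * (2 * w R * (C * N ^ (1 - ρ))) * ∑ b ∈ Ico 1 (U + 1), (1 / b : ℝ) := by
    rw [mul_sum]
    refine sum_congr rfl fun b _ => ?_
    ring
  rw [e]
  have := mul_le_mul_of_nonneg_left hs2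
    (by have := hw0 R; positivity : 0 ≤ K * (2 * w R * (C * N ^ (1 - ρ))))
  linarith

theorem bilinTerm_mul (M N : ℝ) (g : ℝ → ℝ) (u v : ℕ → ℂ) (K : ℂ) (a b : ℕ) :
    bilinTerm M N g u (fun b => K * v b) a b = K * bilinTerm M N g u v a b := by
  unfold bilinTerm
  split_ifs <;> ring

theorem exists_typeII_sum_bound {d : ℕ} (α θ : Fin (d + 1) → ℝ) (hθ : StrictMono θ)
    (hα : α (Fin.last d) ≠ 0) {Θ : ℝ} (hΘ : θ (Fin.last d) = Θ) (h3 : 3 < Θ)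
    (hnonint : ∀ z : ℤ, (z : ℝ) ≠ Θ) {M : ℝ} (hM : 1 ≤ M) {D ρ τ : ℝ}
    (hD : D = 8 * Θ ^ 2 + 12 * Θ + 10) (hρ : ρ = 1 / D) (hτ : τ = ρ / 10 ^ 4) :
    ∃ C > (0 : ℝ), ∃ N₀ ≥ (3 : ℝ), ∀ N ≥ N₀, ∀ l : ℝ, -ρ ≤ l → l ≤ τ →
      ∀ (A B : Finset ℕ) (u v : ℕ → ℂ) (K : ℝ), 0 < K →
      (∀ a, ‖u a‖ ≤ 1) → (∀ b ∈ B, ‖v b‖ ≤ K) →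
      (∀ a : ℕ, (a : ℝ) ≤ N ^ (1 / 3 : ℝ) → u a = 0) →
      (∀ b : ℕ, (b : ℝ) ≤ N ^ (1 / 3 : ℝ) → v b = 0) →
      ‖∑ b ∈ B, ∑ a ∈ A, bilinTerm M N (fun x => N ^ l * powSum α θ x) u v a b‖ ≤
          C * (K * (N ^ (1 - ρ) * Real.log N)) := by
  obtain ⟨C, hC, N₁, hN₁, hb⟩ := exists_typeII_bound α θ hθ hα hΘ h3 hnonint hM hD hρ hτ
  refine ⟨C, hC, N₁, hN₁, ?_⟩
  intro N hN l hl hl' A B u v K hK hu hv hu0 hv0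
  set v' : ℕ → ℂ := fun b => if b ∈ B then (K : ℂ)⁻¹ * v b else 0 with hv'
  have hKne : (K : ℂ) ≠ 0 := by exact_mod_cast hK.ne'
  have h1 := hb N hN l hl hl' A B u v' hu
    (fun b => by
      by_cases hbB : b ∈ B
      · simp only [hv', if_pos hbB]
        rw [norm_mul, norm_inv, Complex.norm_real, Real.norm_of_nonneg hK.le, inv_mul_le_iff₀ hK,
          mul_one]
        exact hv b hbB
      · simp [hv', hbB]) hu0
    (fun b hb => by simp [hv', hv0 b hb])
  have h2 : ∑ b ∈ B, ∑ a ∈ A, bilinTerm M N (fun x => N ^ l * powSum α θ x) u v a b =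
      K * ∑ b ∈ B, ∑ a ∈ A, bilinTerm M N (fun x => N ^ l * powSum α θ x) u v' a b := by
    rw [mul_sum]
    refine sum_congr rfl fun b hbB => ?_
    rw [mul_sum]
    refine sum_congr rfl fun a _ => ?_
    rw [← bilinTerm_mul]
    simp only [bilinTerm, hv', if_pos hbB, mul_inv_cancel_left₀ hKne]
  rw [h2, norm_mul, Complex.norm_real, Real.norm_of_nonneg hK.le]
  have := mul_le_mul_of_nonneg_left h1 hK.le
  linarith

/-- The restriction of an arithmetic function to arguments at most `U`. -/
def truncLE (f : ArithmeticFunction ℝ) (U : ℝ) : ArithmeticFunction ℝ :=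
  ⟨fun n => if (n : ℝ) ≤ U then f n else 0, by simp⟩

theorem truncLE_apply (f : ArithmeticFunction ℝ) (U : ℝ) (n : ℕ) :
    truncLE f U n = if (n : ℝ) ≤ U then f n else 0 := rfl

theorem sub_truncLE_apply (f : ArithmeticFunction ℝ) (U : ℝ) (n : ℕ) :
    (f - truncLE f U) n = if (n : ℝ) ≤ U then 0 else f n := by
  rw [sub_eq_add_neg]
  show f n + -(truncLE f U n) = _
  rw [truncLE_apply]
  split_ifs <;> simp

theorem vaughan_identity (U : ℝ) :
    (ArithmeticFunction.vonMangoldt - truncLE ArithmeticFunction.vonMangoldt U) =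
      ArithmeticFunction.log * truncLE (ArithmeticFunction.moebius : ArithmeticFunction ℝ) U -
      (ArithmeticFunction.zeta : ArithmeticFunction ℝ) *
        (truncLE (ArithmeticFunction.moebius : ArithmeticFunction ℝ) U *
          truncLE ArithmeticFunction.vonMangoldt U) +
      ((ArithmeticFunction.moebius : ArithmeticFunction ℝ) -
          truncLE (ArithmeticFunction.moebius : ArithmeticFunction ℝ) U) *
        ((ArithmeticFunction.zeta : ArithmeticFunction ℝ) *
        (ArithmeticFunction.vonMangoldt - truncLE ArithmeticFunction.vonMangoldt U)) := by
  have h1 : (ArithmeticFunction.moebius : ArithmeticFunction ℝ) *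
    (ArithmeticFunction.zeta : ArithmeticFunction ℝ) = 1 :=
    ArithmeticFunction.coe_moebius_mul_coe_zeta
  have h2 := ArithmeticFunction.vonMangoldt_mul_zeta
  linear_combination -(ArithmeticFunction.vonMangoldt -
    truncLE ArithmeticFunction.vonMangoldt U) * h1 +
    truncLE (ArithmeticFunction.moebius : ArithmeticFunction ℝ) U * h2

theorem abs_truncLE_moebius_le (U : ℝ) (n : ℕ) :
    |truncLE (ArithmeticFunction.moebius : ArithmeticFunction ℝ) U n| ≤ 1 := by
  rw [truncLE_apply]
  split_ifs
  · rw [ArithmeticFunction.intCoe_apply]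
    exact_mod_cast ArithmeticFunction.abs_moebius_le_one
  · simp

theorem abs_moebius_sub_truncLE_le (U : ℝ) (n : ℕ) :
    |((ArithmeticFunction.moebius : ArithmeticFunction ℝ) -
      truncLE (ArithmeticFunction.moebius : ArithmeticFunction ℝ) U) n| ≤ 1 := by
  rw [sub_truncLE_apply]
  split_ifs
  · simp
  · rw [ArithmeticFunction.intCoe_apply]
    exact_mod_cast ArithmeticFunction.abs_moebius_le_one

theorem abs_mul_le_log (f g : ArithmeticFunction ℝ) (hf : ∀ n, |f n| ≤ 1)
    (hg : ∀ n, |g n| ≤ ArithmeticFunction.vonMangoldt n) (n : ℕ) :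
    |(f * g) n| ≤ Real.log n := by
  rw [← ArithmeticFunction.vonMangoldt_sum, ArithmeticFunction.mul_apply]
  refine (abs_sum_le_sum_abs _ _).trans ?_
  rw [Nat.sum_divisorsAntidiagonal' (fun a b => |f a * g b|)]
  refine sum_le_sum fun i _ => ?_
  rw [abs_mul]
  calc _ ≤ 1 * ArithmeticFunction.vonMangoldt i :=
        mul_le_mul (hf _) (hg _) (abs_nonneg _) zero_le_one
    _ = _ := one_mul _

theorem abs_truncLE_vonMangoldt_le (U : ℝ) (n : ℕ) :
    |truncLE ArithmeticFunction.vonMangoldt U n| ≤ ArithmeticFunction.vonMangoldt n := by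
  have := ArithmeticFunction.vonMangoldt_nonneg (n := n)
  rw [truncLE_apply]
  split_ifs
  · rw [abs_of_nonneg this]
  · simp [this]

theorem abs_vonMangoldt_sub_truncLE_le (U : ℝ) (n : ℕ) :
    |(ArithmeticFunction.vonMangoldt - truncLE ArithmeticFunction.vonMangoldt U) n| ≤
      ArithmeticFunction.vonMangoldt n := by
  have := ArithmeticFunction.vonMangoldt_nonneg (n := n)
  rw [sub_truncLE_apply]
  split_ifs
  · simp [this]
  · rw [abs_of_nonneg this]

theorem truncLE_mul_truncLE_eq_zero (f g : ArithmeticFunction ℝ) {U : ℝ} (hU : 0 ≤ U) {n : ℕ}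
    (hn : U * U < n) : (truncLE f U * truncLE g U) n = 0 := by
  rw [ArithmeticFunction.mul_apply]
  refine sum_eq_zero fun x hx => ?_
  obtain ⟨hx, -⟩ := Nat.mem_divisorsAntidiagonal.1 hx
  rw [truncLE_apply, truncLE_apply]
  split_ifs with h1 h2
  · exfalso
    have : (n : ℝ) = x.1 * x.2 := by exact_mod_cast hx.symm
    have h3 : (x.1 : ℝ) * x.2 ≤ U * U := by gcongr
    linarith
  all_goals simp

theorem zeta_mul_sub_truncLE_eq_zero (g f : ArithmeticFunction ℝ) {U : ℝ} {n : ℕ}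
    (hn : (n : ℝ) ≤ U) : (g * (f - truncLE f U)) n = 0 := by
  rw [ArithmeticFunction.mul_apply]
  refine sum_eq_zero fun x hx => ?_
  obtain ⟨hx, hn0⟩ := Nat.mem_divisorsAntidiagonal.1 hx
  rw [sub_truncLE_apply, if_pos, mul_zero]
  refine le_trans ?_ hn
  exact_mod_cast Nat.le_of_dvd (Nat.pos_of_ne_zero hn0) ⟨x.1, by rw [← hx, mul_comm]⟩

theorem sum_mul_expi_eq_bilin (f g : ArithmeticFunction ℝ) (φ : ℝ → ℝ) {M N : ℝ} (hN : 0 ≤ N)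
    {R : ℕ} (hR : M * N < R) :
    ∑ n ∈ (range R).filter (fun n : ℕ => N < (n : ℝ) ∧ (n : ℝ) ≤ M * N),
      ((f * g) n : ℂ) * expi (φ n) =
    ∑ b ∈ range R, ∑ a ∈ range R,
      bilinTerm M N φ (fun a => (f a : ℂ)) (fun b => (g b : ℂ)) a b := by
  rw [sum_comm, ← sum_product']
  set Q := (range R).filter (fun n : ℕ => N < (n : ℝ) ∧ (n : ℝ) ≤ M * N) with hQ
  set s := (range R ×ˢ range R).filter
    (fun x : ℕ × ℕ => N < (x.1 : ℝ) * x.2 ∧ (x.1 : ℝ) * x.2 ≤ M * N) with hs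
  have hpos : ∀ n ∈ Q, n ≠ 0 := by
    rintro n hn rfl
    have := (mem_filter.1 hn).2.1
    push_cast at this
    linarith
  have h1 : ∑ x ∈ range R ×ˢ range R,
      bilinTerm M N φ (fun a => (f a : ℂ)) (fun b => (g b : ℂ)) x.1 x.2 =
      ∑ x ∈ s, (f x.1 : ℂ) * g x.2 * expi (φ (x.1 * x.2)) := by
    rw [hs, sum_filter]
    rfl
  have hmaps : ∀ x ∈ s, x.1 * x.2 ∈ Q := by
    intro x hx
    obtain ⟨-, h2, h3⟩ := mem_filter.1 hx
    refine mem_filter.2 ⟨mem_range.2 ?_, by exact_mod_cast h2, by exact_mod_cast h3⟩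
    exact_mod_cast h3.trans_lt hR
  rw [h1, ← sum_fiberwise_of_maps_to hmaps]
  refine sum_congr rfl fun n hn => ?_
  have hfib : (s.filter fun x => x.1 * x.2 = n) = n.divisorsAntidiagonal := by
    ext x
    rw [mem_filter, Nat.mem_divisorsAntidiagonal]
    constructor
    · rintro ⟨-, h⟩
      exact ⟨h, hpos n hn⟩
    · rintro ⟨h, hn0⟩
      obtain ⟨hnR, h2, h3⟩ := mem_filter.1 hn
      refine ⟨mem_filter.2 ⟨mem_product.2 ⟨?_, ?_⟩, ?_⟩, h⟩
      · exact mem_range.2 ((Nat.le_of_dvd (Nat.pos_of_ne_zero hn0) ⟨_, h.symm⟩).trans_lt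
          (mem_range.1 hnR))
      · exact mem_range.2 ((Nat.le_of_dvd (Nat.pos_of_ne_zero hn0)
          ⟨_, by rw [← h, mul_comm]⟩).trans_lt (mem_range.1 hnR))
      · have : (x.1 : ℝ) * x.2 = n := by exact_mod_cast h
        rw [this]
        exact ⟨h2, h3⟩
  rw [hfib, ArithmeticFunction.mul_apply]
  push_cast
  rw [sum_mul]
  refine sum_congr rfl fun x hx => ?_
  obtain ⟨h, -⟩ := Nat.mem_divisorsAntidiagonal.1 hx
  have : (x.1 : ℝ) * x.2 = n := by exact_mod_cast h
  rw [this]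

theorem bilinTerm_add (M N : ℝ) (g : ℝ → ℝ) (u v v' : ℕ → ℂ) (a b : ℕ) :
    bilinTerm M N g u (fun b => v b + v' b) a b =
      bilinTerm M N g u v a b + bilinTerm M N g u v' a b := by
  unfold bilinTerm
  split_ifs <;> ring

theorem log_natCast_le {n : ℕ} {x : ℝ} (hx : 1 ≤ x) (h : (n : ℝ) ≤ x) : Real.log n ≤ Real.log x := by
  rcases Nat.eq_zero_or_pos n with rfl | hn
  · simpa using Real.log_nonneg hx
  · exact Real.log_le_log (by exact_mod_cast hn) h

theorem monotone_log_natCast : Monotone fun n : ℕ => Real.log n := by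
  intro a b hab
  rcases Nat.eq_zero_or_pos b with rfl | hb
  · rw [Nat.le_zero.1 hab]
  · exact log_natCast_le (by exact_mod_cast hb) (by exact_mod_cast hab)

theorem zeta_real_apply (a : ℕ) :
    (ArithmeticFunction.zeta : ArithmeticFunction ℝ) a = if a = 0 then 0 else 1 := by
  rw [ArithmeticFunction.natCoe_apply, ArithmeticFunction.zeta_apply]
  split_ifs <;> simp

set_option maxHeartbeats 1000000 in
theorem exists_vonMangoldt_expSum_bound {d : ℕ} (α θ : Fin (d + 1) → ℝ) (hθ : StrictMono θ)
    (hα : α (Fin.last d) ≠ 0) {Θ : ℝ} (hΘ : θ (Fin.last d) = Θ) (h3 : 3 < Θ)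
    (hnonint : ∀ z : ℤ, (z : ℝ) ≠ Θ) {M : ℝ} (hM : 1 ≤ M) {D ρ τ : ℝ}
    (hD : D = 8 * Θ ^ 2 + 12 * Θ + 10) (hρ : ρ = 1 / D) (hτ : τ = ρ / 10 ^ 4) :
    ∃ C > (0 : ℝ), ∃ N₀ ≥ (3 : ℝ), ∀ N ≥ N₀, ∀ l : ℝ, -ρ ≤ l → l ≤ τ →
      ∀ R : ℕ, M * N < R → (R : ℝ) ≤ 2 * (M * N) →
      ‖∑ n ∈ (range R).filter (fun n : ℕ => N < (n : ℝ) ∧ (n : ℝ) ≤ M * N),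
        (ArithmeticFunction.vonMangoldt n : ℂ) * expi (N ^ l * powSum α θ n)‖ ≤
        C * (N ^ (1 - ρ) * Real.log N ^ 2) := by
  obtain ⟨C₁, hC₁, N₁, hN₁, hI⟩ := exists_typeI_sum_bound α θ hθ hα hΘ h3 hnonint hM hD hρ hτ
  obtain ⟨C₂, hC₂, N₂, hN₂, hII⟩ := exists_typeII_sum_bound α θ hθ hα hΘ h3 hnonint hM hD hρ hτ
  refine ⟨3 * C₁ + 3 * C₂, by positivity, N₁ + N₂ + 2 * M, by linarith, ?_⟩
  intro N hN l hl hl' R hR hR'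
  have hN3 : 3 ≤ N := by linarith
  have hN0 : 0 < N := by linarith
  have hN1 : 1 ≤ N := by linarith
  have hlog1 : 1 ≤ Real.log N := by
    rw [Real.le_log_iff_exp_le hN0]
    exact Real.exp_one_lt_d9.le.trans (by linarith)
  have hRlog : Real.log R ≤ 2 * Real.log N := by
    have h1 : (R : ℝ) ≤ N * N := by
      refine hR'.trans ?_
      rw [← mul_assoc]
      exact mul_le_mul_of_nonneg_right (by linarith) hN0.le
    have h2 := log_natCast_le (one_le_mul_of_one_le_of_one_le hN1 hN1) h1
    rw [Real.log_mul hN0.ne' hN0.ne'] at h2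
    linarith
  set U := N ^ (1 / 3 : ℝ) with hU
  have hU0 : 0 ≤ U := by positivity
  have hU3 : U * U * U = N := by
    rw [hU, ← Real.rpow_add hN0, ← Real.rpow_add hN0]; norm_num
  have hU1 : 1 ≤ U := Real.one_le_rpow hN1 (by norm_num)
  have hUU : U ≤ U * U := le_mul_of_one_le_left hU0 hU1
  have hUUN : U * U ≤ N := by
    rw [← hU3]; exact le_mul_of_one_le_right (by positivity) hU1
  have hUN : U ≤ N := hUU.trans hUUN
  set φ : ℝ → ℝ := fun x => N ^ l * powSum α θ x with hφ
  set Q := (range R).filter (fun n : ℕ => N < (n : ℝ) ∧ (n : ℝ) ≤ M * N) with hQ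
  set mu1 := truncLE (ArithmeticFunction.moebius : ArithmeticFunction ℝ) U with hmu1
  set La1 := truncLE ArithmeticFunction.vonMangoldt U with hLa1
  set c := mu1 * La1 with hc
  set e := (ArithmeticFunction.zeta : ArithmeticFunction ℝ) *
        (ArithmeticFunction.vonMangoldt - La1) with he
  have hcabs : ∀ n, |c n| ≤ Real.log n := fun n =>
    abs_mul_le_log _ _ (abs_truncLE_moebius_le U) (abs_truncLE_vonMangoldt_le U) n
  have heabs : ∀ n, |e n| ≤ Real.log n := fun n =>
    abs_mul_le_log _ _ (fun n => by rw [zeta_real_apply]; by_cases h : n = 0 <;> norm_num [h])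
      (abs_vonMangoldt_sub_truncLE_le U) n
  have hc0 : ∀ n : ℕ, U * U < n → c n = 0 := fun n hn => truncLE_mul_truncLE_eq_zero _ _ hU0 hn
  have hclog : ∀ n, |c n| ≤ Real.log N := by
    intro n
    by_cases hn : U * U < n
    · rw [hc0 n hn, abs_zero]; linarith
    · exact (hcabs n).trans (log_natCast_le hN1 ((not_lt.1 hn).trans hUUN))
  have hdecomp : ∑ n ∈ Q, (ArithmeticFunction.vonMangoldt n : ℂ) * expi (φ n) =
      ∑ n ∈ Q, ((ArithmeticFunction.log * mu1) n : ℂ) * expi (φ n) -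
      ∑ n ∈ Q, (((ArithmeticFunction.zeta : ArithmeticFunction ℝ) * c) n : ℂ) * expi (φ n) +
      ∑ n ∈ Q, ((((ArithmeticFunction.moebius : ArithmeticFunction ℝ) - mu1) * e) n : ℂ) *
        expi (φ n) := by
    rw [← sum_sub_distrib, ← sum_add_distrib]
    refine sum_congr rfl fun n hn => ?_
    have h1 : ArithmeticFunction.vonMangoldt n =
        (ArithmeticFunction.vonMangoldt - La1) n := by
      rw [hLa1, sub_truncLE_apply, if_neg]
      have := (mem_filter.1 hn).2.1
      linarith
    rw [h1, hLa1, vaughan_identity, sub_eq_add_neg, ArithmeticFunction.add_apply,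
      ArithmeticFunction.add_apply, ArithmeticFunction.neg_apply]
    push_cast
    ring
  rw [hdecomp, sum_mul_expi_eq_bilin _ _ φ hN0.le hR, sum_mul_expi_eq_bilin _ _ φ hN0.le hR,
    sum_mul_expi_eq_bilin _ _ φ hN0.le hR]
  set X := N ^ (1 - ρ) * Real.log N with hX
  have hX0 : 0 ≤ X := by positivity
  have hrealnorm : ∀ x : ℝ, ‖(x : ℂ)‖ = |x| := fun x => Complex.norm_real x
  have t1 := hI N (by linarith) l hl hl' R hR (fun n => Real.log n) monotone_log_natCast
    (fun n => Real.log_natCast_nonneg n) (range R) (fun b => (mu1 b : ℂ)) 1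
    (fun b => by rw [hrealnorm]; exact abs_truncLE_moebius_le U b) (by simp)
    (fun b hb => by rw [hmu1, truncLE_apply, if_neg (not_le.2 hb), Complex.ofReal_zero])
  have t3 := hII N (by linarith) l hl hl' (range R) (range R)
    (fun a => (((ArithmeticFunction.moebius : ArithmeticFunction ℝ) - mu1) a : ℂ))
    (fun b => (e b : ℂ)) (2 * Real.log N) (by linarith)
    (fun b => by rw [hrealnorm]; exact abs_moebius_sub_truncLE_le U b)
    (fun b hb => by
      rw [hrealnorm]
      have h1 : (b : ℝ) ≤ R := by exact_mod_cast (mem_range.1 hb).le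
      have hR1 : (1 : ℝ) ≤ R := by
        have : N ≤ M * N := le_mul_of_one_le_left hN0.le hM
        linarith
      exact (heabs b).trans ((log_natCast_le hR1 h1).trans hRlog))
    (fun a ha => by rw [hmu1, sub_truncLE_apply, if_pos ha, Complex.ofReal_zero])
    (fun b hb => by rw [he, hLa1, zeta_mul_sub_truncLE_eq_zero _ _ hb, Complex.ofReal_zero])
  set cl : ℕ → ℂ := fun b => if (b : ℝ) ≤ U then (c b : ℂ) else 0 with hcl
  set ch : ℕ → ℂ := fun b => if (b : ℝ) ≤ U then 0 else (c b : ℂ) with hch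
  have t2a := hI N (by linarith) l hl hl' R hR
    (fun a => (ArithmeticFunction.zeta : ArithmeticFunction ℝ) a)
    (fun a b hab => by
      simp only [zeta_real_apply]
      split_ifs with h1 h2
      · exact le_rfl
      · exact zero_le_one
      · omega
      · exact le_rfl)
    (fun n => by rw [zeta_real_apply]; by_cases h : n = 0 <;> norm_num [h]) (range R) cl (Real.log N)
    (fun b => by
      simp only [hcl]
      split_ifs
      · rw [hrealnorm]; exact hclog b
      · rw [norm_zero]; linarith) (by simp [hcl])
    (fun b hb => if_neg (not_le.2 hb))
  set ze : ℕ → ℂ := fun a => if (a : ℝ) ≤ U then 0 else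
    ((ArithmeticFunction.zeta : ArithmeticFunction ℝ) a : ℂ) with hze
  have t2b := hII N (by linarith) l hl hl' (range R) (range R) ze ch (Real.log N) (by linarith)
    (fun a => by
      simp only [hze]
      split_ifs
      · simp
      · rw [hrealnorm, zeta_real_apply]; by_cases h : a = 0 <;> norm_num [h])
    (fun b _ => by
      simp only [hch]
      split_ifs
      · rw [norm_zero]; linarith
      · rw [hrealnorm]; exact hclog b)
    (fun a ha => if_pos ha)
    (fun b hb => if_pos hb)
  have hsplit : ∑ b ∈ range R, ∑ a ∈ range R, bilinTerm M N φ
      (fun a => ((ArithmeticFunction.zeta : ArithmeticFunction ℝ) a : ℂ)) (fun b => (c b : ℂ)) a b =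
      ∑ b ∈ range R, ∑ a ∈ range R, bilinTerm M N φ
        (fun a => ((ArithmeticFunction.zeta : ArithmeticFunction ℝ) a : ℂ)) cl a b +
      ∑ b ∈ range R, ∑ a ∈ range R, bilinTerm M N φ ze ch a b := by
    rw [← sum_add_distrib]
    refine sum_congr rfl fun b _ => ?_
    rw [← sum_add_distrib]
    refine sum_congr rfl fun a _ => ?_
    have h1 : bilinTerm M N φ ze ch a b = bilinTerm M N φ
        (fun a => ((ArithmeticFunction.zeta : ArithmeticFunction ℝ) a : ℂ)) ch a b := by
      by_cases ha : (a : ℝ) ≤ U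
      · have h2 : bilinTerm M N φ
            (fun a => ((ArithmeticFunction.zeta : ArithmeticFunction ℝ) a : ℂ)) ch a b = 0 := by
          by_contra hne
          obtain ⟨h4, -, -, h5⟩ := bilinTerm_ne_zero hne
          have hb : (b : ℝ) ≤ U * U := by
            by_contra hb
            refine h5 ?_
            simp only [hch, hc0 b (not_le.1 hb), Complex.ofReal_zero, ite_self]
          have : (a : ℝ) * b ≤ U * (U * U) := by gcongr
          linarith
        rw [h2]
        by_contra hne
        exact (bilinTerm_ne_zero hne).2.2.1 (by simp only [hze, if_pos ha])
      · simp only [bilinTerm, hze, if_neg ha]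
    rw [h1, ← bilinTerm_add]
    congr 1
    funext b
    simp only [hcl, hch]
    split_ifs <;> simp
  rw [hsplit]
  simp only [ArithmeticFunction.log_apply]
  have hzR : (ArithmeticFunction.zeta : ArithmeticFunction ℝ) R ≤ 1 := by
    rw [zeta_real_apply]; split_ifs <;> simp
  have b1 : C₁ * (Real.log R * 1 * X) ≤ C₁ * (2 * Real.log N * X) := by
    rw [mul_one]; gcongr
  have b2 : C₁ * ((ArithmeticFunction.zeta : ArithmeticFunction ℝ) R * Real.log N * X) ≤
      C₁ * (1 * Real.log N * X) := by gcongr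
  have hfin : N ^ (1 - ρ) * Real.log N ^ 2 = Real.log N * X := by rw [hX]; ring
  rw [hfin]
  refine (norm_add_le _ _).trans ?_
  refine (add_le_add ((norm_sub_le _ _).trans (add_le_add t1 ((norm_add_le _ _).trans
    (add_le_add t2a t2b)))) t3).trans ?_
  linarith

theorem expi_nat_mul (n : ℕ) (t : ℝ) : expi (n * t) = expi t ^ n := by
  rw [expi, expi, ← Complex.exp_nat_mul]
  congr 1; push_cast; ring

theorem conj_expi (t : ℝ) : (starRingEnd ℂ) (expi t) = expi (-t) := by
  rw [expi, expi, ← Complex.exp_conj]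
  congr 1
  rw [map_mul, Complex.conj_ofReal, Complex.conj_I]
  push_cast; ring

theorem norm_geom_sum_expi_le {m t : ℝ} (hm : 0 < m) (h : ∀ k : ℤ, 1 / (2 * m) ≤ |t - k|)
    (L : ℕ) : ‖∑ j ∈ range L, expi (j * t)‖ ≤ m := by
  set u := t - round t with hu
  have hexp : expi t = expi u := by
    have : t = u + (round t : ℤ) := by rw [hu]; ring
    conv_lhs => rw [this]
    rw [expi_add, expi_intCast, mul_one]
  have hu1 : |u| ≤ 1 / 2 := abs_sub_round t
  have hu2 : 1 / (2 * m) ≤ |u| := h _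
  have hz : 2 / m ≤ ‖expi t - 1‖ := by
    rw [hexp, expi, mul_comm _ Complex.I, Complex.norm_exp_I_mul_ofReal_sub_one,
      Real.norm_eq_abs, abs_mul, abs_two, show 2 * Real.pi * u / 2 = Real.pi * u by ring]
    have h1 : |Real.pi * u| ≤ Real.pi / 2 := by
      rw [abs_mul, abs_of_pos Real.pi_pos]
      nlinarith [Real.pi_pos]
    have h2 := Real.mul_abs_le_abs_sin h1
    rw [abs_mul, abs_of_pos Real.pi_pos, ← mul_assoc, div_mul_cancel₀ _ Real.pi_pos.ne'] at h2
    have h3 : 2 / m = 4 * (1 / (2 * m)) := by field_simp; norm_num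
    rw [h3]
    linarith
  have hg : ‖∑ j ∈ range L, expi (j * t)‖ * ‖expi t - 1‖ ≤ 2 := by
    simp_rw [expi_nat_mul]
    rw [← norm_mul, geom_sum_mul]
    refine (norm_sub_le _ _).trans ?_
    rw [norm_pow, norm_expi, one_pow, norm_one]
    norm_num
  have h4 : ‖∑ j ∈ range L, expi (j * t)‖ * (2 / m) ≤ 2 :=
    (mul_le_mul_of_nonneg_left hz (norm_nonneg _)).trans hg
  rw [mul_div_assoc', div_le_iff₀ hm] at h4
  linarith

theorem exists_geom_sum_pow_coeff {L r : ℕ} (hL : 1 ≤ L) (hr : 1 ≤ r) :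
    ∃ c : ℕ → ℝ, (∀ s, 0 ≤ c s) ∧ ∑ s ∈ range (r * L), c s = (L : ℝ) ^ r ∧
      ∀ t : ℝ, (∑ j ∈ range L, expi (j * t)) ^ r =
        ∑ s ∈ range (r * L), (c s : ℂ) * expi (s * t) := by
  set P : Polynomial ℕ := (∑ j ∈ range L, Polynomial.X ^ j) ^ r with hP
  have hdeg : P.natDegree < r * L := by
    have h1 : P.natDegree ≤ r * (L - 1) := by
      refine Polynomial.natDegree_pow_le_of_le r ?_
      refine Polynomial.natDegree_sum_le_of_forall_le _ _ fun j hj => ?_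
      rw [Polynomial.natDegree_X_pow]
      have := mem_range.1 hj
      omega
    have h2 : r * (L - 1) < r * L := Nat.mul_lt_mul_of_pos_left (by omega) (by omega)
    omega
  refine ⟨fun s => (P.coeff s : ℝ), fun s => Nat.cast_nonneg _, ?_, fun t => ?_⟩
  · have h := Polynomial.eval_eq_sum_range' hdeg 1
    rw [hP, Polynomial.eval_pow, Polynomial.eval_finsetSum] at h
    simp only [Polynomial.eval_pow, Polynomial.eval_X, one_pow, sum_const, card_range,
      smul_eq_mul, mul_one] at h
    rw [← hP] at h
    rw [← Nat.cast_sum, ← h]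
    push_cast; rfl
  · have h := Polynomial.aeval_eq_sum_range' hdeg (expi t)
    rw [hP, map_pow, map_sum] at h
    simp only [map_pow, Polynomial.aeval_X] at h
    rw [← hP] at h
    simp_rw [expi_nat_mul]
    rw [h]
    refine sum_congr rfl fun s _ => ?_
    rw [nsmul_eq_mul, Complex.ofReal_natCast]

theorem le_sum_mul_norm_sq_of_expSum_bound (A : Finset ℕ) (w t : ℕ → ℝ) {Z : ℕ}
    {c : ℕ → ℝ} (hc : ∀ s, 0 ≤ c s) (hw : ∀ n ∈ A, 0 ≤ w n) {E : ℝ} (hE0 : 0 ≤ E)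
    (hE : ∀ h : ℤ, h ≠ 0 → |h| < Z → ‖∑ n ∈ A, (w n : ℂ) * expi (h * t n)‖ ≤ E) :
    ((∑ n ∈ A, w n) / Z - E) * (∑ s ∈ range Z, c s) ^ 2 ≤
      ∑ n ∈ A, w n * ‖∑ s ∈ range Z, (c s : ℂ) * expi (s * t n)‖ ^ 2 := by
  set W := ∑ n ∈ A, w n with hW
  have hW0 : 0 ≤ W := sum_nonneg hw
  set T : ℤ → ℂ := fun h => ∑ n ∈ A, (w n : ℂ) * expi (h * t n) with hT
  have hexpand : ((∑ n ∈ A, w n * ‖∑ s ∈ range Z, (c s : ℂ) * expi (s * t n)‖ ^ 2 : ℝ) : ℂ) =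
      ∑ s ∈ range Z, ∑ s' ∈ range Z, ((c s * c s' : ℝ) : ℂ) * T ((s : ℤ) - s') := by
    simp only [hT, mul_sum]
    rw [Complex.ofReal_sum]
    have h1 : ∀ n ∈ A, ((w n * ‖∑ s ∈ range Z, (c s : ℂ) * expi (s * t n)‖ ^ 2 : ℝ) : ℂ) =
        ∑ s ∈ range Z, ∑ s' ∈ range Z,
          ((c s * c s' : ℝ) : ℂ) * ((w n : ℂ) * expi ((((s : ℤ) - s' : ℤ) : ℝ) * t n)) := by
      intro n _
      rw [← Complex.normSq_eq_norm_sq, Complex.ofReal_mul, ← Complex.mul_conj, map_sum, sum_mul_sum,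
        mul_sum]
      refine sum_congr rfl fun s _ => ?_
      rw [mul_sum]
      refine sum_congr rfl fun s' _ => ?_
      rw [map_mul, Complex.conj_ofReal, conj_expi]
      have : (((s : ℤ) - s' : ℤ) : ℝ) * t n = s * t n + -(s' * t n) := by push_cast; ring
      rw [this, expi_add]
      push_cast; ring
    rw [sum_congr rfl h1, sum_comm]
    refine sum_congr rfl fun s _ => ?_
    rw [sum_comm]
  have hre := congrArg Complex.re hexpand
  rw [Complex.ofReal_re, Complex.re_sum] at hre
  rw [hre]
  have hterm : ∀ s ∈ range Z, ∀ s' ∈ range Z,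
      (if s = s' then c s ^ 2 * W else 0) - c s * c s' * E ≤
        (((c s * c s' : ℝ) : ℂ) * T ((s : ℤ) - s')).re := by
    intro s hs s' hs'
    rw [Complex.re_ofReal_mul]
    have hcc : 0 ≤ c s * c s' := mul_nonneg (hc s) (hc s')
    split_ifs with h
    · subst h
      have : T ((s : ℤ) - s) = (W : ℂ) := by simp [hT, hW]
      rw [this, Complex.ofReal_re]
      nlinarith [mul_nonneg hcc hE0]
    · have h1 : ‖T ((s : ℤ) - s')‖ ≤ E := by
        refine hE _ (by omega) ?_
        have := mem_range.1 hs
        have := mem_range.1 hs'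
        rw [abs_lt]; omega
      have h2 : -E ≤ (T ((s : ℤ) - s')).re := by
        have := (Complex.abs_re_le_norm (T ((s : ℤ) - s'))).trans h1
        exact (abs_le.1 this).1
      nlinarith [mul_le_mul_of_nonneg_left h2 hcc]
  have hlow : ∑ s ∈ range Z, ∑ s' ∈ range Z,
      ((if s = s' then c s ^ 2 * W else 0) - c s * c s' * E) =
      (∑ s ∈ range Z, c s ^ 2) * W - (∑ s ∈ range Z, c s) ^ 2 * E := by
    simp_rw [sum_sub_distrib]
    congr 1
    · rw [sum_mul]
      refine sum_congr rfl fun s hs => ?_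
      rw [sum_ite_eq, if_pos hs]
    · rw [sq, sum_mul_sum, sum_mul]
      exact sum_congr rfl fun s _ => by rw [sum_mul]
  have hcs : (∑ s ∈ range Z, c s) ^ 2 / Z ≤ ∑ s ∈ range Z, c s ^ 2 := by
    have h1 := sq_sum_le_card_mul_sum_sq (s := range Z) (f := c)
    rw [card_range] at h1
    exact div_le_of_le_mul₀ (Nat.cast_nonneg _) (sum_nonneg fun _ _ => sq_nonneg _)
      (by linarith)
  calc (W / Z - E) * (∑ s ∈ range Z, c s) ^ 2
      = (∑ s ∈ range Z, c s) ^ 2 / Z * W - (∑ s ∈ range Z, c s) ^ 2 * E := by ring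
    _ ≤ (∑ s ∈ range Z, c s ^ 2) * W - (∑ s ∈ range Z, c s) ^ 2 * E := by gcongr
    _ ≤ _ := by
      rw [← hlow]
      refine sum_le_sum fun s hs => ?_
      rw [Complex.re_sum]
      exact sum_le_sum fun s' hs' => hterm s hs s' hs'

theorem dvd_floor_of_abs_lt {m : ℕ} (hm : 0 < m) {x : ℝ} {k : ℤ}
    (h : |x / m - 1 / (2 * m) - k| < 1 / (2 * m)) : (m : ℤ) ∣ ⌊x⌋ := by
  have hm' : (0 : ℝ) < m := by exact_mod_cast hm
  rw [abs_lt] at h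
  have h1 : (m * k : ℝ) < x := by
    have : (k : ℝ) < x / m := by linarith [h.1]
    rwa [lt_div_iff₀ hm', mul_comm] at this
  have h2 : x < m * k + 1 := by
    have h3 : x / m < k + 2 * (1 / (2 * m)) := by linarith [h.2]
    have h4 : k + 2 * (1 / (2 * m)) = (m * k + 1) / (m : ℝ) := by field_simp
    rw [h4, div_lt_div_iff_of_pos_right hm'] at h3
    exact h3
  have hfl : ⌊x⌋ = m * k := by
    rw [Int.floor_eq_iff]
    push_cast
    exact ⟨h1.le, h2⟩
  rw [hfl]
  exact dvd_mul_right _ _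

theorem exists_prime_of_expSum_bound (A : Finset ℕ) (g : ℕ → ℝ) {m L r : ℕ} (hm : 0 < m)
    (hL : 1 ≤ L) (hr : 1 ≤ r) {E : ℝ} (hE0 : 0 ≤ E)
    (hE : ∀ h : ℕ, 1 ≤ h → h < r * L →
      ‖∑ n ∈ A, (ArithmeticFunction.vonMangoldt n : ℂ) * expi (h / m * g n)‖ ≤ E)
    (hlt : E + ∑ n ∈ A with ¬ n.Prime, ArithmeticFunction.vonMangoldt n +
      (∑ n ∈ A, ArithmeticFunction.vonMangoldt n) * ((m : ℝ) / L) ^ (2 * r) <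
      (∑ n ∈ A, ArithmeticFunction.vonMangoldt n) / (r * L)) :
    ∃ p ∈ A, p.Prime ∧ (m : ℤ) ∣ ⌊g p⌋ := by
  by_contra! hno
  have hm' : (0 : ℝ) < m := by exact_mod_cast hm
  have hL' : (0 : ℝ) < L := by exact_mod_cast hL
  obtain ⟨c, hc0, hcsum, hc⟩ := exists_geom_sum_pow_coeff hL hr
  set W := ∑ n ∈ A, ArithmeticFunction.vonMangoldt n with hW
  set t : ℕ → ℝ := fun n => g n / m - 1 / (2 * m) with ht
  have hpos : ∀ h : ℕ, 1 ≤ h → h < r * L →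
      ‖∑ n ∈ A, (ArithmeticFunction.vonMangoldt n : ℂ) * expi (h * t n)‖ ≤ E := by
    intro h h1 h2
    have : ∀ n ∈ A, (ArithmeticFunction.vonMangoldt n : ℂ) * expi (h * t n) =
        expi (-(h / (2 * m))) *
          ((ArithmeticFunction.vonMangoldt n : ℂ) * expi (h / m * g n)) := by
      intro n _
      have : h * t n = -(h / (2 * m)) + h / m * g n := by rw [ht]; ring
      rw [this, expi_add]; ring
    rw [sum_congr rfl this, ← mul_sum, norm_mul, norm_expi, one_mul]
    exact hE h h1 h2
  have hall : ∀ h : ℤ, h ≠ 0 → |h| < ((r * L : ℕ) : ℤ) →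
      ‖∑ n ∈ A, (ArithmeticFunction.vonMangoldt n : ℂ) * expi (h * t n)‖ ≤ E := by
    intro h h0 hZ
    obtain ⟨a, rfl | rfl⟩ := h.eq_nat_or_neg
    · rw [Nat.abs_cast] at hZ
      exact_mod_cast hpos a (by omega) (by exact_mod_cast hZ)
    · rw [abs_neg, Nat.abs_cast] at hZ
      have h1 := hpos a (by omega) (by exact_mod_cast hZ)
      rw [← Complex.norm_conj, map_sum] at h1
      refine le_trans (le_of_eq ?_) h1
      congr 1
      refine sum_congr rfl fun n _ => ?_
      rw [map_mul, Complex.conj_ofReal, conj_expi]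
      push_cast
      rw [neg_mul]
  have hlow := le_sum_mul_norm_sq_of_expSum_bound A
    (fun n => ArithmeticFunction.vonMangoldt n) t hc0
    (fun n _ => ArithmeticFunction.vonMangoldt_nonneg) hE0 hall
  rw [hcsum] at hlow
  have hup : ∑ n ∈ A, ArithmeticFunction.vonMangoldt n *
      ‖∑ s ∈ range (r * L), (c s : ℂ) * expi (s * t n)‖ ^ 2 ≤
      W * ((m : ℝ) ^ r) ^ 2 +
        (∑ n ∈ A with ¬ n.Prime, ArithmeticFunction.vonMangoldt n) * ((L : ℝ) ^ r) ^ 2 := by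
    rw [hW, sum_mul, sum_mul, sum_filter, ← sum_add_distrib]
    refine sum_le_sum fun n hn => ?_
    have hΛ : 0 ≤ ArithmeticFunction.vonMangoldt n := ArithmeticFunction.vonMangoldt_nonneg
    rw [← hc, norm_pow]
    by_cases hp : n.Prime
    · rw [if_neg (not_not.2 hp), add_zero]
      have h1 := norm_geom_sum_expi_le (t := t n) hm' (fun k => by
        by_contra! hk
        exact hno n hn hp (dvd_floor_of_abs_lt hm hk)) L
      gcongr
    · rw [if_pos hp]
      have h1 : ‖∑ j ∈ range L, expi (j * t n)‖ ≤ L := by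
        refine (norm_sum_le _ _).trans ?_
        simp
      have h2 : ArithmeticFunction.vonMangoldt n * (‖∑ j ∈ range L, expi (j * t n)‖ ^ r) ^ 2 ≤
          ArithmeticFunction.vonMangoldt n * ((L : ℝ) ^ r) ^ 2 := by gcongr
      have h3 : 0 ≤ ArithmeticFunction.vonMangoldt n * ((m : ℝ) ^ r) ^ 2 := by positivity
      linarith
  have hLr : 0 < ((L : ℝ) ^ r) ^ 2 := by positivity
  have hml : W * ((m : ℝ) / L) ^ (2 * r) * ((L : ℝ) ^ r) ^ 2 = W * ((m : ℝ) ^ r) ^ 2 := by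
    rw [mul_comm 2 r, pow_mul, div_pow, mul_assoc, ← mul_pow, div_mul_cancel₀ _ (by positivity)]
  have hfin := mul_lt_mul_of_pos_right hlt hLr
  push_cast at hlow
  nlinarith [hlow.trans hup]

theorem filter_range_eq_Ioc {N M : ℝ} (hN : 0 ≤ N) (hM : 0 ≤ M) {R : ℕ} (hR : M < R) :
    (range R).filter (fun n : ℕ => N < (n : ℝ) ∧ (n : ℝ) ≤ M) = Ioc ⌊N⌋₊ ⌊M⌋₊ := by
  ext n
  rw [mem_filter, mem_range, mem_Ioc, Nat.floor_lt hN, Nat.le_floor_iff hM]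
  refine ⟨fun h => h.2, fun h => ⟨?_, h⟩⟩
  exact_mod_cast h.2.trans_lt hR

theorem sum_vonMangoldt_Ioc_bounds {N : ℝ} (hN : 3 ≤ N) :
    N ≤ ∑ n ∈ Ioc ⌊N⌋₊ ⌊16 * N⌋₊, ArithmeticFunction.vonMangoldt n ∧
      ∑ n ∈ Ioc ⌊N⌋₊ ⌊16 * N⌋₊, ArithmeticFunction.vonMangoldt n ≤ 96 * N ∧
      ∑ n ∈ Ioc ⌊N⌋₊ ⌊16 * N⌋₊ with ¬ n.Prime, ArithmeticFunction.vonMangoldt n ≤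
        32 * (N ^ (1 / 2 : ℝ) * Real.log N) := by
  have hsub : Ioc ⌊N⌋₊ ⌊16 * N⌋₊ ⊆ Ioc 0 ⌊16 * N⌋₊ := Ioc_subset_Ioc_left (Nat.zero_le _)
  have hfl : ⌊N⌋₊ ≤ ⌊16 * N⌋₊ := Nat.floor_le_floor (by linarith)
  have hW : Chebyshev.psi N + ∑ n ∈ Ioc ⌊N⌋₊ ⌊16 * N⌋₊, ArithmeticFunction.vonMangoldt n =
      Chebyshev.psi (16 * N) := by
    rw [Chebyshev.psi, Chebyshev.psi, sum_Ioc_consecutive _ (Nat.zero_le _) hfl]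
  have hψ0 : 0 ≤ Chebyshev.psi N := Chebyshev.psi_nonneg _
  have h1 := Chebyshev.psi_le_const_mul_self (x := N) (by linarith)
  have h2 := Chebyshev.psi_le_const_mul_self (x := 16 * N) (by linarith)
  have h3 := Chebyshev.psi_ge' (x := 16 * N) (by linarith)
  have hl4 : Real.log 4 = 2 * Real.log 2 := by
    rw [show (4 : ℝ) = 2 ^ 2 by norm_num, Real.log_pow]; push_cast; ring
  have hl16 : Real.log 16 = 4 * Real.log 2 := by
    rw [show (16 : ℝ) = 2 ^ 4 by norm_num, Real.log_pow]; push_cast; ring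
  have hlow := Real.log_two_gt_d9
  have hhigh := Real.log_two_lt_d9
  have hlN : 1 ≤ Real.log N := by
    rw [Real.le_log_iff_exp_le (by linarith)]
    linarith [Real.exp_one_lt_d9]
  refine ⟨?_, ?_, ?_⟩
  · have h4 : Real.log (16 * N + 2) ≤ 4 * Real.log 2 + N := by
      rw [show 16 * N + 2 = 16 * (N + 1 / 8) by ring, Real.log_mul (by norm_num) (by linarith), hl16]
      linarith [Real.log_le_sub_one_of_pos (x := N + 1 / 8) (by linarith)]
    rw [hl4] at h1
    nlinarith
  · rw [hl4] at h2
    nlinarith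
  · have h4 : ∑ n ∈ Ioc ⌊N⌋₊ ⌊16 * N⌋₊ with ¬ n.Prime, ArithmeticFunction.vonMangoldt n ≤
        Chebyshev.psi (16 * N) - Chebyshev.theta (16 * N) := by
      rw [Chebyshev.psi_sub_theta_eq_sum_not_prime]
      exact sum_le_sum_of_subset_of_nonneg (filter_subset_filter _ hsub)
        fun _ _ _ => ArithmeticFunction.vonMangoldt_nonneg
    have h5 := Chebyshev.psi_sub_theta_le (x := 16 * N) (by linarith)
    have h6 : √(16 * N) = 4 * N ^ (1 / 2 : ℝ) := by
      rw [Real.sqrt_mul (by norm_num), Real.sqrt_eq_rpow N,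
        show (16 : ℝ) = 4 ^ 2 by norm_num, Real.sqrt_sq (by norm_num)]
    rw [h6, Real.log_mul (by norm_num) (by linarith), hl16] at h5
    have h7 : 0 ≤ N ^ (1 / 2 : ℝ) := by positivity
    refine h4.trans (h5.trans ?_)
    nlinarith [mul_le_mul_of_nonneg_left (show 4 * Real.log 2 ≤ 3 * Real.log N by linarith) h7]

/-- Primes `p ≤ 16 N` with `m ∣ ⌊f p⌋` exist uniformly for `2 ≤ m ≤ N ^ σ`. -/
theorem exists_prime_le_floor_powSum_dvd {d : ℕ} (α θ : Fin (d + 1) → ℝ) (hθ : StrictMono θ)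
    (hα : α (Fin.last d) ≠ 0) {Θ : ℝ} (hΘ : θ (Fin.last d) = Θ) (h3 : 3 < Θ)
    (hnonint : ∀ z : ℤ, (z : ℝ) ≠ Θ) {D ρ σ : ℝ}
    (hD : D = 8 * Θ ^ 2 + 12 * Θ + 10) (hρ : ρ = 1 / D) (hσ : σ < ρ) :
    ∃ N₀ ≥ (3 : ℝ), ∀ N ≥ N₀, ∀ m : ℕ, 2 ≤ m → (m : ℝ) ≤ N ^ σ →
      ∃ p : ℕ, p.Prime ∧ (p : ℝ) ≤ 16 * N ∧ (m : ℤ) ∣ ⌊powSum α θ p⌋ := by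
  obtain ⟨τ, hτ⟩ : ∃ τ : ℝ, τ = ρ / 10 ^ 4 := ⟨_, rfl⟩
  obtain ⟨hρ0, hρ1, hτ0, -⟩ := rho_tau_bounds h3 hD hρ hτ
  obtain ⟨C, hC, N₁, hN₁, hS⟩ := exists_vonMangoldt_expSum_bound α θ hθ hα hΘ h3 hnonint
    (M := 16) (by norm_num) hD hρ hτ
  obtain ⟨η, hη0, hη1, hη2⟩ : ∃ η : ℝ, 0 < η ∧ η ≤ (ρ - σ) / 8 ∧ η ≤ τ / 4 :=
    ⟨min ((ρ - σ) / 8) (τ / 4), lt_min (by linarith) (by linarith), min_le_left _ _,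
      min_le_right _ _⟩
  obtain ⟨r, hrη⟩ := exists_nat_ge (1 / η)
  have hr1 : 1 ≤ r := by
    have : (0 : ℝ) < r := lt_of_lt_of_le (by positivity) hrη
    exact_mod_cast this
  have hrη' : 1 ≤ η * r := by
    rw [div_le_iff₀ hη0] at hrη
    linarith
  set K := C / η ^ 2 + 32 / η + 96 with hK
  have hK0 : 96 ≤ K := by
    have : 0 ≤ C / η ^ 2 + 32 / η := by positivity
    linarith
  obtain ⟨N₂, hN₂, hlarge⟩ := exists_forall_le_rpow (K * (2 * r)) hη0
  refine ⟨max N₁ N₂, hN₁.trans (le_max_left _ _), fun N hN m hm hmN => ?_⟩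
  have hNN₁ : N₁ ≤ N := (le_max_left _ _).trans hN
  have hbig := hlarge N ((le_max_right _ _).trans hN)
  have hN3 : 3 ≤ N := hN₁.trans hNN₁
  have hN0 : 0 < N := by linarith
  have hN1 : 1 < N := by linarith
  have hm0 : (0 : ℝ) < m := by exact_mod_cast (by omega : 0 < m)
  have hr1' : (1 : ℝ) ≤ r := by exact_mod_cast hr1
  have hNη1 : 1 ≤ N ^ η := Real.one_le_rpow hN1.le hη0.le
  have hr2 : 2 * (r : ℝ) ≤ N ^ η := by nlinarith
  set L := ⌈(m : ℝ) * N ^ η⌉₊ with hLdef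
  have hL_ge : (m : ℝ) * N ^ η ≤ L := Nat.le_ceil _
  have hmη : 0 < (m : ℝ) * N ^ η := by positivity
  have hL0 : (0 : ℝ) < L := hmη.trans_le hL_ge
  have hL1 : 1 ≤ L := by exact_mod_cast hL0
  have hm1 : (1 : ℝ) ≤ m := by exact_mod_cast (by omega : 1 ≤ m)
  have hL_le : (L : ℝ) ≤ 2 * (m * N ^ η) := by
    have h1 := Nat.ceil_lt_add_one hmη.le
    have h2 : 1 ≤ (m : ℝ) * N ^ η := one_le_mul_of_one_le_of_one_le hm1 hNη1
    linarith
  set R := ⌊16 * N⌋₊ + 1 with hRdef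
  have hR : 16 * N < R := by
    rw [hRdef]; push_cast; exact Nat.lt_floor_add_one _
  have hR2 : (R : ℝ) ≤ 2 * (16 * N) := by
    rw [hRdef]; push_cast
    linarith [Nat.floor_le (show 0 ≤ 16 * N by linarith)]
  obtain ⟨hW1, hW2, hP⟩ := sum_vonMangoldt_Ioc_bounds hN3
  set A := Ioc ⌊N⌋₊ ⌊16 * N⌋₊ with hA
  set W := ∑ n ∈ A, ArithmeticFunction.vonMangoldt n with hWdef
  have hE : ∀ h : ℕ, 1 ≤ h → h < r * L →
      ‖∑ n ∈ A, (ArithmeticFunction.vonMangoldt n : ℂ) * expi (h / m * powSum α θ n)‖ ≤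
        C * (N ^ (1 - ρ) * Real.log N ^ 2) := by
    intro h h1 h2
    have h1' : (1 : ℝ) ≤ h := by exact_mod_cast h1
    have h2' : (h : ℝ) ≤ r * L := by exact_mod_cast h2.le
    have hhm : 0 < (h : ℝ) / m := by positivity
    have hl : N ^ Real.logb N (h / m) = h / m := Real.rpow_logb hN0 hN1.ne' hhm
    have h4 := hS N hNN₁ (Real.logb N (h / m)) ?_ ?_ R hR hR2
    · rwa [filter_range_eq_Ioc hN0.le (by linarith) hR, hl] at h4
    · rw [Real.le_logb_iff_rpow_le hN1 hhm, Real.rpow_neg hN0.le]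
      have h5 : (m : ℝ) ≤ N ^ ρ := hmN.trans (Real.rpow_le_rpow_of_exponent_le hN1.le hσ.le)
      calc (N ^ ρ)⁻¹ ≤ (m : ℝ)⁻¹ := inv_anti₀ hm0 h5
        _ = 1 / m := (one_div _).symm
        _ ≤ h / m := by gcongr
    · rw [Real.logb_le_iff_le_rpow hN1 hhm, div_le_iff₀ hm0]
      have h5 : N ^ η * N ^ η ≤ N ^ τ := by
        rw [← Real.rpow_add hN0]
        exact Real.rpow_le_rpow_of_exponent_le hN1.le (by linarith)
      calc (h : ℝ) ≤ r * L := h2'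
        _ ≤ r * (2 * (m * N ^ η)) := by gcongr
        _ = 2 * r * N ^ η * m := by ring
        _ ≤ N ^ η * N ^ η * m := by gcongr
        _ ≤ N ^ τ * m := by gcongr
  have hlog : Real.log N ≤ N ^ η / η := Real.log_le_rpow_div hN0.le hη0
  have hlog0 : 0 ≤ Real.log N := Real.log_nonneg hN1.le
  set Y := N ^ (1 - σ - 6 * η) with hY
  have hY0 : 0 < Y := by positivity
  have hE1 : C * (N ^ (1 - ρ) * Real.log N ^ 2) ≤ C / η ^ 2 * Y := by
    have h1 : N ^ (1 - ρ) * (N ^ η * N ^ η) ≤ Y := by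
      rw [← Real.rpow_add hN0, ← Real.rpow_add hN0]
      exact Real.rpow_le_rpow_of_exponent_le hN1.le (by linarith)
    calc C * (N ^ (1 - ρ) * Real.log N ^ 2) ≤ C * (N ^ (1 - ρ) * (N ^ η / η) ^ 2) := by gcongr
      _ = C / η ^ 2 * (N ^ (1 - ρ) * (N ^ η * N ^ η)) := by field_simp
      _ ≤ C / η ^ 2 * Y := by gcongr
  have hP1 : 32 * (N ^ (1 / 2 : ℝ) * Real.log N) ≤ 32 / η * Y := by
    have h1 : N ^ (1 / 2 : ℝ) * N ^ η ≤ Y := by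
      rw [← Real.rpow_add hN0]
      exact Real.rpow_le_rpow_of_exponent_le hN1.le (by linarith)
    calc 32 * (N ^ (1 / 2 : ℝ) * Real.log N) ≤ 32 * (N ^ (1 / 2 : ℝ) * (N ^ η / η)) := by gcongr
      _ = 32 / η * (N ^ (1 / 2 : ℝ) * N ^ η) := by ring
      _ ≤ 32 / η * Y := by gcongr
  have hF1 : W * ((m : ℝ) / L) ^ (2 * r) ≤ 96 * Y := by
    have h1 : (m : ℝ) / L ≤ N ^ (-η) := by
      rw [div_le_iff₀ hL0, Real.rpow_neg hN0.le, inv_mul_eq_div, le_div_iff₀ (by positivity)]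
      exact hL_ge
    have h2 : ((m : ℝ) / L) ^ (2 * r) ≤ N ^ (-1 : ℝ) := by
      calc ((m : ℝ) / L) ^ (2 * r) ≤ (N ^ (-η)) ^ (2 * r) := by gcongr
        _ = N ^ (-η * (2 * r : ℕ)) := by rw [Real.rpow_mul hN0.le, Real.rpow_natCast]
        _ ≤ N ^ (-1 : ℝ) := by
          refine Real.rpow_le_rpow_of_exponent_le hN1.le ?_
          push_cast
          linarith
    have h3 : 1 ≤ Y := Real.one_le_rpow hN1.le (by linarith)
    calc W * ((m : ℝ) / L) ^ (2 * r) ≤ 96 * N * N ^ (-1 : ℝ) := by gcongr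
      _ = 96 := by rw [Real.rpow_neg_one]; field_simp
      _ ≤ 96 * Y := by linarith
  have hlower : N ^ (1 - σ - η) / (2 * r) ≤ W / (r * L) := by
    have h1 : (L : ℝ) ≤ 2 * N ^ (σ + η) := by
      rw [Real.rpow_add hN0]
      exact hL_le.trans (by gcongr)
    rw [div_le_div_iff₀ (by positivity) (by positivity)]
    calc N ^ (1 - σ - η) * (r * L) ≤ N ^ (1 - σ - η) * (r * (2 * N ^ (σ + η))) := by gcongr
      _ = N ^ (1 - σ - η) * N ^ (σ + η) * (2 * r) := by ring
      _ = N * (2 * r) := by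
        rw [← Real.rpow_add hN0, show 1 - σ - η + (σ + η) = 1 by ring, Real.rpow_one]
      _ ≤ W * (2 * r) := by gcongr
  have hKY : K * Y < N ^ (1 - σ - η) / (2 * r) := by
    rw [lt_div_iff₀ (by positivity)]
    calc K * Y * (2 * r) = K * (2 * r) * Y := by ring
      _ ≤ N ^ η * Y := by gcongr
      _ = N ^ (1 - σ - 5 * η) := by rw [hY, ← Real.rpow_add hN0]; congr 1; ring
      _ < N ^ (1 - σ - η) := Real.rpow_lt_rpow_of_exponent_lt hN1 (by linarith)
  have hKsum : K * Y = C / η ^ 2 * Y + 32 / η * Y + 96 * Y := by rw [hK]; ring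
  obtain ⟨p, hpA, hp, hdvd⟩ := exists_prime_of_expSum_bound A (fun n => powSum α θ n)
    (by omega : 0 < m) hL1 hr1 (by positivity) hE (by linarith)
  refine ⟨p, hp, ?_, hdvd⟩
  have := (mem_Ioc.1 hpA).2
  exact (Nat.le_floor_iff (by linarith)).1 this

theorem exists_prime_with_floor_multiple
    (f : ℝ → ℝ) (Θ : ℝ) (hf : IsDominantPseudoPoly f Θ) (hΘ : 3 < Θ)
    (ρt : ℝ) (hρt0 : 0 < ρt) (hρt : ρt < (1 / (8 * Θ ^ 2 + 12 * Θ + 10)) / 3)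
    (ε : ℝ) (hε : 0 < ε) :
    ∃ C > (0 : ℝ), ∀ᶠ X : ℕ in atTop, ∀ m : ℕ, 2 ≤ m → (m : ℝ) ≤ (X : ℝ) ^ ρt →
      ∃ p : ℕ, p.Prime ∧ (p : ℝ) ≤ C * (X : ℝ) ^ ((1 : ℝ) / 3 + ε) ∧
        (m : ℤ) ∣ ⌊f p⌋ := by
  obtain ⟨d, α, θ, hα, hθ, -, hlast, hnonint, hf⟩ := hf
  obtain ⟨N₀, hN₀, hmain⟩ := exists_prime_le_floor_powSum_dvd α θ hθ (hα _).ne' hlast hΘ hnonint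
    (σ := 3 * ρt) rfl rfl (by linarith)
  obtain ⟨X₁, hX₁, hlarge⟩ := exists_forall_le_rpow 16 hε
  obtain ⟨X₂, hX₂, hlarge'⟩ := exists_forall_le_rpow N₀ (show (0 : ℝ) < 1 / 3 by norm_num)
  refine ⟨1, one_pos, ?_⟩
  filter_upwards [eventually_ge_atTop ⌈max X₁ X₂⌉₊] with X hX m hm hmX
  have hX' : max X₁ X₂ ≤ X := (Nat.le_ceil _).trans (by exact_mod_cast hX)
  have hX0 : (0 : ℝ) < X := by linarith [le_max_left X₁ X₂]
  have h1 := hlarge X ((le_max_left _ _).trans hX')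
  have h2 := hlarge' X ((le_max_right _ _).trans hX')
  set Y := (X : ℝ) ^ (1 / 3 : ℝ) with hY
  have hY0 : 0 < Y := by positivity
  have hsplit : (X : ℝ) ^ ((1 : ℝ) / 3 + ε) = Y * X ^ ε := Real.rpow_add hX0 _ _
  have hYN : Y ≤ (X : ℝ) ^ ((1 : ℝ) / 3 + ε) / 16 := by
    rw [hsplit, le_div_iff₀ (by norm_num)]
    gcongr
  have hmN : (m : ℝ) ≤ ((X : ℝ) ^ ((1 : ℝ) / 3 + ε) / 16) ^ (3 * ρt) := by
    calc (m : ℝ) ≤ X ^ ρt := hmX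
      _ = Y ^ (3 * ρt) := by
        rw [hY, ← Real.rpow_mul hX0.le]
        congr 1; ring
      _ ≤ _ := by gcongr
  obtain ⟨p, hp, hpN, hdvd⟩ := hmain _ (h2.trans hYN) m hm hmN
  refine ⟨p, hp, by linarith, ?_⟩
  have : f p = powSum α θ p := hf p
  rwa [this]
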